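/- arXiv:1507.04840 — 2 statements merged into one kernel-verified Lean document; each statement's English description precedes it below -/
import Mathlib

section
/- Let F be an algebraically closed field of characteristic zero and assume a_1, …, a_m, b_1, …, b_n ∈ F(t_1, …, t_m, k_1, …, k_n) with all b_j nonzero satisfy the compatibility conditions: D_i(a_j) = D_j(a_i) for 1 ≤ i < j ≤ m; S_i(b_j)/b_j = S_j(b_i)/b_i for 1 ≤ i < j ≤ n; and D_i(b_j)/b_j = S_j(a_i) − a_i for 1 ≤ i ≤ m and 1 ≤ j ≤ n. Then there exist a nonzero rational function f ∈ F(t_1, …, t_m, k_1, …, k_n), a natural number L, rational functions g_0 ∈ F(t_1, …, t_m) and nonzero g_1, …, g_L, h_1, …, h_n ∈ F(t_1, …, t_m), a finite set V ⊂ ℤ^n \ {0}, for each v ∈ V a univariate rational function r_v ∈ F(z) that is a quotient of two monic polynomials, and constants γ_1, …, γ_L, μ_1, …, μ_n ∈ F with each μ_j nonzero, such that: a_i = D_i(g_0) + D_i(f)/f + Σ_{ℓ=1}^{L} γ_ℓ · D_i(g_ℓ)/g_ℓ + Σ_{j=1}^{n} k_j · D_i(h_j)/h_j for all 1 ≤ i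 ≤ m, and b_j = (S_j(f)/f) · μ_j · h_j · ∏_{v ∈ V} ∏_0^{v_j} r_v(v·k + ℓ) for all 1 ≤ j ≤ n, where r_v(v·k + ℓ) denotes substitution of the element v_1 k_1 + ⋯ + v_n k_n + ℓ into r_v. (Structure theorem for compatible rational functions in the mixed continuous–discrete setting.) -/
open MvPolynomial

/-- The two-sided product `∏_0^t α_ℓ`, defined as `∏_{ℓ=0}^{t−1} α_ℓ` if `t ≥ 0`
and as `∏_{ℓ=t}^{−1} α_ℓ⁻¹` if `t < 0`. -/
noncomputable def twoSidedProd {K : Type*} [Field K] (t : ℤ) (α : ℤ → K) : K :=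
  if 0 ≤ t then ∏ ℓ ∈ Finset.range t.toNat, α ℓ
  else ∏ ℓ ∈ Finset.range (-t).toNat, (α (t + ℓ))⁻¹

/-- The field of rational functions `F(t_1, …, t_m, k_1, …, k_n)`: the fraction field
of the polynomial ring in the continuous variables `t_i` (indexed by `Sum.inl`)
and the discrete variables `k_j` (indexed by `Sum.inr`). -/
abbrev MixedField (F : Type*) [Field F] (m n : ℕ) : Type _ :=
  FractionRing (MvPolynomial (Fin m ⊕ Fin n) F)

/-- `g` lies in the subfield `F(t_1, …, t_m)` of `F(t_1, …, t_m, k_1, …, k_n)`,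
i.e. it is a quotient of two polynomials in the variables `t_1, …, t_m` alone. -/
def memContField {F : Type*} [Field F] {m n : ℕ} (g : MixedField F m n) : Prop :=
  ∃ p q : MvPolynomial (Fin m) F, q ≠ 0 ∧
    g = algebraMap (MvPolynomial (Fin m ⊕ Fin n) F) (MixedField F m n)
          (rename Sum.inl p) /
        algebraMap (MvPolynomial (Fin m ⊕ Fin n) F) (MixedField F m n)
          (rename Sum.inl q)

section Order

variable {R K : Type*} [CommRing R] [IsDomain R] [UniqueFactorizationMonoid R]
  [Field K] [Algebra R K] [IsFractionRing R K]

/-- The order of vanishing of `x` along `q`. -/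
noncomputable def ordAt (q : R) (x : K) : ℤ :=
  (multiplicity q (IsFractionRing.num R x) : ℤ) -
    multiplicity q (IsFractionRing.den R x : R)

omit [IsDomain R] [UniqueFactorizationMonoid R] in
theorem algebraMap_ne_zero_of_ne {a : R} (ha : a ≠ 0) : algebraMap R K a ≠ 0 := by
  simpa using ha

theorem finiteMultiplicity_of_prime {q a : R} (hq : Prime q) (ha : a ≠ 0) :
    FiniteMultiplicity q a :=
  FiniteMultiplicity.of_prime_left hq ha

theorem ordAt_div {q a b : R} (hq : Prime q) (ha : a ≠ 0) (hb : b ≠ 0) :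
    ordAt q (algebraMap R K a / algebraMap R K b) = multiplicity q a - multiplicity q b := by
  set x := algebraMap R K a / algebraMap R K b with hx
  have hx0 : x ≠ 0 := div_ne_zero (algebraMap_ne_zero_of_ne ha) (algebraMap_ne_zero_of_ne hb)
  have hn : IsFractionRing.num R x ≠ 0 := by simpa [IsFractionRing.num_eq_zero] using hx0
  have hd : (IsFractionRing.den R x : R) ≠ 0 := nonZeroDivisors.coe_ne_zero _
  have h : IsFractionRing.num R x * b = a * IsFractionRing.den R x := by
    apply IsFractionRing.injective R K
    have h1 := IsFractionRing.mk'_num_den' R x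
    rw [map_mul, map_mul, ← div_eq_div_iff (algebraMap_ne_zero_of_ne hd) (algebraMap_ne_zero_of_ne hb), h1]
  have h2 := congrArg (multiplicity q) h
  rw [multiplicity_mul hq (finiteMultiplicity_of_prime hq (mul_ne_zero hn hb)),
    multiplicity_mul hq (finiteMultiplicity_of_prime hq (mul_ne_zero ha hd))] at h2
  unfold ordAt
  omega

theorem exists_div_ne_zero {x : K} (hx : x ≠ 0) :
    ∃ a b : R, a ≠ 0 ∧ b ≠ 0 ∧ x = algebraMap R K a / algebraMap R K b :=
  ⟨IsFractionRing.num R x, IsFractionRing.den R x,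
    by simpa [IsFractionRing.num_eq_zero] using hx, nonZeroDivisors.coe_ne_zero _,
    (IsFractionRing.mk'_num_den' R x).symm⟩

theorem ordAt_algebraMap {q a : R} (hq : Prime q) (ha : a ≠ 0) :
    ordAt q (algebraMap R K a) = multiplicity q a := by
  have := ordAt_div (K := K) hq ha one_ne_zero
  rwa [map_one, div_one, multiplicity_of_one_right hq.not_isUnit, Nat.cast_zero, sub_zero] at this

theorem ordAt_mul {q : R} (hq : Prime q) {x y : K} (hx : x ≠ 0) (hy : y ≠ 0) :
    ordAt q (x * y) = ordAt q x + ordAt q y := by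
  obtain ⟨a, b, ha, hb, rfl⟩ := exists_div_ne_zero (R := R) hx
  obtain ⟨c, d, hc, hd, rfl⟩ := exists_div_ne_zero (R := R) hy
  rw [div_mul_div_comm, ← map_mul, ← map_mul, ordAt_div hq (mul_ne_zero ha hc) (mul_ne_zero hb hd),
    ordAt_div hq ha hb, ordAt_div hq hc hd,
    multiplicity_mul hq (finiteMultiplicity_of_prime hq (mul_ne_zero ha hc)),
    multiplicity_mul hq (finiteMultiplicity_of_prime hq (mul_ne_zero hb hd))]
  push_cast
  ring

theorem ordAt_one {q : R} (hq : Prime q) : ordAt q (1 : K) = 0 := by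
  have := ordAt_mul (K := K) hq one_ne_zero one_ne_zero
  rw [mul_one] at this
  omega

theorem ordAt_inv {q : R} (hq : Prime q) {x : K} (hx : x ≠ 0) :
    ordAt q x⁻¹ = -ordAt q x := by
  have := ordAt_mul hq hx (inv_ne_zero hx)
  rw [mul_inv_cancel₀ hx, ordAt_one hq] at this
  omega

theorem ordAt_div' {q : R} (hq : Prime q) {x y : K} (hx : x ≠ 0) (hy : y ≠ 0) :
    ordAt q (x / y) = ordAt q x - ordAt q y := by
  rw [div_eq_mul_inv, ordAt_mul hq hx (inv_ne_zero hy), ordAt_inv hq hy, sub_eq_add_neg]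

theorem ordAt_pow {q : R} (hq : Prime q) {x : K} (hx : x ≠ 0) (n : ℕ) :
    ordAt q (x ^ n) = n * ordAt q x := by
  induction n with
  | zero => simp [ordAt_one hq]
  | succ n ih => rw [pow_succ, ordAt_mul hq (pow_ne_zero n hx) hx, ih]; push_cast; ring

theorem ordAt_zpow {q : R} (hq : Prime q) {x : K} (hx : x ≠ 0) (n : ℤ) :
    ordAt q (x ^ n) = n * ordAt q x := by
  obtain ⟨n, rfl | rfl⟩ := n.eq_nat_or_neg
  · rw [zpow_natCast, ordAt_pow hq hx]
  · rw [zpow_neg, zpow_natCast, ordAt_inv hq (pow_ne_zero n hx), ordAt_pow hq hx]; ring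

theorem ordAt_prod {q : R} (hq : Prime q) {ι : Type*} (s : Finset ι) (x : ι → K)
    (hx : ∀ i ∈ s, x i ≠ 0) : ordAt q (∏ i ∈ s, x i) = ∑ i ∈ s, ordAt q (x i) := by
  classical
  induction s using Finset.induction_on with
  | empty => simp [ordAt_one hq]
  | insert i s hi ih =>
    rw [Finset.prod_insert hi, Finset.sum_insert hi, ordAt_mul hq (hx i (by simp))
      (Finset.prod_ne_zero_iff.2 fun j hj => hx j (by simp [hj])),
      ih fun j hj => hx j (by simp [hj])]

theorem ordAt_self {q : R} (hq : Prime q) : ordAt q (algebraMap R K q) = 1 := by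
  rw [ordAt_algebraMap hq hq.ne_zero, multiplicity_self, Nat.cast_one]

theorem ordAt_eq_zero_of_not_dvd {q a : R} (hq : Prime q) (h : ¬ q ∣ a) :
    ordAt q (algebraMap R K a) = 0 := by
  have ha : a ≠ 0 := by rintro rfl; exact h (dvd_zero q)
  rw [ordAt_algebraMap hq ha, multiplicity_eq_zero.2 h, Nat.cast_zero]

theorem ordAt_congr {p q : R} (h : Associated p q) (x : K) : ordAt p x = ordAt q x := by
  simp only [ordAt, multiplicity_eq_of_associated_left h]

theorem dvd_num_or_den_of_ordAt_ne_zero {q : R} {x : K} (h : ordAt q x ≠ 0) :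
    q ∣ IsFractionRing.num R x ∨ q ∣ (IsFractionRing.den R x : R) := by
  by_contra! hc
  rw [ordAt, multiplicity_eq_zero.2 hc.1, multiplicity_eq_zero.2 hc.2] at h
  exact h rfl

theorem dvd_den_of_ordAt_neg {q : R} {x : K} (h : ordAt q x < 0) :
    q ∣ (IsFractionRing.den R x : R) := by
  by_contra hc
  rw [ordAt, multiplicity_eq_zero.2 hc] at h
  omega

theorem ordAt_nonneg_iff {q : R} (hq : Prime q) {x : K} :
    0 ≤ ordAt q x ↔ ∃ a b : R, ¬ q ∣ b ∧ x = algebraMap R K a / algebraMap R K b := by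
  constructor
  · intro h
    refine ⟨IsFractionRing.num R x, IsFractionRing.den R x, fun hd => ?_,
      (IsFractionRing.mk'_num_den' R x).symm⟩
    have hn : ¬ q ∣ IsFractionRing.num R x :=
      fun hn => hq.not_isUnit (IsFractionRing.num_den_reduced R x hn hd)
    have := multiplicity_pos_of_dvd hd
    rw [ordAt, multiplicity_eq_zero.2 hn] at h
    omega
  · rintro ⟨a, b, hb, rfl⟩
    by_cases ha : a = 0
    · subst ha
      rw [map_zero, zero_div, ordAt,
        multiplicity_of_isUnit_right hq.not_isUnit IsFractionRing.isUnit_den_zero]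
      omega
    · have hb0 : b ≠ 0 := by rintro rfl; exact hb (dvd_zero q)
      rw [ordAt_div hq ha hb0, multiplicity_eq_zero.2 hb]
      omega

theorem ordAt_add_nonneg {q : R} (hq : Prime q) {x y : K} (hx : 0 ≤ ordAt q x)
    (hy : 0 ≤ ordAt q y) : 0 ≤ ordAt q (x + y) := by
  rw [ordAt_nonneg_iff hq] at *
  obtain ⟨a, b, hb, rfl⟩ := hx
  obtain ⟨c, d, hd, rfl⟩ := hy
  have hb0 : b ≠ 0 := by rintro rfl; exact hb (dvd_zero q)
  have hd0 : d ≠ 0 := by rintro rfl; exact hd (dvd_zero q)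
  refine ⟨a * d + b * c, b * d, fun h => (hq.dvd_or_dvd h).elim hb hd, ?_⟩
  rw [div_add_div _ _ (algebraMap_ne_zero_of_ne hb0) (algebraMap_ne_zero_of_ne hd0)]
  simp

theorem ordAt_algebraMap_nonneg {q : R} (hq : Prime q) (a : R) :
    0 ≤ ordAt q (algebraMap R K a) :=
  (ordAt_nonneg_iff hq).2 ⟨a, 1, hq.not_dvd_one, by simp⟩

theorem ordAt_mul_nonneg {q : R} (hq : Prime q) {x y : K} (hx : 0 ≤ ordAt q x)
    (hy : 0 ≤ ordAt q y) : 0 ≤ ordAt q (x * y) := by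
  rw [ordAt_nonneg_iff hq] at *
  obtain ⟨a, b, hb, rfl⟩ := hx
  obtain ⟨c, d, hd, rfl⟩ := hy
  exact ⟨a * c, b * d, fun h => (hq.dvd_or_dvd h).elim hb hd, by simp [div_mul_div_comm]⟩

theorem ordAt_neg_nonneg {q : R} (hq : Prime q) {x : K} (hx : 0 ≤ ordAt q x) :
    0 ≤ ordAt q (-x) := by
  rw [ordAt_nonneg_iff hq] at *
  obtain ⟨a, b, hb, rfl⟩ := hx
  exact ⟨-a, b, hb, by rw [map_neg, neg_div]⟩

theorem ordAt_sub_nonneg {q : R} (hq : Prime q) {x y : K} (hx : 0 ≤ ordAt q x)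
    (hy : 0 ≤ ordAt q y) : 0 ≤ ordAt q (x - y) :=
  sub_eq_add_neg x y ▸ ordAt_add_nonneg hq hx (ordAt_neg_nonneg hq hy)

theorem ordAt_sum_nonneg {q : R} (hq : Prime q) {ι : Type*} (s : Finset ι) (x : ι → K)
    (hx : ∀ i ∈ s, 0 ≤ ordAt q (x i)) : 0 ≤ ordAt q (∑ i ∈ s, x i) := by
  classical
  induction s using Finset.induction_on with
  | empty => simpa using ordAt_algebraMap_nonneg (K := K) hq 0
  | insert i s hi ih =>
    rw [Finset.sum_insert hi]
    exact ordAt_add_nonneg hq (hx i (by simp)) (ih fun j hj => hx j (by simp [hj]))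

theorem dvd_of_ordAt_pos {q a : R} (hq : Prime q) (h : 0 < ordAt q (algebraMap R K a)) :
    q ∣ a := by
  by_contra hc
  exact h.ne' (ordAt_eq_zero_of_not_dvd hq hc)

theorem isUnit_of_ordAt_eq_zero {x : K} (hx : x ≠ 0) (h : ∀ q : R, Prime q → ordAt q x = 0) :
    ∃ u : R, IsUnit u ∧ x = algebraMap R K u := by
  have hn : IsFractionRing.num R x ≠ 0 := by simpa [IsFractionRing.num_eq_zero] using hx
  have hd : (IsFractionRing.den R x : R) ≠ 0 := nonZeroDivisors.coe_ne_zero _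
  have hun : IsUnit (IsFractionRing.num R x) := by
    by_contra hu
    obtain ⟨q, hq, hqd⟩ := WfDvdMonoid.exists_irreducible_factor hu hn
    have hqd' : ¬ q ∣ (IsFractionRing.den R x : R) :=
      fun h' => hq.not_isUnit (IsFractionRing.num_den_reduced R x hqd h')
    have := h q (UniqueFactorizationMonoid.irreducible_iff_prime.1 hq)
    have h3 := multiplicity_pos_of_dvd hqd
    rw [ordAt, multiplicity_eq_zero.2 hqd'] at this
    omega
  have hud : IsUnit (IsFractionRing.den R x : R) := by
    by_contra hu
    obtain ⟨q, hq, hqd⟩ := WfDvdMonoid.exists_irreducible_factor hu hd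
    have hqd' : ¬ q ∣ IsFractionRing.num R x :=
      fun h' => hq.not_isUnit (IsFractionRing.num_den_reduced R x h' hqd)
    have := h q (UniqueFactorizationMonoid.irreducible_iff_prime.1 hq)
    have h3 := multiplicity_pos_of_dvd hqd
    rw [ordAt, multiplicity_eq_zero.2 hqd'] at this
    omega
  obtain ⟨v, hv⟩ := hud
  refine ⟨IsFractionRing.num R x * ↑v⁻¹, hun.mul v⁻¹.isUnit, ?_⟩
  conv_lhs => rw [← IsFractionRing.mk'_num_den' R x]
  rw [← hv, map_mul, div_eq_iff (algebraMap_ne_zero_of_ne v.ne_zero), mul_assoc, ← map_mul, Units.inv_mul,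
    map_one, mul_one]

theorem ordAt_map_equiv {q : R} (hq : Prime q) (τ : R ≃+* R) (σ : K ≃+* K)
    (h : ∀ a, σ (algebraMap R K a) = algebraMap R K (τ a)) {x : K} (hx : x ≠ 0) :
    ordAt (τ q) (σ x) = ordAt q x := by
  obtain ⟨a, b, ha, hb, rfl⟩ := exists_div_ne_zero (R := R) hx
  rw [map_div₀, h, h, ordAt_div ((MulEquiv.prime_iff τ).2 hq) (by simpa) (by simpa),
    ordAt_div hq ha hb, multiplicity_map_eq, multiplicity_map_eq]

end Order

section DerivationOrder

variable {F R K : Type*} [Field F] [CharZero F] [CommRing R] [IsDomain R]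
  [UniqueFactorizationMonoid R] [Algebra F R] [Field K] [Algebra R K] [IsFractionRing R K]
  [Algebra F K]
  (D : Derivation F K K) (d : R → R) (hd : ∀ a, D (algebraMap R K a) = algebraMap R K (d a))

include hd

omit [CharZero F] [UniqueFactorizationMonoid R] [Algebra F R] [IsDomain R] in
theorem derivation_algebraMap_div {a b : R} (hb : b ≠ 0) :
    D (algebraMap R K a / algebraMap R K b) =
      algebraMap R K (d a * b - a * d b) / algebraMap R K (b * b) := by
  have hb' : algebraMap R K b ≠ 0 := by simpa using hb
  rw [Derivation.leibniz_div]
  simp only [hd, map_sub, map_mul, smul_eq_mul]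
  field_simp

omit [CharZero F] [Algebra F R] in
theorem ordAt_derivation_nonneg {q : R} (hq : Prime q) {x : K} (hx : 0 ≤ ordAt q x) :
    0 ≤ ordAt q (D x) := by
  rw [ordAt_nonneg_iff hq] at *
  obtain ⟨a, b, hb, rfl⟩ := hx
  have hb0 : b ≠ 0 := by rintro rfl; exact hb (dvd_zero q)
  exact ⟨_, b * b, fun h => (hq.dvd_or_dvd h).elim hb hb, derivation_algebraMap_div D d hd hb0⟩

omit [CharZero F] [Algebra F R] in
theorem ordAt_logDeriv_nonneg {q : R} (hq : Prime q) {x : K} (hx0 : x ≠ 0)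
    (hx : ordAt q x = 0) : 0 ≤ ordAt q (D x / x) := by
  rw [div_eq_mul_inv]
  refine ordAt_mul_nonneg hq (ordAt_derivation_nonneg D d hd hq hx.ge) ?_
  rw [ordAt_inv hq hx0, hx, neg_zero]

theorem ordAt_logDeriv {q : R} (hq : Prime q) (hdq : ¬ q ∣ d q) {x : K} (hx0 : x ≠ 0)
    (hx : ordAt q x ≠ 0) : D x / x ≠ 0 ∧ ordAt q (D x / x) = -1 := by
  set n := ordAt q x with hn
  set Q := algebraMap R K q with hQ
  have hQ0 : Q ≠ 0 := by simpa [hQ] using hq.ne_zero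
  set y := x / Q ^ n with hy
  have hQn : Q ^ n ≠ 0 := zpow_ne_zero n hQ0
  have hy0 : y ≠ 0 := div_ne_zero hx0 hQn
  have hxy : x = Q ^ n * y := by rw [hy]; field_simp
  have hyo : ordAt q y = 0 := by
    rw [hy, ordAt_div' hq hx0 hQn, ordAt_zpow hq hQ0, ordAt_self hq, mul_one, hn, sub_self]
  have hlog : D x / x = (n * algebraMap R K (d q) + D y / y * Q) / Q := by
    rw [hxy, D.leibniz, D.leibniz_zpow, hd, smul_eq_mul, smul_eq_mul, smul_eq_mul, zsmul_eq_mul,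
      zpow_sub_one₀ hQ0]
    field_simp
    ring
  have hly := ordAt_logDeriv_nonneg D d hd hq hy0 hyo
  rw [ordAt_nonneg_iff hq] at hly
  obtain ⟨a, b, hb, hab⟩ := hly
  have hb0 : b ≠ 0 := by rintro rfl; exact hb (dvd_zero q)
  have hbK : algebraMap R K b ≠ 0 := by simpa using hb0
  have hz : (n * algebraMap R K (d q) + D y / y * Q) =
      algebraMap R K (n * d q * b + a * q) / algebraMap R K b := by
    rw [hab, ← hQ.symm]
    simp only [map_add, map_mul, map_intCast]
    field_simp
  have hnd : ¬ q ∣ (n : R) := by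
    intro h
    refine hq.not_isUnit (isUnit_of_dvd_unit h ?_)
    have : IsUnit ((n : ℤ) : F) := by simpa using hx
    simpa using this.map (algebraMap F R)
  have hnum : ¬ q ∣ n * d q * b + a * q := by
    intro h
    have h1 : q ∣ n * d q * b := by
      have := dvd_sub h (Dvd.intro_left a rfl)
      simpa using this
    rcases hq.dvd_or_dvd h1 with h2 | h2
    · exact (hq.dvd_or_dvd h2).elim hnd hdq
    · exact hb h2
  have hnum0 : (n : R) * d q * b + a * q ≠ 0 := by
    intro h; rw [h] at hnum; exact hnum (dvd_zero q)
  have hz0 : algebraMap R K (n * d q * b + a * q) ≠ 0 := algebraMap_ne_zero_of_ne hnum0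
  rw [hlog, hz]
  refine ⟨div_ne_zero (div_ne_zero hz0 hbK) hQ0, ?_⟩
  rw [ordAt_div' hq (div_ne_zero hz0 hbK) hQ0, ordAt_div' hq hz0 hbK, ordAt_self hq,
    ordAt_eq_zero_of_not_dvd hq hnum, ordAt_eq_zero_of_not_dvd hq hb]
  rfl

end DerivationOrder

namespace Polynomial

/-- The derivation of `k[X]` acting on coefficients through a derivation of `k`. -/
noncomputable def coeffDeriv {F k : Type*} [Field F] [Field k] [Algebra F k]
    (δ : Derivation F k k) : Derivation F k[X] k[X] :=
  (PolynomialModule.equivPolynomialSelf (R := k)).toLinearMap.compDer δ.mapCoeffs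

section

variable {F k : Type*} [Field F] [Field k] [Algebra F k] (δ : Derivation F k k)

theorem coeff_coeffDeriv (p : k[X]) (n : ℕ) : (coeffDeriv δ p).coeff n = δ (p.coeff n) := rfl

theorem coeffDeriv_C (x : k) : coeffDeriv δ (C x) = C (δ x) := by
  ext n
  rw [coeff_coeffDeriv, coeff_C, coeff_C]
  split_ifs <;> simp

theorem coeffDeriv_X : coeffDeriv δ (X : k[X]) = 0 := by
  ext n
  rw [coeff_coeffDeriv, coeff_X]
  split_ifs <;> simp

theorem coeffDeriv_derivative (p : k[X]) :
    coeffDeriv δ (derivative p) = derivative (coeffDeriv δ p) := by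
  ext n
  rw [coeff_coeffDeriv, coeff_derivative, coeff_derivative, coeff_coeffDeriv, Derivation.leibniz]
  have : δ ((n : k) + 1) = 0 := by
    rw [map_add, Derivation.map_natCast, Derivation.map_one_eq_zero, add_zero]
  rw [this, smul_zero, zero_add, smul_eq_mul, mul_comm]

theorem degree_coeffDeriv_lt {p : k[X]} (hp : p.Monic) : (coeffDeriv δ p).degree < p.degree := by
  rw [degree_eq_natDegree hp.ne_zero, degree_lt_iff_coeff_zero]
  intro n hn
  rw [coeff_coeffDeriv]
  rcases hn.eq_or_lt with rfl | hn
  · rw [hp.coeff_natDegree, Derivation.map_one_eq_zero]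
  · rw [coeff_eq_zero_of_natDegree_lt hn, map_zero]

/-- The derivation `π.derivative • δ - δ π • ∂`, which preserves the ideal generated by `π`. -/
noncomputable def tangentDeriv (π : k[X]) : Derivation F k[X] k[X] :=
  derivative π • coeffDeriv δ - coeffDeriv δ π • (derivative' : Derivation k k[X] k[X]).restrictScalars F

theorem tangentDeriv_apply (π p : k[X]) : tangentDeriv δ π p =
    derivative π * coeffDeriv δ p - coeffDeriv δ π * derivative p := rfl

theorem tangentDeriv_aeval (π ρ χ : k[X]) : tangentDeriv δ π (aeval ρ χ) =
    derivative π * aeval ρ (coeffDeriv δ χ) + aeval ρ (derivative χ) * tangentDeriv δ π ρ := by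
  induction χ using Polynomial.induction_on' with
  | add p q hp hq => simp only [map_add, hp, hq]; ring
  | monomial n a =>
    have h1 : tangentDeriv δ π (C a) = derivative π * C (δ a) := by
      rw [tangentDeriv_apply, coeffDeriv_C, derivative_C, mul_zero, sub_zero]
    have h2 : coeffDeriv δ (X ^ n : k[X]) = 0 := by
      rw [Derivation.leibniz_pow, coeffDeriv_X, smul_zero, smul_zero]
    rw [← C_mul_X_pow_eq_monomial, Derivation.leibniz, h2, coeffDeriv_C, smul_zero,
      zero_add, smul_eq_mul]
    simp only [map_mul, map_pow, aeval_X, aeval_C, Polynomial.algebraMap_eq, Derivation.leibniz,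
      Derivation.leibniz_pow, h1, smul_eq_mul, nsmul_eq_mul, derivative_C_mul_X_pow, map_natCast]
    ring

theorem not_dvd_derivative [CharZero k] {π : k[X]} (hπ : Irreducible π) :
    ¬ π ∣ derivative π := by
  intro h
  have h0 : derivative π = 0 := by
    by_contra h0
    exact (degree_le_of_dvd h h0).not_gt (degree_derivative_lt hπ.ne_zero)
  exact hπ.natDegree_pos.ne' (derivative_eq_zero.1 h0)

theorem exists_derivative_eq [CharZero k] (p : k[X]) : ∃ P : k[X], derivative P = p := by
  induction p using Polynomial.induction_on' with
  | add p q hp hq =>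
    obtain ⟨P, rfl⟩ := hp
    obtain ⟨Q, rfl⟩ := hq
    exact ⟨P + Q, derivative_add⟩
  | monomial n a =>
    refine ⟨monomial (n + 1) (a / (n + 1 : k)), ?_⟩
    rw [derivative_monomial, Nat.add_sub_cancel]
    have : (n + 1 : k) ≠ 0 := by exact_mod_cast n.succ_ne_zero
    push_cast
    rw [div_mul_cancel₀ _ this]

theorem exists_const_of_dvd_tangentDeriv [CharZero F] [IsAlgClosed F] {ι : Type*}
    (δ : ι → Derivation F k k)
    (hconst : ∀ x : k, (∀ i, δ i x = 0) → x ∈ Set.range (algebraMap F k))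
    {π ρ : k[X]} (hπ : Irreducible π) (h : ∀ i, π ∣ tangentDeriv (δ i) π ρ) :
    ∃ γ : F, π ∣ ρ - C (algebraMap F k γ) := by
  have : CharZero k := charZero_of_injective_algebraMap (algebraMap F k).injective
  have : Fact (Irreducible π) := ⟨hπ⟩
  have hπ' := UniqueFactorizationMonoid.irreducible_iff_prime.1 hπ
  set r := AdjoinRoot.mk π ρ with hr
  have haeval (p : k[X]) : aeval r p = AdjoinRoot.mk π (aeval ρ p) := by
    induction p using Polynomial.induction_on' with
    | add p q hp hq => simp only [map_add, hp, hq]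
    | monomial n a =>
      simp only [aeval_monomial, map_mul, map_pow, hr]
      rfl
  have : Module.Finite k (AdjoinRoot π) := (AdjoinRoot.powerBasis hπ.ne_zero).finite
  have hint : IsIntegral k r := .of_finite k r
  set χ := minpoly k r with hχ
  have hχm : χ.Monic := minpoly.monic hint
  have hδ (i : ι) : coeffDeriv (δ i) χ = 0 := by
    have h1 : π ∣ aeval ρ χ := by
      rw [← AdjoinRoot.mk_eq_zero, ← haeval, hχ, minpoly.aeval]
    have h2 : π ∣ tangentDeriv (δ i) π (aeval ρ χ) := by
      obtain ⟨e, he⟩ := h1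
      have h0 : tangentDeriv (δ i) π π = 0 := by rw [tangentDeriv_apply]; ring
      rw [he, Derivation.leibniz, h0, smul_zero, add_zero]
      exact Dvd.intro _ rfl
    rw [tangentDeriv_aeval] at h2
    have h3 := (dvd_add_left ((h i).mul_left _)).1 h2
    have h4 := (hπ'.dvd_or_dvd h3).resolve_left (not_dvd_derivative hπ)
    rw [← AdjoinRoot.mk_eq_zero, ← haeval] at h4
    by_contra h5
    exact (minpoly.degree_le_of_ne_zero k r h5 h4).not_gt (degree_coeffDeriv_lt (δ i) hχm)
  have hlift : χ ∈ lifts (algebraMap F k) := by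
    rw [lifts_iff_coeff_lifts]
    intro n
    refine hconst _ fun i => ?_
    rw [← coeff_coeffDeriv, hδ, coeff_zero]
  obtain ⟨χ₀, hχ₀, -, hχ₀m⟩ := lifts_and_natDegree_eq_and_monic hlift hχm
  have hintF : IsIntegral F r := by
    refine ⟨χ₀, hχ₀m, ?_⟩
    have := minpoly.aeval k r
    rw [← hχ, ← hχ₀, aeval_map_algebraMap] at this
    exact this
  have hdeg := IsAlgClosed.degree_eq_one_of_irreducible F (minpoly.irreducible hintF)
  obtain ⟨γ, hγ⟩ := minpoly.mem_range_of_degree_eq_one F r hdeg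
  refine ⟨γ, ?_⟩
  rw [← AdjoinRoot.mk_eq_zero, map_sub, ← hr, ← hγ, sub_eq_zero]
  rfl

end

end Polynomial

namespace Polynomial

section

variable {F k K : Type*} [Field F] [Field k] [Field K] [Algebra F k] [Algebra F K]
  [Algebra k[X] K] [IsFractionRing k[X] K] [IsScalarTower F k[X] K] [CharZero F]
  (E : Derivation F K K) (hE : ∀ p : k[X], E (algebraMap k[X] K p) = algebraMap k[X] K (derivative p))

include hE

omit [IsScalarTower F k[X] K] in
/-- Up to a derivative, every rational function has only simple poles. -/
theorem exists_hermite_reduction (x : K) : ∃ (g : K) (s : k[X] →₀ k[X]),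
    (∀ π ∈ s.support, π.Monic ∧ Irreducible π) ∧
      x = E g + s.sum fun π r => algebraMap k[X] K r / algebraMap k[X] K π := by
  have : CharZero k := charZero_of_injective_algebraMap (algebraMap F k).injective
  set Q : K → Prop := fun x => ∃ (g : K) (s : k[X] →₀ k[X]),
    (∀ π ∈ s.support, π.Monic ∧ Irreducible π) ∧
      x = E g + s.sum fun π r => algebraMap k[X] K r / algebraMap k[X] K π with hQ
  have hadd {x y : K} (hx : Q x) (hy : Q y) : Q (x + y) := by
    classical
    obtain ⟨g, s, hs, rfl⟩ := hx
    obtain ⟨g', s', hs', rfl⟩ := hy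
    refine ⟨g + g', s + s', fun π hπ => ?_, ?_⟩
    · rcases Finset.mem_union.1 (Finsupp.support_add hπ) with h | h
      exacts [hs π h, hs' π h]
    · rw [Finsupp.sum_add_index' (by simp) (by intros; rw [map_add, add_div]), map_add]
      ring
  have hder (g : K) : Q (E g) := ⟨g, 0, by simp, by simp⟩
  have hpoly (p : k[X]) : Q (algebraMap k[X] K p) := by
    obtain ⟨P, rfl⟩ := exists_derivative_eq p
    rw [← hE]
    exact hder _
  have hpow {π : k[X]} (hm : π.Monic) (hi : Irreducible π) (j : ℕ) :
      ∀ r : k[X], Q (algebraMap k[X] K r / algebraMap k[X] K π ^ j) := by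
    induction j with
    | zero => intro r; simpa using hpoly r
    | succ j ih =>
      intro r
      have hP : algebraMap k[X] K π ≠ 0 := by simpa using hi.ne_zero
      rcases Nat.eq_zero_or_pos j with rfl | hj
      · refine ⟨0, Finsupp.single π r, fun π' h => ?_, ?_⟩
        · rw [Finset.mem_singleton.1 (Finsupp.support_single_subset h)]
          exact ⟨hm, hi⟩
        · rw [Finsupp.sum_single_index (by simp)]
          simp
      · have hcop : IsCoprime π (derivative π) :=
          (hi.coprime_iff_not_dvd).2 (not_dvd_derivative hi)
        obtain ⟨u, v, huv⟩ := hcop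
        have hj0 : (j : k) ≠ 0 := by exact_mod_cast hj.ne'
        set w : k[X] := C (j : k)⁻¹ * (r * v) with hw
        have hjw : (j : k[X]) * w = r * v := by
          rw [hw, ← C_eq_natCast, ← mul_assoc, ← C_mul, mul_inv_cancel₀ hj0, C_1, one_mul]
        have key : algebraMap k[X] K r / algebraMap k[X] K π ^ (j + 1) =
            algebraMap k[X] K (r * u + derivative w) / algebraMap k[X] K π ^ j +
              E (-(algebraMap k[X] K w / algebraMap k[X] K π ^ j)) := by
          have hr : algebraMap k[X] K r = algebraMap k[X] K (r * u) * algebraMap k[X] K π +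
              (j : K) * algebraMap k[X] K w * algebraMap k[X] K (derivative π) := by
            rw [← map_natCast (algebraMap k[X] K), ← map_mul, ← map_mul, ← map_mul, ← map_add, hjw]
            congr 1
            linear_combination (-r) * huv
          obtain ⟨i, rfl⟩ : ∃ i, j = i + 1 := ⟨j - 1, by omega⟩
          rw [map_neg, Derivation.leibniz_div, hE, Derivation.leibniz_pow, hE, hr]
          simp only [smul_eq_mul, nsmul_eq_mul, map_add, map_mul, Nat.add_sub_cancel]
          field_simp
          ring
        rw [key]
        exact hadd (ih _) (hder _)
  have hfrac (b : k[X]) : b ≠ 0 → ∀ a : k[X], Q (algebraMap k[X] K a / algebraMap k[X] K b) := by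
    induction b using UniqueFactorizationMonoid.induction_on_coprime with
    | h0 => exact fun h => (h rfl).elim
    | h1 hu =>
      intro _ a
      obtain ⟨c, hc⟩ := hu.exists_right_inv
      have hb := congrArg (algebraMap k[X] K) hc
      rw [map_mul, map_one] at hb
      rw [div_eq_mul_inv, ← eq_inv_of_mul_eq_one_right hb, ← map_mul]
      exact hpoly _
    | hpr i hp =>
      rename_i p
      intro hne a
      have hi := hp.irreducible
      have hl : p.leadingCoeff ≠ 0 := leadingCoeff_ne_zero.2 hp.ne_zero
      have hm := monic_mul_leadingCoeff_inv hp.ne_zero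
      have hi' : Irreducible (p * C p.leadingCoeff⁻¹) := irreducible_mul_leadingCoeff_inv.2 hi
      have := hpow hm hi' i (a * C p.leadingCoeff⁻¹ ^ i)
      have hc : algebraMap k[X] K (C p.leadingCoeff⁻¹) ≠ 0 := by simpa using hl
      rwa [map_mul, map_mul, map_pow, mul_pow,
        mul_div_mul_right _ _ (pow_ne_zero i hc), ← map_pow] at this
    | hcp hxy ihx ihy =>
      rename_i x y
      intro hne a
      have hx := left_ne_zero_of_mul hne
      have hy := right_ne_zero_of_mul hne
      obtain ⟨u, v, huv⟩ := hxy.isCoprime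
      have key : algebraMap k[X] K a / algebraMap k[X] K (x * y) =
          algebraMap k[X] K (a * v) / algebraMap k[X] K x +
            algebraMap k[X] K (a * u) / algebraMap k[X] K y := by
        have hx' : algebraMap k[X] K x ≠ 0 := by simpa using hx
        have hy' : algebraMap k[X] K y ≠ 0 := by simpa using hy
        rw [div_add_div _ _ hx' hy', map_mul (algebraMap k[X] K) x y]
        congr 1
        rw [← map_mul, ← map_mul, ← map_add]
        congr 1
        linear_combination (-a) * huv
      rw [key]
      exact hadd (ihx hx _) (ihy hy _)
  rw [← IsFractionRing.mk'_num_den' k[X] x]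
  exact hfrac _ (nonZeroDivisors.coe_ne_zero _) _

omit [IsScalarTower F k[X] K] in
theorem dvd_tangentDeriv (D : Derivation F K K) (δ : Derivation F k k)
    (hD : ∀ p : k[X], D (algebraMap k[X] K p) = algebraMap k[X] K (coeffDeriv δ p))
    {π ρ : k[X]} (hπ : Irreducible π) {y c : K} (hy : 0 ≤ ordAt π y)
    (h : D (algebraMap k[X] K (ρ * derivative π) / algebraMap k[X] K π + y) = E c) :
    π ∣ tangentDeriv δ π ρ := by
  have : CharZero k := charZero_of_injective_algebraMap (algebraMap F k).injective
  have hπ' := UniqueFactorizationMonoid.irreducible_iff_prime.1 hπ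
  have hP : algebraMap k[X] K π ≠ 0 := by simpa using hπ.ne_zero
  set u := c - algebraMap k[X] K (ρ * coeffDeriv δ π) / algebraMap k[X] K π with hu
  have hEu : E u = algebraMap k[X] K (tangentDeriv δ π ρ) / algebraMap k[X] K π + D y := by
    rw [hu, map_sub, ← h, map_add, Derivation.leibniz_div, Derivation.leibniz_div, hD, hE, hD, hE,
      tangentDeriv_apply]
    simp only [Derivation.leibniz, derivative_mul, coeffDeriv_derivative, smul_eq_mul, map_add,
      map_sub, map_mul]
    field_simp
    ring
  have hDy := ordAt_derivation_nonneg D _ hD hπ' hy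
  have hreg : 0 ≤ ordAt π u := by
    by_contra hneg
    have hu0 : u ≠ 0 := by
      rintro h0
      rw [h0] at hneg
      exact hneg (by simpa using ordAt_algebraMap_nonneg (K := K) hπ' 0)
    obtain ⟨h1, h2⟩ := ordAt_logDeriv E _ hE hπ' (not_dvd_derivative hπ) hu0 (by omega)
    have hE0 : E u ≠ 0 := fun h0 => h1 (by rw [h0, zero_div])
    rw [ordAt_div' hπ' hE0 hu0] at h2
    have h3 : 0 ≤ ordAt π (algebraMap k[X] K π * E u) := by
      rw [hEu, mul_add, mul_div_cancel₀ _ hP]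
      exact ordAt_add_nonneg hπ' (ordAt_algebraMap_nonneg hπ' _)
        (ordAt_mul_nonneg hπ' (ordAt_algebraMap_nonneg hπ' _) hDy)
    rw [ordAt_mul hπ' hP hE0, ordAt_self hπ'] at h3
    omega
  have h4 : 0 ≤ ordAt π (algebraMap k[X] K (tangentDeriv δ π ρ) / algebraMap k[X] K π) := by
    have h5 := ordAt_sub_nonneg hπ' (ordAt_derivation_nonneg E _ hE hπ' hreg) hDy
    rwa [hEu, add_sub_cancel_right] at h5
  by_cases h0 : tangentDeriv δ π ρ = 0
  · rw [h0]; exact dvd_zero _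
  · rw [ordAt_div' hπ' (by simpa using h0) hP, ordAt_self hπ'] at h4
    exact dvd_of_ordAt_pos (K := K) hπ' (by omega)

theorem exists_logDeriv_sum [IsAlgClosed F] {ι : Type*}
    (D : ι → Derivation F K K) (δ : ι → Derivation F k k)
    (hD : ∀ i (p : k[X]), D i (algebraMap k[X] K p) = algebraMap k[X] K (coeffDeriv (δ i) p))
    (hcomm : ∀ i x, D i (E x) = E (D i x))
    (hconst : ∀ x : k, (∀ i, δ i x = 0) → x ∈ Set.range (algebraMap F k))
    {a : K} {c : ι → K} (h : ∀ i, D i a = E (c i)) :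
    ∃ (g : K) (γ : K →₀ F), a = E g + γ.sum fun x r => r • (E x / x) := by
  classical
  have : CharZero k := charZero_of_injective_algebraMap (algebraMap F k).injective
  obtain ⟨g, s, hs, rfl⟩ := exists_hermite_reduction E hE a
  set Q : K → Prop := fun x => ∃ (g : K) (γ : K →₀ F), x = E g + γ.sum fun x r => r • (E x / x)
    with hQ
  have hadd {x y : K} (hx : Q x) (hy : Q y) : Q (x + y) := by
    obtain ⟨g, s, rfl⟩ := hx
    obtain ⟨g', s', rfl⟩ := hy
    refine ⟨g + g', s + s', ?_⟩
    rw [Finsupp.sum_add_index' (by simp) (by intros; rw [add_smul]), map_add]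
    ring
  have hder (g : K) : Q (E g) := ⟨g, 0, by simp⟩
  have hpoly (p : k[X]) : Q (algebraMap k[X] K p) := by
    obtain ⟨P, rfl⟩ := exists_derivative_eq p
    rw [← hE]
    exact hder _
  have hterm : ∀ π ∈ s.support, Q (algebraMap k[X] K (s π) / algebraMap k[X] K π) := by
    intro π hπs
    have hi := (hs π hπs).2
    have hi' := UniqueFactorizationMonoid.irreducible_iff_prime.1 hi
    have hP : algebraMap k[X] K π ≠ 0 := by simpa using hi.ne_zero
    obtain ⟨u, v, huv⟩ : IsCoprime π (derivative π) :=
      (hi.coprime_iff_not_dvd).2 (not_dvd_derivative hi)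
    have key : algebraMap k[X] K (s π) / algebraMap k[X] K π =
        algebraMap k[X] K (s π * v * derivative π) / algebraMap k[X] K π +
          algebraMap k[X] K (s π * u) := by
      have : s π = s π * v * derivative π + s π * u * π := by linear_combination (-s π) * huv
      conv_lhs => rw [this]
      rw [map_add, map_mul _ _ π]
      field_simp
    set y := algebraMap k[X] K (s π * u) + ∑ q ∈ s.support.erase π,
      algebraMap k[X] K (s q) / algebraMap k[X] K q with hy
    have hyreg : 0 ≤ ordAt π y := by
      refine ordAt_add_nonneg hi' (ordAt_algebraMap_nonneg hi' _)
        (ordAt_sum_nonneg hi' _ _ fun q hq => ?_)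
      obtain ⟨hne, hqs⟩ := Finset.mem_erase.1 hq
      refine (ordAt_nonneg_iff hi').2 ⟨_, _, fun hdvd => hne ?_, rfl⟩
      exact (eq_of_monic_of_associated (hs π hπs).1 (hs q hqs).1
        (hi.associated_of_dvd (hs q hqs).2 hdvd)).symm
    have hsum : (s.sum fun π r => algebraMap k[X] K r / algebraMap k[X] K π) =
        algebraMap k[X] K (s π * v * derivative π) / algebraMap k[X] K π + y := by
      rw [Finsupp.sum, ← Finset.add_sum_erase _ _ hπs, key, hy]
      ring
    have hdvd (i : ι) : π ∣ tangentDeriv (δ i) π (s π * v) := by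
      refine dvd_tangentDeriv E hE (D i) (δ i) (hD i) hi hyreg (c := c i - D i g) ?_
      rw [← hsum, map_sub, ← h i, map_add, hcomm]
      ring
    obtain ⟨γ, e, hγ⟩ := exists_const_of_dvd_tangentDeriv δ hconst hi hdvd
    have key2 : algebraMap k[X] K (s π) / algebraMap k[X] K π =
        γ • (E (algebraMap k[X] K π) / algebraMap k[X] K π) +
          algebraMap k[X] K (s π * u + e * derivative π) := by
      have hγ' : algebraMap k[X] K (C (algebraMap F k γ)) = algebraMap F K γ := by
        rw [IsScalarTower.algebraMap_apply F k[X] K]; rfl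
      rw [key, sub_eq_iff_eq_add.1 hγ, hE, Algebra.smul_def, ← hγ']
      simp only [map_add, map_mul]
      field_simp
      ring
    rw [key2]
    refine hadd ⟨0, Finsupp.single (algebraMap k[X] K π) γ, ?_⟩ (hpoly _)
    rw [Finsupp.sum_single_index (by simp)]
    simp
  refine hadd (hder g) ?_
  have hall : ∀ t ⊆ s.support, Q (∑ π ∈ t, algebraMap k[X] K (s π) / algebraMap k[X] K π) := by
    intro t
    induction t using Finset.induction_on with
    | empty => intro _; exact ⟨0, 0, by simp⟩
    | insert π t hπ ih =>
      intro ht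
      rw [Finset.sum_insert hπ]
      exact hadd (hterm π (ht (by simp))) (ih fun x hx => ht (by simp [hx]))
  exact hall _ subset_rfl

omit [IsScalarTower F k[X] K] in
theorem mem_range_C_of_derivation_eq_zero {x : K} (hx : E x = 0) :
    ∃ r : k, x = algebraMap k[X] K (C r) := by
  have : CharZero k := charZero_of_injective_algebraMap (algebraMap F k).injective
  rcases eq_or_ne x 0 with rfl | hx0
  · exact ⟨0, by simp⟩
  · obtain ⟨u, hu, rfl⟩ := isUnit_of_ordAt_eq_zero (R := k[X]) hx0 fun q hq => by
      by_contra hne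
      refine (ordAt_logDeriv E _ hE hq (not_dvd_derivative hq.irreducible) hx0 hne).1 ?_
      rw [hx, zero_div]
    obtain ⟨r, -, rfl⟩ := isUnit_iff.1 hu
    exact ⟨r, rfl⟩

end

end Polynomial

section ClosedForms

universe u

variable {F : Type*} {K : Type u} [Field F] [Field K] [Algebra F K]

theorem IntermediateField.derivation_mem_of_mem_adjoin (D : Derivation F K K) {s : Set K}
    {L : IntermediateField F K} (hs : adjoin F s ≤ L) (h : ∀ x ∈ s, D x ∈ L) {x : K}
    (hx : x ∈ adjoin F s) : D x ∈ L := by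
  induction hx using adjoin_induction with
  | mem x hx => exact h x hx
  | algebraMap x => rw [D.map_algebraMap]; exact zero_mem _
  | add x y _ _ hx hy => rw [map_add]; exact add_mem hx hy
  | inv x hx h =>
    rw [D.leibniz_inv, smul_eq_mul]
    exact mul_mem (neg_mem (pow_mem (inv_mem (hs hx)) 2)) h
  | mul x y hx hy h1 h2 =>
    rw [D.leibniz, smul_eq_mul, smul_eq_mul]
    exact add_mem (mul_mem (hs hx) h2) (mul_mem (hs hy) h1)

theorem IntermediateField.derivation_eq_zero_of_mem_adjoin (D : Derivation F K K) {s : Set K}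
    (h : ∀ x ∈ s, D x = 0) {x : K} (hx : x ∈ adjoin F s) : D x = 0 := by
  induction hx using adjoin_induction with
  | mem x hx => exact h x hx
  | algebraMap x => exact D.map_algebraMap x
  | add x y _ _ hx hy => rw [map_add, hx, hy, add_zero]
  | inv x _ h => rw [D.leibniz_inv, h, smul_zero]
  | mul x y _ _ h1 h2 => rw [D.leibniz, h1, h2, smul_zero, smul_zero, add_zero]

/-- The restriction of a derivation to an intermediate field it preserves. -/
def IntermediateField.restrictDerivation (L : IntermediateField F K) (D : Derivation F K K)
    (h : ∀ x ∈ L, D x ∈ L) : Derivation F L L :=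
  Derivation.mk'
    { toFun x := ⟨D x, h x x.2⟩
      map_add' x y := Subtype.ext (D.map_add x y)
      map_smul' r x := Subtype.ext (D.map_smul r x) }
    fun x y => Subtype.ext (D.leibniz x y)

theorem IntermediateField.coe_restrictDerivation (L : IntermediateField F K)
    (D : Derivation F K K) (h : ∀ x ∈ L, D x ∈ L) (x : L) :
    (L.restrictDerivation D h x : K) = D x := rfl

theorem Derivation.map_div_comm (D₁ D₂ : Derivation F K K) (h : ∀ x, D₁ (D₂ x) = D₂ (D₁ x)) (x : K) :
    D₁ (D₂ x / x) = D₂ (D₁ x / x) := by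
  rw [Derivation.leibniz_div, Derivation.leibniz_div, h]
  simp only [smul_eq_mul]
  ring

/-- The family `a` is the gradient of a rational function plus a combination of logarithmic
gradients. -/
def IsElementaryGradient {ι : Type*} (D : ι → Derivation F K K) (a : ι → K) : Prop :=
  ∃ (g : K) (γ : K →₀ F), ∀ i, a i = D i g + γ.sum fun x r => r • (D i x / x)

theorem IsElementaryGradient.add {ι : Type*} {D : ι → Derivation F K K} {a b : ι → K}
    (ha : IsElementaryGradient D a) (hb : IsElementaryGradient D b) :
    IsElementaryGradient D fun i => a i + b i := by
  classical
  obtain ⟨g, s, ha⟩ := ha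
  obtain ⟨g', s', hb⟩ := hb
  refine ⟨g + g', s + s', fun i => ?_⟩
  beta_reduce
  rw [Finsupp.sum_add_index' (by simp) (by intros; rw [add_smul]), map_add, ha, hb]
  ring

section Step

open Polynomial in
theorem IntermediateField.aeval_injective_of_derivation [CharZero F] (k : IntermediateField F K)
    (E : Derivation F K K) (hk : ∀ x ∈ k, E x = 0) {z : K} (hz : E z = 1) (p : k[X])
    (hp : Polynomial.aeval z p = 0) : p = 0 := by
  have hE (p : k[X]) : E (Polynomial.aeval z p) = Polynomial.aeval z (derivative p) := by
    induction p using Polynomial.induction_on' with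
    | add p q hp hq => simp only [map_add, hp, hq]
    | monomial n a =>
      rw [Polynomial.aeval_monomial, derivative_monomial, Polynomial.aeval_monomial,
        Derivation.leibniz, Derivation.leibniz_pow, hz]
      have : E (algebraMap k K a) = 0 := hk _ a.2
      rw [this]
      simp only [smul_eq_mul, nsmul_eq_mul, map_mul, map_natCast]
      ring
  induction hn : p.natDegree using Nat.strong_induction_on generalizing p with
  | _ n ih =>
    by_cases h0 : n = 0
    · rw [h0] at hn
      rw [eq_C_of_natDegree_eq_zero hn, Polynomial.aeval_C] at hp
      rw [eq_C_of_natDegree_eq_zero hn, (map_eq_zero _).1 hp, Polynomial.C_0]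
    · have : CharZero k := charZero_of_injective_algebraMap (algebraMap F k).injective
      have h1 : Polynomial.aeval z (derivative p) = 0 := by rw [← hE, hp, map_zero]
      have h2 : (derivative p).natDegree < n := hn ▸ natDegree_derivative_lt (by omega)
      have h3 := derivative_eq_zero.1 (ih _ h2 _ h1 rfl)
      omega

end Step

theorem closed_gradient_aux [CharZero F] [IsAlgClosed F] (m : ℕ) :
    ∀ {K : Type u} [Field K] [Algebra F K] (t : Fin m → K) (D : Fin m → Derivation F K K)
    (_ : ∀ i j, D i (t j) = if i = j then 1 else 0)
    (_ : IntermediateField.adjoin F (Set.range t) = ⊤),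
    (∀ x, (∀ i, D i x = 0) → x ∈ Set.range (algebraMap F K)) ∧
      ∀ a : Fin m → K, (∀ i j, D i (a j) = D j (a i)) → IsElementaryGradient D a := by
  induction m with
  | zero =>
    intro K _ _ t D _ htop
    refine ⟨fun x _ => ?_, fun a _ => ⟨0, 0, fun i => i.elim0⟩⟩
    rw [Set.range_eq_empty, IntermediateField.adjoin_empty] at htop
    have : x ∈ (⊥ : IntermediateField F K) := htop ▸ IntermediateField.mem_top
    exact IntermediateField.mem_bot.1 this
  | succ m ih =>
    intro K _ _ t D hD htop
    have hcomm (i j : Fin (m + 1)) (x : K) : D i (D j x) = D j (D i x) := by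
      have : ⁅D i, D j⁆ x = 0 := by
        refine IntermediateField.derivation_eq_zero_of_mem_adjoin _ (s := Set.range t) ?_
          (htop ▸ IntermediateField.mem_top)
        rintro _ ⟨l, rfl⟩
        rw [Derivation.commutator_apply, hD, hD]
        split_ifs <;> simp
      rwa [Derivation.commutator_apply, sub_eq_zero] at this
    set k : IntermediateField F K := IntermediateField.adjoin F (Set.range (t ∘ Fin.succ)) with hk
    have hkmem (i : Fin m) : t i.succ ∈ k := IntermediateField.subset_adjoin _ _ ⟨i, rfl⟩
    have hstab (i : Fin (m + 1)) (x : K) (hx : x ∈ k) : D i x ∈ k := by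
      refine IntermediateField.derivation_mem_of_mem_adjoin _ le_rfl ?_ hx
      rintro _ ⟨l, rfl⟩
      rw [Function.comp_apply, hD]
      split_ifs
      exacts [one_mem _, zero_mem _]
    have hE0 (x : K) (hx : x ∈ k) : D 0 x = 0 := by
      refine IntermediateField.derivation_eq_zero_of_mem_adjoin _ ?_ hx
      rintro _ ⟨l, rfl⟩
      rw [Function.comp_apply, hD, if_neg (Fin.succ_ne_zero l).symm]
    set δ : Fin m → Derivation F k k := fun i => k.restrictDerivation (D i.succ) (hstab _) with hδ
    have hδc (i : Fin m) (x : k) : (δ i x : K) = D i.succ x := rfl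
    obtain ⟨ihc, iha⟩ := ih (fun i => (⟨t i.succ, hkmem i⟩ : k)) δ
      (fun i j => by
        refine Subtype.ext ?_
        rw [hδc]
        simp only [hD, Fin.succ_inj]
        split_ifs <;> simp)
      (by
        apply IntermediateField.lift_injective k
        rw [IntermediateField.lift_adjoin, IntermediateField.lift_top, ← Set.range_comp]
        rfl)
    set z := t 0 with hz
    have hz1 : D 0 z = 1 := by rw [hz, hD, if_pos rfl]
    have hadj : IntermediateField.adjoin k {z} = ⊤ := by
      apply IntermediateField.restrictScalars_injective F
      rw [IntermediateField.restrictScalars_top, ← htop, hk,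
        IntermediateField.adjoin_adjoin_left]
      congr 1
      ext x
      simp only [Set.mem_union, Set.mem_range, Set.mem_singleton_iff, Fin.exists_fin_succ,
        Function.comp_apply, eq_comm (a := x)]
      tauto
    let _ : Algebra (Polynomial k) K := (Polynomial.aeval z).toAlgebra
    have halg (p : Polynomial k) : algebraMap (Polynomial k) K p = Polynomial.aeval z p := rfl
    have hinj : Function.Injective (algebraMap (Polynomial k) K) := by
      rw [injective_iff_map_eq_zero]
      exact fun p hp => k.aeval_injective_of_derivation (D 0) hE0 hz1 p hp
    have : FaithfulSMul (Polynomial k) K := (faithfulSMul_iff_algebraMap_injective _ _).2 hinj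
    have : IsFractionRing (Polynomial k) K := IsFractionRing.of_field _ _ fun x => by
      have hx : x ∈ IntermediateField.adjoin k {z} := hadj ▸ IntermediateField.mem_top
      exact (IntermediateField.mem_adjoin_simple_iff k x).1 hx
    have : IsScalarTower F (Polynomial k) K := .of_algebraMap_eq fun r => by
      rw [halg, IsScalarTower.algebraMap_apply F k (Polynomial k), Polynomial.algebraMap_apply,
        Algebra.algebraMap_self_apply, Polynomial.aeval_C]
      rfl
    have hE (p : Polynomial k) : D 0 (algebraMap _ K p) =
        algebraMap _ K (Polynomial.derivative p) := by
      simp only [halg]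
      induction p using Polynomial.induction_on' with
      | add p q hp hq => simp only [map_add, hp, hq]
      | monomial n a =>
        rw [Polynomial.aeval_monomial, Polynomial.derivative_monomial, Polynomial.aeval_monomial,
          Derivation.leibniz, Derivation.leibniz_pow, hz1]
        have : D 0 (algebraMap k K a) = 0 := hE0 _ a.2
        rw [this]
        simp only [smul_eq_mul, nsmul_eq_mul, map_mul, map_natCast]
        ring
    have hDs (i : Fin m) (p : Polynomial k) : D i.succ (algebraMap _ K p) =
        algebraMap _ K (Polynomial.coeffDeriv (δ i) p) := by
      simp only [halg]
      induction p using Polynomial.induction_on' with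
      | add p q hp hq => simp only [map_add, hp, hq]
      | monomial n a =>
        have h1 : D i.succ z = 0 := by rw [hz, hD, if_neg (Fin.succ_ne_zero i)]
        have h2 : Polynomial.coeffDeriv (δ i) (Polynomial.monomial n a) =
            Polynomial.monomial n (δ i a) := by
          ext l
          rw [Polynomial.coeff_coeffDeriv, Polynomial.coeff_monomial, Polynomial.coeff_monomial]
          split_ifs <;> simp
        rw [h2, Polynomial.aeval_monomial, Polynomial.aeval_monomial,
          Derivation.leibniz, Derivation.leibniz_pow, h1, smul_zero, smul_zero, smul_zero,
          zero_add, smul_eq_mul]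
        exact mul_comm _ _
    have hker {x : K} (hx : D 0 x = 0) : ∃ r : k, x = r := by
      obtain ⟨r, hr⟩ := Polynomial.mem_range_C_of_derivation_eq_zero (D 0) hE hx
      exact ⟨r, by rw [hr, halg, Polynomial.aeval_C]; rfl⟩
    refine ⟨fun x hx => ?_, fun a ha => ?_⟩
    · obtain ⟨r, rfl⟩ := hker (hx 0)
      obtain ⟨c, rfl⟩ := ihc r fun i => Subtype.ext (by rw [hδc]; exact hx i.succ)
      exact ⟨c, rfl⟩
    · obtain ⟨g, γ, hg⟩ := Polynomial.exists_logDeriv_sum (D 0) hE (fun i => D i.succ) δ hDs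
        (fun i => hcomm i.succ 0) ihc (a := a 0) (c := fun i => a i.succ) (fun i => ha i.succ 0)
      set p : Fin (m + 1) → K := fun i => D i g + γ.sum fun x r => r • (D i x / x) with hp
      have hpc (i j : Fin (m + 1)) : D i (p j) = D j (p i) := by
        simp only [hp, map_add, Finsupp.sum, map_sum, Derivation.map_smul]
        rw [hcomm]
        congr 1
        refine Finset.sum_congr rfl fun x _ => ?_
        rw [Derivation.map_div_comm _ _ (hcomm i j)]
      have ha' (i j : Fin (m + 1)) : D i (a j - p j) = D j (a i - p i) := by
        rw [map_sub, map_sub, ha, hpc]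
      have h0 : a 0 - p 0 = 0 := by rw [hg]; exact sub_self _
      have hr (i : Fin m) : ∃ r : k, a i.succ - p i.succ = r := by
        apply hker
        rw [ha', h0, map_zero]
      choose r hr using hr
      obtain ⟨g', γ', hg'⟩ := iha r fun i j => Subtype.ext (by
        rw [hδc, hδc, ← hr, ← hr, ha'])
      have hsum (i : Fin (m + 1)) : ((γ'.mapDomain (Subtype.val : k → K)).sum fun x c =>
          c • (D i x / x)) = γ'.sum fun x c => c • (D i x / x) :=
        Finsupp.sum_mapDomain_index (by simp) (by intros; rw [add_smul])
      have h2 : IsElementaryGradient D fun i => a i - p i := by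
        refine ⟨g', γ'.mapDomain Subtype.val, fun i => ?_⟩
        rw [hsum]
        refine Fin.cases ?_ (fun i => ?_) i
        · beta_reduce
          rw [h0, hE0 _ g'.2, zero_add]
          refine (Finset.sum_eq_zero fun x _ => ?_).symm
          beta_reduce
          rw [hE0 _ x.2, zero_div, smul_zero]
        · have := congrArg (Subtype.val : k → K) (hg' i)
          beta_reduce
          rw [hr, this]
          push_cast [Finsupp.sum]
          rfl
      have h1 : IsElementaryGradient D p := ⟨g, γ, fun i => rfl⟩
      have := h1.add h2
      simpa using this

end ClosedForms

section Lattice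

theorem AddSubgroup.eq_top_of_single_mem {n : ℕ} (A : AddSubgroup (Fin n → ℤ))
    (h : ∀ i, Pi.single i 1 ∈ A) : A = ⊤ := by
  rw [eq_top_iff]
  intro w _
  rw [← Finset.univ_sum_single w]
  refine sum_mem fun i _ => ?_
  have : (Pi.single i (w i) : Fin n → ℤ) = w i • Pi.single i 1 := by
    rw [← Pi.single_smul, smul_eq_mul, mul_one]
  rw [this]
  exact zsmul_mem (h i) _

theorem exists_primitive_of_saturated {n : ℕ} (H : AddSubgroup (Fin n → ℤ)) (j : Fin n)
    (hsat : ∀ (N : ℤ) (g : Fin n → ℤ), N ≠ 0 → N • g ∈ H → g ∈ H)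
    (hj : (Pi.single j 1 : Fin n → ℤ) ∉ H)
    (h : ∀ g : Fin n → ℤ, ∃ N c : ℤ, N ≠ 0 ∧ N • g + c • Pi.single j 1 ∈ H) :
    ∃ v w : Fin n → ℤ, v ⬝ᵥ w = 1 ∧ (∀ g, v ⬝ᵥ g = 0 ↔ g ∈ H) ∧ 0 < v j := by
  classical
  set e : Fin n → ℤ := Pi.single j 1 with he
  choose N₀ c₀ hN₀ hc₀ using fun i : Fin n => h (Pi.single i 1)
  set N : ℤ := ∏ i, N₀ i with hN
  have hN0 : N ≠ 0 := Finset.prod_ne_zero_iff.2 fun i _ => hN₀ i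
  set u : Fin n → ℤ := fun i => -(c₀ i * ∏ l ∈ Finset.univ.erase i, N₀ l) with hu
  have hsingle (i : Fin n) : N • (Pi.single i 1 : Fin n → ℤ) - u i • e ∈ H := by
    have h1 : N • (Pi.single i 1 : Fin n → ℤ) - u i • e =
        (∏ l ∈ Finset.univ.erase i, N₀ l) • (N₀ i • Pi.single i 1 + c₀ i • e) := by
      rw [hN, ← Finset.mul_prod_erase _ _ (Finset.mem_univ i), hu]
      module
    rw [h1]
    exact zsmul_mem (hc₀ i) _
  have hall (g : Fin n → ℤ) : N • g - (u ⬝ᵥ g) • e ∈ H := by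
    let A : AddSubgroup (Fin n → ℤ) :=
      { carrier := {g | N • g - (u ⬝ᵥ g) • e ∈ H}
        add_mem' := fun {x y} hx hy => by
          simp only [Set.mem_ofPred_eq] at *
          have := add_mem hx hy
          rw [dotProduct_add]
          convert this using 1
          module
        zero_mem' := by simp [zero_mem]
        neg_mem' := fun {x} hx => by
          simp only [Set.mem_ofPred_eq] at *
          have := neg_mem hx
          rw [dotProduct_neg]
          convert this using 1
          module }
    have : A = ⊤ := A.eq_top_of_single_mem fun i => by
      change N • (Pi.single i 1 : Fin n → ℤ) - (u ⬝ᵥ Pi.single i 1) • e ∈ H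
      rw [dotProduct_single, mul_one]
      exact hsingle i
    have hg : g ∈ A := this ▸ AddSubgroup.mem_top g
    exact hg
  have heH (c : ℤ) : c • e ∈ H ↔ c = 0 := by
    refine ⟨fun hc => ?_, fun hc => by rw [hc, zero_smul]; exact zero_mem _⟩
    by_contra h0
    exact hj (hsat c e h0 hc)
  have hker (g : Fin n → ℤ) : u ⬝ᵥ g = 0 ↔ g ∈ H := by
    constructor
    · intro h0
      have := hall g
      rw [h0, zero_smul, sub_zero] at this
      exact hsat N g hN0 this
    · intro hg
      rw [← heH]
      have := sub_mem (zsmul_mem hg N) (hall g)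
      rwa [sub_sub_cancel] at this
  have huj : u j ≠ 0 := by
    intro h0
    refine hj ((hker e).1 ?_)
    rw [he, dotProduct_single, mul_one, h0]
  obtain ⟨d, hd⟩ := IsPrincipalIdealRing.principal (Ideal.span (Set.range u))
  have hdvd (i : Fin n) : ∃ v, u i = d * v := by
    have : u i ∈ Ideal.span (Set.range u) := Ideal.subset_span ⟨i, rfl⟩
    rw [hd] at this
    obtain ⟨v, hv⟩ := Ideal.mem_span_singleton'.1 this
    exact ⟨v, by rw [← hv, mul_comm]⟩
  choose v hv using hdvd
  have hdu : d ∈ Submodule.span ℤ (Set.range u) := by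
    change d ∈ Ideal.span (Set.range u)
    rw [hd]
    exact Submodule.mem_span_singleton_self d
  obtain ⟨w, hw⟩ := (Submodule.mem_span_range_iff_exists_fun ℤ).1 hdu
  have hd0 : d ≠ 0 := by
    rintro rfl
    exact huj (by rw [hv, zero_mul])
  have huv : u = d • v := funext hv
  have hvw : v ⬝ᵥ w = 1 := by
    have : d * (v ⬝ᵥ w) = d * 1 := by
      rw [mul_one]
      conv_rhs => rw [← hw]
      rw [← smul_eq_mul, ← smul_dotProduct, ← huv]
      exact Finset.sum_congr rfl fun i _ => mul_comm _ _
    exact mul_left_cancel₀ hd0 this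
  have hvker (g : Fin n → ℤ) : v ⬝ᵥ g = 0 ↔ g ∈ H := by
    rw [← hker, huv, smul_dotProduct, smul_eq_mul, mul_eq_zero, or_iff_right hd0]
  have hvj : v j ≠ 0 := fun h0 => huj (by rw [hv, h0, mul_zero])
  rcases hvj.lt_or_gt with hlt | hgt
  · refine ⟨-v, -w, by rw [neg_dotProduct_neg, hvw], fun g => ?_, by simpa using hlt⟩
    rw [neg_dotProduct, neg_eq_zero, hvker]
  · exact ⟨v, w, hvw, hvker, hgt⟩

end Lattice

section Cocycle

open Filter

variable {n : ℕ} {P : Type*} [AddAction (Fin n → ℤ) P]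

theorem eventually_vadd_notMem {e : Fin n → ℤ} {q : P}
    (hfree : ∀ s : ℤ, (s • e) +ᵥ q = q → s = 0) {T : Set P} (hT : T.Finite) :
    (∀ᶠ s : ℕ in atTop, ((s : ℤ) • e) +ᵥ q ∉ T) ∧
      ∀ᶠ s : ℕ in atTop, (-(s : ℤ) • e) +ᵥ q ∉ T := by
  have hinj : Function.Injective fun s : ℤ => (s • e) +ᵥ q := by
    intro a b hab
    have : ((a - b) • e) +ᵥ q = q := by
      rw [sub_smul, sub_eq_neg_add, add_vadd]
      simp only at hab
      rw [hab, neg_vadd_vadd]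
    have := hfree _ this
    omega
  have h1 : Function.Injective fun s : ℕ => ((s : ℤ) • e) +ᵥ q :=
    hinj.comp Nat.cast_injective
  have h2 : Function.Injective fun s : ℕ => (-(s : ℤ) • e) +ᵥ q :=
    hinj.comp (neg_injective.comp Nat.cast_injective)
  rw [← Nat.cofinite_eq_atTop]
  exact ⟨h1.tendsto_cofinite.eventually hT.eventually_cofinite_notMem,
    h2.tendsto_cofinite.eventually hT.eventually_cofinite_notMem⟩

theorem exists_mem_of_ne_of_vadd {e : Fin n → ℤ} {f : P → ℤ} {q : P} (s : ℕ)
    (h : f (((s : ℤ) • e) +ᵥ q) ≠ f q) :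
    ∃ r : ℕ, r < s ∧ f ((((r + 1 : ℕ) : ℤ) • e) +ᵥ q) ≠ f (-e +ᵥ ((((r + 1 : ℕ) : ℤ) • e) +ᵥ q)) := by
  by_contra! hc
  refine h ?_
  have key : ∀ r ≤ s, f (((r : ℤ) • e) +ᵥ q) = f q := by
    intro r
    induction r with
    | zero => intro _; simp
    | succ r ih =>
      intro hr
      rw [hc r (by omega), vadd_vadd, ← ih (by omega)]
      congr 2
      push_cast
      module
  exact key s le_rfl

theorem finite_support_of_eventually_zero {e : Fin n → ℤ} {f : P → ℤ} {O : Set P}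
    (hO : ∀ (g : Fin n → ℤ) (q : P), g +ᵥ q ∈ O ↔ q ∈ O)
    (hfree : ∀ q ∈ O, ∀ s : ℤ, (s • e) +ᵥ q = q → s = 0)
    (hfin : {q | f q ≠ f (-e +ᵥ q)}.Finite) (hf : ∀ q ∉ O, f q = 0)
    (hup : ∀ q ∈ O, ∀ᶠ s : ℕ in atTop, f (((s : ℤ) • e) +ᵥ q) = 0)
    (hdown : ∀ q ∈ O, ∀ᶠ s : ℕ in atTop, f ((-(s : ℤ) • e) +ᵥ q) = 0) :
    {q | f q ≠ 0}.Finite := by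
  set T := {q | f q ≠ f (-e +ᵥ q)} with hT
  have hpair (t : P × P) : {q | t.1 ∈ O ∧ ∃ s₁ s₂ : ℕ, q = ((s₁ : ℤ) • e) +ᵥ t.1 ∧
      t.2 = ((s₂ : ℤ) • e) +ᵥ q}.Finite := by
    obtain ⟨t₁, t₂⟩ := t
    rcases Set.eq_empty_or_nonempty {q | t₁ ∈ O ∧ ∃ s₁ s₂ : ℕ, q = ((s₁ : ℤ) • e) +ᵥ t₁ ∧
      t₂ = ((s₂ : ℤ) • e) +ᵥ q} with h | ⟨q, ht, s₁, s₂, h1, h2⟩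
    · rw [h]; exact Set.finite_empty
    · refine ((Finset.range (s₁ + s₂ + 1)).finite_toSet.image
        fun s : ℕ => ((s : ℤ) • e) +ᵥ t₁).subset ?_
      rintro q' ⟨-, r₁, r₂, h3, h4⟩
      refine ⟨r₁, ?_, h3.symm⟩
      have h5 : (((r₁ + r₂ : ℤ) - (s₁ + s₂)) • e) +ᵥ t₁ = t₁ := by
        have : ((r₁ + r₂ : ℤ) • e) +ᵥ t₁ = ((s₁ + s₂ : ℤ) • e) +ᵥ t₁ := by
          rw [add_comm (r₁ : ℤ), add_comm (s₁ : ℤ), add_smul, add_smul, add_vadd, add_vadd,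
            ← h1, ← h3, ← h2, ← h4]
        rw [sub_smul, sub_eq_neg_add, add_vadd, this, neg_vadd_vadd]
      have := hfree _ ht _ h5
      simp only [Finset.coe_range, Set.mem_Iio]
      omega
  refine ((hfin.prod hfin).biUnion fun t _ => hpair t).subset fun q hq => ?_
  have hqO : q ∈ O := by
    by_contra h
    exact hq (hf q h)
  obtain ⟨s, hs⟩ := (hup q hqO).exists
  obtain ⟨s', hs'⟩ := (hdown q hqO).exists
  obtain ⟨r, -, hr⟩ := exists_mem_of_ne_of_vadd (f := f) (e := e) (q := q) s
    (by rw [hs]; exact Ne.symm hq)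
  set q' := (-(s' : ℤ) • e) +ᵥ q with hq'
  have hqq' : q = ((s' : ℤ) • e) +ᵥ q' := by
    rw [hq', vadd_vadd, neg_smul, add_neg_cancel, zero_vadd]
  obtain ⟨r', hr's, hr'⟩ := exists_mem_of_ne_of_vadd (f := f) (e := e) (q := q') s'
    (by rw [← hqq', hs']; exact hq)
  simp only [Set.mem_iUnion]
  refine ⟨(_, _), ⟨hr', hr⟩, ?_, s' - (r' + 1), r + 1, ?_, rfl⟩
  · rw [hO, hq', hO]; exact hqO
  · dsimp only
    rw [vadd_vadd, ← add_smul]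
    refine hqq'.trans ?_
    congr 2
    omega

/-- Data attached to a finitely supported additive cocycle on an orbit along which a
coordinate direction acts freely. -/
theorem exists_potential (φ : Fin n → P → ℤ) (hfin : ∀ i, {q | φ i q ≠ 0}.Finite)
    (hcoc : ∀ i j q, φ i q + φ j (-(Pi.single i 1 : Fin n → ℤ) +ᵥ q) =
      φ j q + φ i (-(Pi.single j 1 : Fin n → ℤ) +ᵥ q))
    {O : Set P} (hO : ∀ (g : Fin n → ℤ) (q : P), g +ᵥ q ∈ O ↔ q ∈ O)
    (hφ : ∀ i, ∀ q ∉ O, φ i q = 0) (j : Fin n)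
    (hfree : ∀ q ∈ O, ∀ s : ℤ, (s • (Pi.single j 1 : Fin n → ℤ)) +ᵥ q = q → s = 0) :
    ∃ f : P → ℤ, (∀ i q, φ i q = f q - f (-(Pi.single i 1 : Fin n → ℤ) +ᵥ q)) ∧
      (∀ q ∉ O, f q = 0) ∧
      (∀ q, ∀ᶠ N : ℕ in atTop,
        f q = ∑ s ∈ Finset.range N, φ j ((-(s : ℤ) • (Pi.single j 1 : Fin n → ℤ)) +ᵥ q)) ∧
      ∀ q, ∀ᶠ s : ℕ in atTop, f ((-(s : ℤ) • (Pi.single j 1 : Fin n → ℤ)) +ᵥ q) = 0 := by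
  set e : Fin n → ℤ := Pi.single j 1 with he
  have hev (i : Fin n) (q : P) : ∀ᶠ s : ℕ in atTop, φ i ((-(s : ℤ) • e) +ᵥ q) = 0 := by
    by_cases hq : q ∈ O
    · filter_upwards [(eventually_vadd_notMem (hfree q hq) (hfin i)).2] with s hs
      simpa using hs
    · exact Eventually.of_forall fun s => hφ i _ (by rwa [hO])
  have hlim (q : P) : ∃ l : ℤ, ∀ᶠ N : ℕ in atTop,
      l = ∑ s ∈ Finset.range N, φ j ((-(s : ℤ) • e) +ᵥ q) := by
    obtain ⟨N₀, hN₀⟩ := eventually_atTop.1 (hev j q)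
    refine ⟨∑ s ∈ Finset.range N₀, φ j ((-(s : ℤ) • e) +ᵥ q), eventually_atTop.2 ⟨N₀, fun N hN => ?_⟩⟩
    refine Finset.sum_subset (Finset.range_subset_range.2 hN) fun s _ hs => ?_
    exact hN₀ s (by simpa using hs)
  choose f hf using hlim
  have ha (i : Fin n) (q : P) : φ i q = f q - f (-(Pi.single i 1 : Fin n → ℤ) +ᵥ q) := by
    obtain ⟨N, h1, h2, h3⟩ := ((hf q).and
      ((hf (-(Pi.single i 1 : Fin n → ℤ) +ᵥ q)).and (hev i q))).exists
    have key : ∀ N : ℕ, ∑ s ∈ Finset.range N, φ j ((-(s : ℤ) • e) +ᵥ q) -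
        ∑ s ∈ Finset.range N, φ j ((-(s : ℤ) • e) +ᵥ (-(Pi.single i 1 : Fin n → ℤ) +ᵥ q)) =
        φ i q - φ i ((-(N : ℤ) • e) +ᵥ q) := by
      intro N
      induction N with
      | zero => simp
      | succ N ih =>
        have := hcoc i j ((-(N : ℤ) • e) +ᵥ q)
        rw [vadd_comm (-(Pi.single i 1 : Fin n → ℤ)), ← he, vadd_vadd (-e)] at this
        have h4 : -e + -(N : ℤ) • e = -((N + 1 : ℕ) : ℤ) • e := by push_cast; module
        rw [h4] at this
        rw [Finset.sum_range_succ, Finset.sum_range_succ]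
        linear_combination ih - this
    have := key N
    rw [← h1, ← h2, h3, sub_zero] at this
    exact this.symm
  refine ⟨f, ha, fun q hq => ?_, hf, fun q => ?_⟩
  · obtain ⟨N, hN⟩ := (hf q).exists
    rw [hN]
    exact Finset.sum_eq_zero fun s _ => hφ j _ (by rwa [hO])
  · filter_upwards [hf q] with N hN
    have key : ∀ N : ℕ, f ((-(N : ℤ) • e) +ᵥ q) =
        f q - ∑ s ∈ Finset.range N, φ j ((-(s : ℤ) • e) +ᵥ q) := by
      intro N
      induction N with
      | zero => simp
      | succ N ih =>
        have h4 : -((N + 1 : ℕ) : ℤ) • e = -e + -(N : ℤ) • e := by push_cast; module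
        rw [Finset.sum_range_succ, ha j ((-(N : ℤ) • e) +ᵥ q), h4, ← he, ← vadd_vadd (-e)]
        linear_combination ih
    rw [key, ← hN, sub_self]

theorem finite_setOf_ne_vadd {f : P → ℤ}
    (h : ∀ i, {q | f q ≠ f (-(Pi.single i 1 : Fin n → ℤ) +ᵥ q)}.Finite) (w : Fin n → ℤ) :
    {q | f q ≠ f (-w +ᵥ q)}.Finite := by
  let A : AddSubgroup (Fin n → ℤ) :=
    { carrier := {w | {q | f q ≠ f (-w +ᵥ q)}.Finite}
      zero_mem' := by simp
      add_mem' := fun {a b} ha hb => by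
        simp only [Set.mem_ofPred_eq] at *
        refine (ha.union (hb.image fun q => a +ᵥ q)).subset fun q hq => ?_
        by_cases h1 : f q = f (-a +ᵥ q)
        · refine Or.inr ⟨-a +ᵥ q, ?_, vadd_neg_vadd a q⟩
          simp only [Set.mem_ofPred_eq] at *
          rwa [← h1, vadd_vadd, ← neg_add_rev]
        · exact Or.inl h1
      neg_mem' := fun {a} ha => by
        simp only [Set.mem_ofPred_eq] at *
        refine (ha.image fun q => -a +ᵥ q).subset fun q hq => ?_
        refine ⟨a +ᵥ q, ?_, neg_vadd_vadd a q⟩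
        simp only [Set.mem_ofPred_eq, neg_vadd_vadd, neg_neg] at *
        exact Ne.symm hq }
  have : A = ⊤ := A.eq_top_of_single_mem h
  have hw : w ∈ A := this ▸ AddSubgroup.mem_top w
  exact hw

theorem exists_eventual_value {f : P → ℤ}
    (hfin : ∀ i, {q | f q ≠ f (-(Pi.single i 1 : Fin n → ℤ) +ᵥ q)}.Finite) (j : Fin n) (p : P)
    (hfree : ∀ g : Fin n → ℤ, ∀ s : ℤ,
      (s • (Pi.single j 1 : Fin n → ℤ)) +ᵥ (g +ᵥ p) = g +ᵥ p → s = 0) :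
    ∃ ε : ℤ, ∀ g : Fin n → ℤ, ∀ᶠ s : ℕ in atTop,
      f (((s : ℤ) • (Pi.single j 1 : Fin n → ℤ)) +ᵥ (g +ᵥ p)) = ε := by
  set e : Fin n → ℤ := Pi.single j 1 with he
  have hev (w g : Fin n → ℤ) : ∀ᶠ s : ℕ in atTop,
      f (((s : ℤ) • e) +ᵥ (g +ᵥ p)) = f (-w +ᵥ (((s : ℤ) • e) +ᵥ (g +ᵥ p))) := by
    filter_upwards [(eventually_vadd_notMem (hfree g) (finite_setOf_ne_vadd hfin w)).1] with s hs
    simpa using hs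
  obtain ⟨N, hN⟩ := eventually_atTop.1 (hev (-e) 0)
  refine ⟨f (((N : ℤ) • e) +ᵥ ((0 : Fin n → ℤ) +ᵥ p)), fun g => ?_⟩
  filter_upwards [hev g g, eventually_ge_atTop N] with s hs hsN
  rw [hs]
  have h1 : -g +ᵥ (((s : ℤ) • e) +ᵥ (g +ᵥ p)) = ((s : ℤ) • e) +ᵥ ((0 : Fin n → ℤ) +ᵥ p) := by
    rw [vadd_comm, neg_vadd_vadd, zero_vadd]
  rw [h1]
  obtain ⟨r, rfl⟩ := Nat.exists_eq_add_of_le hsN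
  clear hs hsN h1
  induction r with
  | zero => rfl
  | succ r ih =>
    rw [← ih, hN (N + r) (by omega), vadd_vadd _ (((N + r : ℕ) : ℤ) • e)]
    congr 2
    push_cast
    module

theorem exists_combination_mem_stabilizer {f : P → ℤ} (j : Fin n) (p : P)
    (hfin : {q | f q ≠ f (-(Pi.single j 1 : Fin n → ℤ) +ᵥ q)}.Finite) {ε : ℤ} (hε : ε ≠ 0)
    (hup : ∀ g : Fin n → ℤ, ∀ᶠ s : ℕ in atTop,
      f (((s : ℤ) • (Pi.single j 1 : Fin n → ℤ)) +ᵥ (g +ᵥ p)) = ε)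
    (hdown : ∀ g : Fin n → ℤ, ∀ᶠ s : ℕ in atTop,
      f ((-(s : ℤ) • (Pi.single j 1 : Fin n → ℤ)) +ᵥ (g +ᵥ p)) = 0) (g : Fin n → ℤ) :
    ∃ N c : ℤ, N ≠ 0 ∧ (N • g + c • Pi.single j 1) +ᵥ p = p := by
  set e : Fin n → ℤ := Pi.single j 1 with he
  have hmeet (l : ℕ) : ∃ c : ℤ, ((l : ℤ) • g + c • e) +ᵥ p ∈ {q | f q ≠ f (-e +ᵥ q)} := by
    obtain ⟨s, hs⟩ := (hup ((l : ℤ) • g)).exists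
    obtain ⟨s', hs'⟩ := (hdown ((l : ℤ) • g)).exists
    obtain ⟨r, -, hr⟩ := exists_mem_of_ne_of_vadd (f := f) (e := e)
      (q := (-(s' : ℤ) • e) +ᵥ ((l : ℤ) • g +ᵥ p)) (s' + s) (by
        rw [hs', vadd_vadd]
        have : ((s' + s : ℕ) : ℤ) • e + -(s' : ℤ) • e = (s : ℤ) • e := by push_cast; module
        rw [this, hs]
        exact hε)
    refine ⟨(r + 1 : ℕ) + -(s' : ℤ), ?_⟩
    have : ((l : ℤ) • g + (((r + 1 : ℕ) : ℤ) + -(s' : ℤ)) • e) +ᵥ p =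
        (((r + 1 : ℕ) : ℤ) • e) +ᵥ ((-(s' : ℤ) • e) +ᵥ ((l : ℤ) • g +ᵥ p)) := by
      rw [vadd_vadd, vadd_vadd, add_comm ((l : ℤ) • g), add_smul]
    rw [this]
    exact hr
  choose c hc using hmeet
  have : Finite {q | f q ≠ f (-e +ᵥ q)} := hfin
  obtain ⟨l, l', hne, hll⟩ := Finite.exists_ne_map_eq_of_infinite
    fun l : ℕ => (⟨_, hc l⟩ : {q | f q ≠ f (-e +ᵥ q)})
  have hll := Subtype.ext_iff.1 hll
  simp only at hll
  refine ⟨l - l', c l - c l', by omega, ?_⟩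
  have : ((l - l' : ℤ) • g + (c l - c l') • e) =
      -((l' : ℤ) • g + c l' • e) + ((l : ℤ) • g + c l • e) := by module
  rw [this, add_vadd, hll, neg_vadd_vadd]

end Cocycle

namespace MvPolynomial

variable {σ F : Type*} [Field F]

/-- Translation of the variables by a constant vector. -/
noncomputable def translateVars (c : σ → F) : MvPolynomial σ F →ₐ[F] MvPolynomial σ F :=
  aeval fun x => X x + C (c x)

theorem translateVars_X (c : σ → F) (x : σ) :
    translateVars c (X x) = X x + C (c x) := by simp [translateVars]

theorem translateVars_translateVars (c d : σ → F) (p : MvPolynomial σ F) :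
    translateVars c (translateVars d p) = translateVars (c + d) p := by
  have : (translateVars c).comp (translateVars d) = translateVars (c + d) := by
    ext1 x
    simp [translateVars, algHom_C, add_assoc]
  exact DFunLike.congr_fun this p

theorem translateVars_zero (p : MvPolynomial σ F) : translateVars (0 : σ → F) p = p := by
  have : translateVars (0 : σ → F) = AlgHom.id F _ := by
    ext1 x
    simp [translateVars]
  exact DFunLike.congr_fun this p

/-- Translation of the variables as an automorphism. -/
noncomputable def translateVarsEquiv (c : σ → F) : MvPolynomial σ F ≃ₐ[F] MvPolynomial σ F :=
  AlgEquiv.ofAlgHom (translateVars c) (translateVars (-c))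
    (by ext1 x; simp [translateVars_translateVars, translateVars_zero])
    (by ext1 x; simp [translateVars_translateVars, translateVars_zero])

theorem pderiv_translateVars (i : σ) (c : σ → F) (p : MvPolynomial σ F) :
    pderiv i (translateVars c p) = translateVars c (pderiv i p) := by
  induction p using MvPolynomial.induction_on with
  | C a => simp [translateVars, algHom_C]
  | add p q hp hq => simp [hp, hq]
  | mul_X p x h =>
    classical
    simp only [map_mul, Derivation.leibniz, h, translateVars_X, map_add, pderiv_C, smul_eq_mul,
      pderiv_X, Pi.single_apply, add_zero, apply_ite (translateVars c), map_one, map_zero]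

theorem eval_translateVars (x c : σ → F) (p : MvPolynomial σ F) :
    eval x (translateVars c p) = eval (x + c) p := by
  have : (aeval x).comp (translateVars c) = aeval (R := F) (x + c) := by
    ext1 y
    simp [translateVars]
  simpa [coe_aeval_eq_eval] using DFunLike.congr_fun this p

variable [CharZero F]

theorem translateVars_eq_self_of_associated {c : σ → F} {M : ℤ} (hM : M ≠ 0) {p : MvPolynomial σ F}
    (hp : p ≠ 0) (h : Associated (translateVars ((M : F) • c) p) p) : translateVars c p = p := by
  let ψ : MvPolynomial σ F →ₐ[F] Polynomial (MvPolynomial σ F) :=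
    aeval fun x => Polynomial.C (X x) + Polynomial.C (C (c x)) * Polynomial.X
  have hev (s : F) (q : MvPolynomial σ F) :
      (ψ q).eval (C s) = translateVars (s • c) q := by
    have : ((Polynomial.aeval (R := MvPolynomial σ F) (C s : MvPolynomial σ F)).restrictScalars
        F).comp ψ = translateVars (s • c) := by
      ext1 x
      simp only [ψ, translateVars, AlgHom.comp_apply, aeval_X, AlgHom.restrictScalars_apply, map_add,
        map_mul, Polynomial.aeval_C, Polynomial.aeval_X, Algebra.algebraMap_self_apply,
        Pi.smul_apply, smul_eq_mul, mul_comm s]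
    simpa [Polynomial.coe_aeval_eq_eval] using DFunLike.congr_fun this q
  have hinj : Function.Injective fun s : ℕ => (C ((s : F) * M) : MvPolynomial σ F) := by
    intro s t hst
    have := C_injective σ F hst
    have hM' : (M : F) ≠ 0 := by exact_mod_cast hM
    exact_mod_cast mul_right_cancel₀ hM' this
  obtain ⟨u, hu⟩ := h.symm
  obtain ⟨a, ha, hau⟩ : ∃ a : F, IsUnit a ∧ (u : MvPolynomial σ F) = C a :=
    (isUnit_iff_eq_C_of_isReduced.1 u.isUnit)
  rw [hau, mul_comm] at hu
  have hpow (s : ℕ) : translateVars (((s : F) * M) • c) p = C (a ^ s) * p := by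
    induction s with
    | zero => simp [translateVars_zero]
    | succ s ih =>
      have h1 : ((((s + 1 : ℕ) : F)) * M) • c = (M : F) • c + ((s : F) * M) • c := by
        push_cast; rw [← add_smul]; congr 1; ring
      rw [h1, ← translateVars_translateVars, ih, map_mul, ← hu, ← mul_assoc]
      simp [translateVars, algHom_C, pow_succ]
  have hψ : ψ p ≠ 0 := by
    intro h0
    have := hev 0 p
    rw [h0, zero_smul, translateVars_zero, Polynomial.eval_zero] at this
    exact hp this.symm
  have htay : Polynomial.taylor (C (M : F)) (ψ p) = Polynomial.C (C a) * ψ p := by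
    refine Polynomial.eq_of_infinite_eval_eq _ _ ((Set.infinite_range_of_injective hinj).mono ?_)
    rintro _ ⟨s, rfl⟩
    rw [Set.mem_ofPred_eq]
    beta_reduce
    rw [Polynomial.taylor_eval, ← C_add, hev, Polynomial.eval_mul,
      Polynomial.eval_C, hev, hpow]
    have := hpow (s + 1)
    rw [Nat.cast_succ, add_mul, one_mul] at this
    rw [this, pow_succ, C_mul, mul_comm (C (a ^ s)), mul_assoc]
  have ha1 : a = 1 := by
    have h1 := congrArg Polynomial.leadingCoeff htay
    rw [Polynomial.leadingCoeff_taylor, Polynomial.leadingCoeff_mul, Polynomial.leadingCoeff_C] at h1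
    have h2 : (C a : MvPolynomial σ F) = C 1 := by
      rw [C_1]
      exact (mul_left_eq_self₀.1 h1.symm).resolve_right (by simpa using hψ)
    exact C_injective σ F h2
  have hconst : ψ p = Polynomial.C p := by
    refine Polynomial.eq_of_infinite_eval_eq _ _ ((Set.infinite_range_of_injective hinj).mono ?_)
    rintro _ ⟨s, rfl⟩
    rw [Set.mem_ofPred_eq]
    beta_reduce
    rw [hev, hpow, ha1, Polynomial.eval_C]
    simp
  have := hev 1 p
  rw [hconst, Polynomial.eval_C, one_smul] at this
  exact this.symm

end MvPolynomial

section Shift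

variable {F : Type*} [Field F] {m n : ℕ}

/-- The constant vector that translates the discrete variables by `u`. -/
def discreteVector (F : Type*) [Field F] (m : ℕ) {n : ℕ} (u : Fin n → ℤ) : Fin m ⊕ Fin n → F :=
  Sum.elim 0 fun j => (u j : F)

theorem discreteVector_add (u v : Fin n → ℤ) :
    discreteVector F m (u + v) = discreteVector F m u + discreteVector F m v := by
  ext (i | i) <;> simp [discreteVector]

theorem discreteVector_smul (M : ℤ) (u : Fin n → ℤ) :
    discreteVector F m (M • u) = (M : F) • discreteVector F m u := by
  ext (i | i) <;> simp [discreteVector]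

/-- The shift of the discrete variables by an integer vector. -/
noncomputable def shift (u : Fin n → ℤ) :
    MvPolynomial (Fin m ⊕ Fin n) F ≃ₐ[F] MvPolynomial (Fin m ⊕ Fin n) F :=
  translateVarsEquiv (discreteVector F m u)

theorem shift_apply (u : Fin n → ℤ) (p : MvPolynomial (Fin m ⊕ Fin n) F) :
    shift u p = translateVars (discreteVector F m u) p := rfl

theorem shift_shift (u v : Fin n → ℤ) (p : MvPolynomial (Fin m ⊕ Fin n) F) :
    shift u (shift v p) = shift (u + v) p := by
  simp only [shift_apply, translateVars_translateVars, discreteVector_add]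

theorem shift_zero (p : MvPolynomial (Fin m ⊕ Fin n) F) : shift 0 p = p := by
  have : discreteVector F m (0 : Fin n → ℤ) = 0 := by ext (i | i) <;> simp [discreteVector]
  rw [shift_apply, this, translateVars_zero]

theorem pderiv_shift (i : Fin m ⊕ Fin n) (u : Fin n → ℤ) (p : MvPolynomial (Fin m ⊕ Fin n) F) :
    pderiv i (shift u p) = shift u (pderiv i p) := pderiv_translateVars _ _ _

theorem shift_X_inl (u : Fin n → ℤ) (i : Fin m) :
    shift u (X (Sum.inl i) : MvPolynomial (Fin m ⊕ Fin n) F) = X (Sum.inl i) := by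
  simp [shift_apply, translateVars_X, discreteVector]

theorem shift_X_inr (u : Fin n → ℤ) (j : Fin n) :
    shift u (X (Sum.inr j) : MvPolynomial (Fin m ⊕ Fin n) F) = X (Sum.inr j) + C (u j : F) := by
  simp [shift_apply, translateVars_X, discreteVector]

/-- The classes of irreducible polynomials up to units. -/
def PrimeClass (F : Type*) [Field F] (m n : ℕ) : Type _ :=
  {A : Associates (MvPolynomial (Fin m ⊕ Fin n) F) // Irreducible A}

namespace PrimeClass

/-- A representative of a class of irreducible polynomials. -/
noncomputable def rep (q : PrimeClass F m n) : MvPolynomial (Fin m ⊕ Fin n) F := Quot.out q.1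

theorem mk_rep (q : PrimeClass F m n) : Associates.mk q.rep = q.1 := Associates.quot_out _

theorem irreducible_rep (q : PrimeClass F m n) : Irreducible q.rep := by
  rw [← Associates.irreducible_mk, mk_rep]; exact q.2

theorem prime_rep (q : PrimeClass F m n) : Prime q.rep := q.irreducible_rep.prime

theorem ext_rep {q q' : PrimeClass F m n} (h : Associated q.rep q'.rep) : q = q' := by
  apply Subtype.ext
  rw [← mk_rep, ← mk_rep, Associates.mk_eq_mk_iff_associated]
  exact h

/-- The class of an irreducible polynomial. -/
noncomputable def mk (p : MvPolynomial (Fin m ⊕ Fin n) F) (hp : Irreducible p) : PrimeClass F m n :=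
  ⟨Associates.mk p, Associates.irreducible_mk.2 hp⟩

theorem rep_mk (p : MvPolynomial (Fin m ⊕ Fin n) F) (hp : Irreducible p) :
    Associated (mk p hp).rep p := Associates.mk_quot_out p

noncomputable instance : AddAction (Fin n → ℤ) (PrimeClass F m n) where
  vadd u q := mk (shift u q.rep) ((MulEquiv.irreducible_iff (shift u)).2 q.irreducible_rep)
  zero_vadd q := ext_rep ((rep_mk _ _).trans (by rw [shift_zero]))
  add_vadd u v q := ext_rep ((rep_mk _ _).trans (by
    rw [← shift_shift]
    exact ((rep_mk _ _).map (shift u)).symm.trans (rep_mk _ _).symm))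

theorem rep_vadd (u : Fin n → ℤ) (q : PrimeClass F m n) :
    Associated (u +ᵥ q).rep (shift u q.rep) := rep_mk _ _

theorem vadd_eq_self_iff (u : Fin n → ℤ) (q : PrimeClass F m n) :
    u +ᵥ q = q ↔ Associated (shift u q.rep) q.rep :=
  ⟨fun h => (rep_vadd u q).symm.trans (by rw [h]), fun h => ext_rep ((rep_vadd u q).trans h)⟩

theorem finite_setOf_dvd {a : MvPolynomial (Fin m ⊕ Fin n) F} (ha : a ≠ 0) :
    {q : PrimeClass F m n | q.rep ∣ a}.Finite := by
  classical
  refine Set.Finite.of_injOn (f := fun q : PrimeClass F m n => q.1)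
    (t := ((UniqueFactorizationMonoid.factors a).toFinset.image Associates.mk : Set _))
    ?_ (fun x _ y _ h => Subtype.ext h) (Finset.finite_toSet _)
  intro q hq
  obtain ⟨y, hy, hqy⟩ := UniqueFactorizationMonoid.exists_mem_factors_of_dvd ha q.irreducible_rep hq
  simp only [Finset.coe_image, Set.mem_image, Finset.mem_coe, Multiset.mem_toFinset]
  exact ⟨y, hy, by rw [← q.mk_rep, Associates.mk_eq_mk_iff_associated]; exact hqy.symm⟩

theorem finite_setOf_ordAt_ne_zero {K : Type*} [Field K] [Algebra (MvPolynomial (Fin m ⊕ Fin n) F) K]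
    [IsFractionRing (MvPolynomial (Fin m ⊕ Fin n) F) K] {x : K} (hx : x ≠ 0) :
    {q : PrimeClass F m n | ordAt q.rep x ≠ 0}.Finite := by
  have hn : IsFractionRing.num (MvPolynomial (Fin m ⊕ Fin n) F) x ≠ 0 := by
    simpa [IsFractionRing.num_eq_zero] using hx
  have hd : (IsFractionRing.den (MvPolynomial (Fin m ⊕ Fin n) F) x :
      MvPolynomial (Fin m ⊕ Fin n) F) ≠ 0 := nonZeroDivisors.coe_ne_zero _
  exact ((finite_setOf_dvd hn).union (finite_setOf_dvd hd)).subset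
    fun q hq => dvd_num_or_den_of_ordAt_ne_zero hq

theorem finite_setOf_ordAt_neg {K : Type*} [Field K] [Algebra (MvPolynomial (Fin m ⊕ Fin n) F) K]
    [IsFractionRing (MvPolynomial (Fin m ⊕ Fin n) F) K] (x : K) :
    {q : PrimeClass F m n | ordAt q.rep x < 0}.Finite := by
  have hd : (IsFractionRing.den (MvPolynomial (Fin m ⊕ Fin n) F) x :
      MvPolynomial (Fin m ⊕ Fin n) F) ≠ 0 := nonZeroDivisors.coe_ne_zero _
  exact (finite_setOf_dvd hd).subset fun q hq => dvd_den_of_ordAt_neg hq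

theorem exists_rep_associated {p : MvPolynomial (Fin m ⊕ Fin n) F} (hp : Prime p) :
    ∃ q : PrimeClass F m n, Associated q.rep p := ⟨mk p hp.irreducible, rep_mk _ _⟩

variable [CharZero F]

theorem shift_rep_eq_self {N : ℤ} (hN : N ≠ 0) {u : Fin n → ℤ} {q : PrimeClass F m n}
    (h : (N • u) +ᵥ q = q) : shift u q.rep = q.rep := by
  rw [vadd_eq_self_iff, shift_apply, discreteVector_smul] at h
  exact translateVars_eq_self_of_associated hN q.prime_rep.ne_zero h

theorem vadd_eq_self_iff_shift {u : Fin n → ℤ} {q : PrimeClass F m n} :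
    u +ᵥ q = q ↔ shift u q.rep = q.rep :=
  ⟨fun h => shift_rep_eq_self one_ne_zero (by rwa [one_zsmul]),
    fun h => (vadd_eq_self_iff _ _).2 (by rw [h])⟩

theorem vadd_eq_self_of_zsmul {N : ℤ} (hN : N ≠ 0) {u : Fin n → ℤ} {q : PrimeClass F m n}
    (h : (N • u) +ᵥ q = q) : u +ᵥ q = q :=
  vadd_eq_self_iff_shift.2 (shift_rep_eq_self hN h)

end PrimeClass

section Invariant

variable [CharZero F]

theorem notMem_vars_of_pderiv_eq_zero {σ : Type*} {i : σ} {p : MvPolynomial σ F}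
    (h : pderiv i p = 0) : i ∉ p.vars := by
  classical
  intro hi
  obtain ⟨d, hd, hid⟩ := (mem_vars_iff_mem_support i).1 hi
  have h1 := coeff_pderiv (i := i) p (d - Finsupp.single i 1)
  have hle : Finsupp.single i 1 ≤ d := by
    rw [Finsupp.single_le_iff]
    exact Nat.one_le_iff_ne_zero.2 (Finsupp.mem_support_iff.1 hid)
  rw [h, coeff_zero, tsub_add_cancel_of_le hle] at h1
  rw [mem_support_iff] at hd
  rcases mul_eq_zero.1 h1.symm with h2 | h2
  · exact hd h2
  · exact (Nat.cast_add_one_ne_zero _) h2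

theorem infinite_range_intCast : (Set.range (Int.cast : ℤ → F)).Infinite :=
  Set.infinite_range_of_injective Int.cast_injective

omit [CharZero F] in
theorem eval_shift (x : Fin m ⊕ Fin n → F) (u : Fin n → ℤ) (p : MvPolynomial (Fin m ⊕ Fin n) F) :
    eval x (shift u p) = eval (x + discreteVector F m u) p := eval_translateVars _ _ _

theorem funext_discrete {p q : MvPolynomial (Fin m ⊕ Fin n) F}
    (h : ∀ (x : Fin m → F) (u : Fin n → ℤ), eval (Sum.elim x fun j => (u j : F)) p =
      eval (Sum.elim x fun j => (u j : F)) q) : p = q := by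
  refine funext_set (Sum.elim (fun _ => Set.univ) fun _ => Set.range (Int.cast : ℤ → F)) ?_ ?_
  · rintro (i | i)
    · exact Set.infinite_univ
    · exact infinite_range_intCast
  · intro x hx
    have hx' (j : Fin n) : ∃ u : ℤ, (u : F) = x (Sum.inr j) := hx (Sum.inr j) trivial
    choose u hu using hx'
    have : x = Sum.elim (x ∘ Sum.inl) fun j => (u j : F) := by
      ext (i | i) <;> simp [hu]
    rw [this]
    exact h _ _

theorem exists_rename_of_shift_eq {p : MvPolynomial (Fin m ⊕ Fin n) F} (h : ∀ u, shift u p = p) :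
    ∃ p' : MvPolynomial (Fin m) F, p = rename Sum.inl p' := by
  refine ⟨aeval (Sum.elim X 0) p, funext_discrete fun x u => ?_⟩
  have h1 : Sum.elim x (fun j => (u j : F)) = Sum.elim x 0 + discreteVector F m u := by
    ext (i | i) <;> simp [discreteVector]
  have h2 : (aeval x).comp (aeval (Sum.elim X 0)) =
      (aeval (Sum.elim x 0) : MvPolynomial (Fin m ⊕ Fin n) F →ₐ[F] F) := by
    ext (i | i) <;> simp
  have h3 := DFunLike.congr_fun h2 p
  rw [AlgHom.comp_apply, aeval_eq_eval, aeval_eq_eval] at h3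
  rw [h1, ← eval_shift, h, ← h1, eval_rename, Sum.elim_comp_inl]
  exact h3.symm

theorem exists_aeval_of_shift_eq {p : MvPolynomial (Fin m ⊕ Fin n) F}
    (hd : ∀ i, pderiv (Sum.inl i) p = 0) {v w : Fin n → ℤ} (hvw : v ⬝ᵥ w = 1)
    (h : ∀ u, v ⬝ᵥ u = 0 → shift u p = p) :
    ∃ P : Polynomial F, p = Polynomial.aeval
      (∑ i, v i • (X (Sum.inr i) : MvPolynomial (Fin m ⊕ Fin n) F)) P := by
  refine ⟨aeval (Sum.elim 0 fun i => w i • Polynomial.X) p, funext_discrete fun x u => ?_⟩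
  set y : Fin m ⊕ Fin n → F := Sum.elim 0 fun j => (((v ⬝ᵥ u) * w j : ℤ) : F) with hy
  set z : Fin m ⊕ Fin n → F := Sum.elim x fun j => (u j : F) with hz
  have h1 : Sum.elim (0 : Fin m → F) (fun j => (u j : F)) = y + discreteVector F m (u - (v ⬝ᵥ u) • w) := by
    ext (i | i) <;> simp [discreteVector, hy]
  have h2 : eval z p = eval (Sum.elim 0 fun j => (u j : F)) p := by
    refine eval₂Hom_congr' rfl (fun i hi _ => ?_) rfl
    rcases i with i | i
    · exact (notMem_vars_of_pderiv_eq_zero (hd i) hi).elim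
    · simp [hz]
  have h3 : v ⬝ᵥ (u - (v ⬝ᵥ u) • w) = 0 := by
    rw [dotProduct_sub, dotProduct_smul, hvw, smul_eq_mul, mul_one, sub_self]
  rw [h2, h1, ← eval_shift, h _ h3]
  have h4 : (aeval z).comp (((Polynomial.aeval
        (∑ i, v i • (X (Sum.inr i) : MvPolynomial (Fin m ⊕ Fin n) F)))).comp
      (aeval (Sum.elim 0 fun i => w i • Polynomial.X))) =
      (aeval y : MvPolynomial (Fin m ⊕ Fin n) F →ₐ[F] F) := by
    ext (i | i)
    · simp [hy]
    · simp [hy, hz, dotProduct, mul_comm]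
  have h5 := DFunLike.congr_fun h4 p
  rw [AlgHom.comp_apply, AlgHom.comp_apply, aeval_eq_eval, aeval_eq_eval] at h5
  exact h5.symm

end Invariant

end Shift

section TwoSided

variable {K : Type*} [Field K]

theorem twoSidedProd_zero (α : ℤ → K) : twoSidedProd 0 α = 1 := by simp [twoSidedProd]

theorem twoSidedProd_add_one (t : ℤ) {α : ℤ → K} (h : ∀ ℓ, α ℓ ≠ 0) :
    twoSidedProd (t + 1) α = twoSidedProd t α * α t := by
  unfold twoSidedProd
  rcases lt_or_ge t 0 with ht | ht
  · obtain ⟨s, rfl⟩ : ∃ s : ℕ, t = -(s + 1 : ℤ) := ⟨(-t - 1).toNat, by omega⟩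
    have h1 : (-(-((s : ℤ) + 1))).toNat = s + 1 := by omega
    rw [if_neg (not_le.2 ht), h1, Finset.prod_range_succ']
    rcases Nat.eq_zero_or_pos s with rfl | hs
    · simp [h]
    · have h2 : (-(-((s : ℤ) + 1) + 1)).toNat = s := by omega
      rw [if_neg (by omega), h2]
      simp only [Nat.cast_zero, add_zero, mul_assoc, inv_mul_cancel₀ (h _), mul_one]
      refine Finset.prod_congr rfl fun i _ => ?_
      congr 2
      push_cast
      ring
  · obtain ⟨s, rfl⟩ := Int.eq_ofNat_of_zero_le ht
    rw [if_pos (by omega), if_pos ht]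
    exact Finset.prod_range_succ (fun i : ℕ => α i) s

theorem twoSidedProd_ne_zero (t : ℤ) {α : ℤ → K} (h : ∀ ℓ, α ℓ ≠ 0) : twoSidedProd t α ≠ 0 := by
  unfold twoSidedProd
  split_ifs
  · exact Finset.prod_ne_zero_iff.2 fun _ _ => h _
  · exact Finset.prod_ne_zero_iff.2 fun _ _ => inv_ne_zero (h _)

theorem twoSidedProd_mul (t : ℤ) (α β : ℤ → K) :
    twoSidedProd t (fun ℓ => α ℓ * β ℓ) = twoSidedProd t α * twoSidedProd t β := by
  unfold twoSidedProd
  split_ifs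
  · exact Finset.prod_mul_distrib
  · simp only [mul_inv, Finset.prod_mul_distrib]

theorem twoSidedProd_inv (t : ℤ) (α : ℤ → K) :
    twoSidedProd t (fun ℓ => (α ℓ)⁻¹) = (twoSidedProd t α)⁻¹ := by
  unfold twoSidedProd
  split_ifs <;> simp only [Finset.prod_inv_distrib]

theorem twoSidedProd_const_one (t : ℤ) : twoSidedProd t (fun _ => (1 : K)) = 1 := by
  unfold twoSidedProd
  split_ifs <;> simp

theorem map_twoSidedProd {G : Type*} [FunLike G K K] [RingHomClass G K K] (σ : G) (t : ℤ)
    (α : ℤ → K) : σ (twoSidedProd t α) = twoSidedProd t fun ℓ => σ (α ℓ) := by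
  unfold twoSidedProd
  split_ifs <;> simp only [map_prod, map_inv₀]

theorem twoSidedProd_add (s t : ℤ) {α : ℤ → K} (h : ∀ ℓ, α ℓ ≠ 0) :
    twoSidedProd (s + t) α = twoSidedProd s α * twoSidedProd t fun ℓ => α (s + ℓ) := by
  induction t using Int.induction_on with
  | zero => rw [add_zero, twoSidedProd_zero, mul_one]
  | succ t ih =>
    rw [← add_assoc, twoSidedProd_add_one _ h, ih, twoSidedProd_add_one _ fun ℓ => h _, mul_assoc]
  | pred t ih =>
    have h1 := twoSidedProd_add_one (s + (-(t : ℤ) - 1)) h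
    have h2 := twoSidedProd_add_one (-(t : ℤ) - 1) fun ℓ => h (s + ℓ)
    rw [sub_add_cancel] at h2
    rw [add_assoc, sub_add_cancel, ih, h2, ← mul_assoc] at h1
    exact (mul_right_cancel₀ (h _) h1).symm

theorem map_twoSidedProd_eq_zero {F : Type*} [Field F] [Algebra F K] (D : Derivation F K K) (t : ℤ)
    {α : ℤ → K} (h : ∀ ℓ, α ℓ ≠ 0) (hD : ∀ ℓ, D (α ℓ) = 0) : D (twoSidedProd t α) = 0 := by
  induction t using Int.induction_on with
  | zero => simp [twoSidedProd_zero]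
  | succ t ih => rw [twoSidedProd_add_one _ h, Derivation.leibniz, ih, hD]; simp
  | pred t ih =>
    have h1 := twoSidedProd_add_one (-(t : ℤ) - 1) h
    rw [sub_add_cancel] at h1
    rw [h1, Derivation.leibniz, hD, smul_zero, zero_add, smul_eq_mul] at ih
    exact (mul_eq_zero.1 ih).resolve_left (h _)

end TwoSided

section ContField

variable {F : Type*} [Field F] {m n : ℕ}

/-- The subfield generated by the continuous variables. -/
noncomputable def contField (F : Type*) [Field F] (m n : ℕ) :
    IntermediateField F (MixedField F m n) :=
  IntermediateField.adjoin F (Set.range fun i : Fin m =>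
    algebraMap (MvPolynomial (Fin m ⊕ Fin n) F) (MixedField F m n) (X (Sum.inl i)))

theorem aeval_algebraMap_X_inl (p : MvPolynomial (Fin m) F) :
    aeval (fun i : Fin m => algebraMap (MvPolynomial (Fin m ⊕ Fin n) F) (MixedField F m n)
      (X (Sum.inl i))) p =
        algebraMap (MvPolynomial (Fin m ⊕ Fin n) F) (MixedField F m n) (rename Sum.inl p) := by
  have : aeval (fun i : Fin m => algebraMap (MvPolynomial (Fin m ⊕ Fin n) F) (MixedField F m n)
      (X (Sum.inl i))) = (IsScalarTower.toAlgHom F (MvPolynomial (Fin m ⊕ Fin n) F)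
        (MixedField F m n)).comp (rename Sum.inl) := by
    ext1 i
    simp
  exact DFunLike.congr_fun this p

theorem memContField_iff {x : MixedField F m n} : memContField x ↔ x ∈ contField F m n := by
  unfold contField memContField
  rw [IntermediateField.mem_adjoin_range_iff]
  simp only [aeval_algebraMap_X_inl]
  constructor
  · rintro ⟨p, q, _, h⟩
    exact ⟨p, q, h⟩
  · rintro ⟨p, q, h⟩
    by_cases hq : q = 0
    · exact ⟨0, 1, one_ne_zero, by rw [h, hq]; simp⟩
    · exact ⟨p, q, hq, h⟩

theorem memContField_of_shift_eq [CharZero F] {p : MvPolynomial (Fin m ⊕ Fin n) F}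
    (h : ∀ u, shift u p = p) :
    memContField (algebraMap (MvPolynomial (Fin m ⊕ Fin n) F) (MixedField F m n) p) := by
  obtain ⟨q, rfl⟩ := exists_rename_of_shift_eq h
  exact ⟨q, 1, one_ne_zero, by simp⟩

end ContField

section LinForm

variable {F : Type*} [Field F] {m n : ℕ}

/-- The linear form `v ⬝ k + ℓ` as a polynomial. -/
noncomputable def linForm (F : Type*) [Field F] (m : ℕ) {n : ℕ} (v : Fin n → ℤ) (ℓ : ℤ) :
    MvPolynomial (Fin m ⊕ Fin n) F :=
  (∑ i, v i • X (Sum.inr i)) + (ℓ : MvPolynomial (Fin m ⊕ Fin n) F)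

theorem shift_linForm (v u : Fin n → ℤ) (ℓ : ℤ) :
    shift u (linForm F m v ℓ) = linForm F m v (ℓ + v ⬝ᵥ u) := by
  simp only [linForm, map_add, map_sum, zsmul_eq_mul, map_mul, shift_X_inr, map_intCast, mul_add,
    Finset.sum_add_distrib, dotProduct, Int.cast_add, Int.cast_sum, Int.cast_mul]
  ring

theorem pderiv_linForm (i : Fin m) (v : Fin n → ℤ) (ℓ : ℤ) :
    pderiv (Sum.inl i) (linForm F m v ℓ) = 0 := by
  simp [linForm, map_sum]

theorem aeval_linForm_ne_zero [CharZero F] {v : Fin n → ℤ} (hv : v ≠ 0) (ℓ : ℤ) {p : Polynomial F}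
    (hp : p ≠ 0) : Polynomial.aeval (linForm F m v ℓ) p ≠ 0 := by
  obtain ⟨j, hj⟩ := Function.ne_iff.1 hv
  have hj' : (v j : F) ≠ 0 := by exact_mod_cast hj
  intro h
  let ψ : MvPolynomial (Fin m ⊕ Fin n) F →ₐ[F] Polynomial F :=
    aeval (Sum.elim 0 (Pi.single j (Polynomial.C (v j : F)⁻¹ * Polynomial.X)))
  have h1 : ψ (linForm F m v ℓ) = Polynomial.X + Polynomial.C (ℓ : F) := by
    simp only [ψ, linForm, map_add, map_sum, map_zsmul, aeval_X, Sum.elim_inr, map_intCast]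
    congr 1
    rw [Finset.sum_eq_single j (fun i _ hi => by simp [hi]) (by simp), Pi.single_eq_same,
      zsmul_eq_mul, ← mul_assoc, ← Polynomial.C_eq_intCast, ← map_mul]
    simp [hj']
  have h2 := congrArg ψ h
  rw [← Polynomial.aeval_algHom_apply, h1, map_zero] at h2
  have h3 : Polynomial.taylor (ℓ : F) p = 0 := by
    rw [Polynomial.taylor_apply, ← h2, Polynomial.aeval_def, Polynomial.comp]
    rfl
  exact hp ((Polynomial.taylor_injective (ℓ : F)) (by rw [h3, map_zero]))

theorem shift_aeval_linForm (v u : Fin n → ℤ) (ℓ : ℤ) (p : Polynomial F) :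
    shift u (Polynomial.aeval (linForm F m v ℓ) p) =
      Polynomial.aeval (linForm F m v (ℓ + v ⬝ᵥ u)) p := by
  rw [← shift_linForm]
  exact (Polynomial.aeval_algHom_apply (shift u).toAlgHom _ _).symm

theorem pderiv_aeval_linForm (i : Fin m) (v : Fin n → ℤ) (ℓ : ℤ) (p : Polynomial F) :
    pderiv (Sum.inl i) (Polynomial.aeval (linForm F m v ℓ) p) = 0 := by
  rw [Derivation.map_aeval, pderiv_linForm, smul_zero]

end LinForm

section Operators

variable {F : Type*} [Field F] {m n : ℕ}

/-- The derivations `D` extend the partial derivatives in the continuous variables. -/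
def ExtendsPartial (D : Fin m → Derivation F (MixedField F m n) (MixedField F m n)) : Prop :=
  ∀ i (p : MvPolynomial (Fin m ⊕ Fin n) F),
    D i (algebraMap (MvPolynomial (Fin m ⊕ Fin n) F) (MixedField F m n) p) =
      algebraMap (MvPolynomial (Fin m ⊕ Fin n) F) (MixedField F m n) (pderiv (Sum.inl i) p)

/-- The automorphisms `S` extend the unit shifts of the discrete variables. -/
def ExtendsShift (S : Fin n → (MixedField F m n ≃ₐ[F] MixedField F m n)) : Prop :=
  ∀ j (p : MvPolynomial (Fin m ⊕ Fin n) F),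
    S j (algebraMap (MvPolynomial (Fin m ⊕ Fin n) F) (MixedField F m n) p) =
      algebraMap (MvPolynomial (Fin m ⊕ Fin n) F) (MixedField F m n) (shift (Pi.single j 1) p)

theorem extendsShift_of_X {S : Fin n → (MixedField F m n ≃ₐ[F] MixedField F m n)}
    (hS : ∀ (j : Fin n) (v : Fin m ⊕ Fin n),
      S j (algebraMap (MvPolynomial (Fin m ⊕ Fin n) F) (MixedField F m n) (X v))
        = algebraMap (MvPolynomial (Fin m ⊕ Fin n) F) (MixedField F m n) (X v)
          + (if v = Sum.inr j then 1 else 0)) : ExtendsShift S := by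
  intro j p
  have : (S j).toAlgHom.comp (IsScalarTower.toAlgHom F (MvPolynomial (Fin m ⊕ Fin n) F)
      (MixedField F m n)) = (IsScalarTower.toAlgHom F (MvPolynomial (Fin m ⊕ Fin n) F)
      (MixedField F m n)).comp (shift (Pi.single j 1)).toAlgHom := by
    ext1 v
    simp only [AlgHom.comp_apply, IsScalarTower.coe_toAlgHom', AlgEquiv.coe_toAlgHom]
    rw [hS]
    rcases v with i | i
    · simp [shift_X_inl]
    · rw [shift_X_inr, map_add]
      rcases eq_or_ne i j with rfl | h
      · simp
      · simp [h]
  exact DFunLike.congr_fun this p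

theorem exists_algebraMap_div (x : MixedField F m n) :
    ∃ p q : MvPolynomial (Fin m ⊕ Fin n) F, q ≠ 0 ∧
      x = algebraMap (MvPolynomial (Fin m ⊕ Fin n) F) (MixedField F m n) p /
        algebraMap (MvPolynomial (Fin m ⊕ Fin n) F) (MixedField F m n) q := by
  rcases eq_or_ne x 0 with rfl | hx
  · exact ⟨0, 1, one_ne_zero, by simp⟩
  · obtain ⟨p, q, _, hq, h⟩ := exists_div_ne_zero (R := MvPolynomial (Fin m ⊕ Fin n) F) hx
    exact ⟨p, q, hq, h⟩

variable {D : Fin m → Derivation F (MixedField F m n) (MixedField F m n)}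
  {S : Fin n → (MixedField F m n ≃ₐ[F] MixedField F m n)}

theorem ExtendsPartial.comm_shift (hD : ExtendsPartial D) (hS : ExtendsShift S) (i : Fin m)
    (j : Fin n) (x : MixedField F m n) : D i (S j x) = S j (D i x) := by
  obtain ⟨p, q, hq, rfl⟩ := exists_algebraMap_div x
  simp only [Derivation.leibniz_div, map_div₀, map_inv₀, hS j _, hD i _, pderiv_shift, map_sub,
    map_mul, smul_eq_mul, map_pow]

theorem ExtendsPartial.comm (hD : ExtendsPartial D) (i j : Fin m) (x : MixedField F m n) :
    D i (D j x) = D j (D i x) := by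
  have h0 : ⁅D i, D j⁆ = 0 := by
    have h1 (p : MvPolynomial (Fin m ⊕ Fin n) F) : ⁅D i, D j⁆
        (algebraMap (MvPolynomial (Fin m ⊕ Fin n) F) (MixedField F m n) p) = 0 := by
      rw [Derivation.commutator_apply, hD, hD, hD, hD, ← map_sub, sub_eq_zero.2, map_zero]
      have : ⁅pderiv (R := F) (Sum.inl i : Fin m ⊕ Fin n),
          pderiv (R := F) (Sum.inl j : Fin m ⊕ Fin n)⁆ = 0 := by
        classical
        refine derivation_ext fun k => ?_
        simp only [Derivation.commutator_apply, pderiv_X, Pi.single_apply,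
          Derivation.coe_zero, Pi.zero_apply]
        split_ifs <;> simp
      have := DFunLike.congr_fun this p
      rw [Derivation.commutator_apply] at this
      exact sub_eq_zero.1 this
    ext x
    obtain ⟨p, q, hq, rfl⟩ := exists_algebraMap_div x
    rw [Derivation.leibniz_div, h1, h1]
    simp
  have := DFunLike.congr_fun h0 x
  rw [Derivation.commutator_apply] at this
  exact sub_eq_zero.1 this

theorem ExtendsShift.comm (hS : ExtendsShift S) (i j : Fin n) (x : MixedField F m n) :
    S i (S j x) = S j (S i x) := by
  obtain ⟨p, q, hq, rfl⟩ := exists_algebraMap_div x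
  simp only [map_div₀, hS _ _, shift_shift, add_comm (Pi.single i 1)]

theorem ExtendsShift.ordAt_apply (hS : ExtendsShift S) (j : Fin n) (q : PrimeClass F m n)
    {x : MixedField F m n} (hx : x ≠ 0) :
    ordAt q.rep (S j x) = ordAt (-(Pi.single j 1 : Fin n → ℤ) +ᵥ q).rep x := by
  set q' := -(Pi.single j 1 : Fin n → ℤ) +ᵥ q with hq'
  have h1 : Associated q.rep (shift (Pi.single j 1) q'.rep) := by
    have := q'.rep_vadd (Pi.single j 1)
    rwa [hq', vadd_vadd, add_neg_cancel, zero_vadd, ← hq'] at this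
  rw [ordAt_congr h1]
  exact ordAt_map_equiv q'.prime_rep (shift (Pi.single j 1)).toRingEquiv (S j).toRingEquiv
    (fun a => hS j a) hx

theorem ExtendsShift.eq_of_memContField (hS : ExtendsShift S) (j : Fin n) {x : MixedField F m n}
    (hx : memContField x) : S j x = x := by
  obtain ⟨p, q, _, rfl⟩ := hx
  have h (p : MvPolynomial (Fin m) F) : shift (Pi.single j 1 : Fin n → ℤ) (rename Sum.inl p) =
      rename Sum.inl p := by
    have : (shift (Pi.single j 1 : Fin n → ℤ)).toAlgHom.comp (rename Sum.inl) =
        (rename Sum.inl : MvPolynomial (Fin m) F →ₐ[F] _) := by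
      ext1 i
      simp [shift_X_inl]
    exact DFunLike.congr_fun this p
  rw [map_div₀, hS, hS, h, h]

theorem ExtendsPartial.memContField_apply (hD : ExtendsPartial D) (i : Fin m) {x : MixedField F m n}
    (hx : memContField x) : memContField (D i x) := by
  rw [memContField_iff] at hx ⊢
  refine IntermediateField.derivation_mem_of_mem_adjoin (D i) le_rfl ?_ hx
  rintro _ ⟨l, rfl⟩
  classical
  beta_reduce
  rw [hD, pderiv_X, Pi.single_apply]
  split_ifs
  · rw [map_one]; exact one_mem _
  · rw [map_zero]; exact zero_mem _

variable [CharZero F]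

theorem PrimeClass.shift_rep_of_forall_vadd_eq (q : PrimeClass F m n)
    (h : ∀ j : Fin n, (Pi.single j 1 : Fin n → ℤ) +ᵥ q = q) (u : Fin n → ℤ) :
    shift u q.rep = q.rep := by
  rw [← PrimeClass.vadd_eq_self_iff_shift]
  have : AddAction.stabilizer (Fin n → ℤ) q = ⊤ := AddSubgroup.eq_top_of_single_mem _ h
  exact (this ▸ AddSubgroup.mem_top u : u ∈ AddAction.stabilizer (Fin n → ℤ) q)

omit [CharZero F] in
theorem shift_eq_self_of_forall_single {p : MvPolynomial (Fin m ⊕ Fin n) F}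
    (h : ∀ j : Fin n, shift (Pi.single j 1) p = p) (u : Fin n → ℤ) : shift u p = p := by
  let A : AddSubgroup (Fin n → ℤ) :=
    { carrier := {u | shift u p = p}
      zero_mem' := shift_zero p
      add_mem' := fun {u v} hu hv => by
        rw [Set.mem_ofPred_eq] at *
        rw [← shift_shift, hv, hu]
      neg_mem' := fun {u} hu => by
        rw [Set.mem_ofPred_eq] at *
        conv_lhs => rw [← hu, shift_shift, neg_add_cancel, shift_zero] }
  have : A = ⊤ := AddSubgroup.eq_top_of_single_mem _ h
  exact (this ▸ AddSubgroup.mem_top u : u ∈ A)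

omit [CharZero F] in
theorem dvd_shift_of_isRelPrime {p q : MvPolynomial (Fin m ⊕ Fin n) F} (hpq : IsRelPrime p q)
    {u : Fin n → ℤ} (h : shift u p * q = p * shift u q) : Associated (shift u p) p := by
  have h1 : p ∣ shift u p := hpq.dvd_of_dvd_mul_right (h ▸ dvd_mul_right _ _)
  have h2 : p ∣ shift (-u) p := by
    refine hpq.dvd_of_dvd_mul_right (?_ : p ∣ shift (-u) p * q)
    have := congrArg (shift (-u)) h
    rw [map_mul, map_mul, shift_shift, shift_shift, neg_add_cancel, shift_zero, shift_zero] at this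
    exact this ▸ dvd_mul_right _ _
  refine associated_of_dvd_dvd ?_ h1
  have := map_dvd (shift u) h2
  rwa [shift_shift, add_neg_cancel, shift_zero] at this

theorem ExtendsShift.memContField_of_eq (hS : ExtendsShift S) {x : MixedField F m n}
    (hx : ∀ j, S j x = x) : memContField x := by
  rcases eq_or_ne x 0 with rfl | hx0
  · exact ⟨0, 1, one_ne_zero, by simp⟩
  set p := IsFractionRing.num (MvPolynomial (Fin m ⊕ Fin n) F) x with hp
  set q : MvPolynomial (Fin m ⊕ Fin n) F :=
    (IsFractionRing.den (MvPolynomial (Fin m ⊕ Fin n) F) x : MvPolynomial (Fin m ⊕ Fin n) F) with hq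
  have hpq : IsRelPrime p q := IsFractionRing.num_den_reduced _ x
  have hxpq : algebraMap _ (MixedField F m n) p / algebraMap _ (MixedField F m n) q = x :=
    IsFractionRing.mk'_num_den' _ x
  have hp0 : p ≠ 0 := by simpa [hp, IsFractionRing.num_eq_zero] using hx0
  have hq0 : q ≠ 0 := nonZeroDivisors.coe_ne_zero _
  have hinv {p q : MvPolynomial (Fin m ⊕ Fin n) F} (hpq : IsRelPrime p q) (hp0 : p ≠ 0)
      (h : ∀ j, shift (Pi.single j 1) p * q = p * shift (Pi.single j 1) q) (u : Fin n → ℤ) :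
      shift u p = p := by
    refine shift_eq_self_of_forall_single (fun j => ?_) u
    have := dvd_shift_of_isRelPrime hpq (h j)
    refine translateVars_eq_self_of_associated (M := 1) one_ne_zero hp0 ?_
    rwa [Int.cast_one, one_smul]
  have hcross (j : Fin n) : shift (Pi.single j 1) p * q = p * shift (Pi.single j 1) q := by
    have := hx j
    rw [← hxpq, map_div₀, hS, hS, div_eq_div_iff (algebraMap_ne_zero_of_ne (by simpa using hq0))
      (algebraMap_ne_zero_of_ne hq0), ← map_mul, ← map_mul] at this
    exact IsFractionRing.injective _ (MixedField F m n) this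
  obtain ⟨p', hp'⟩ := exists_rename_of_shift_eq (hinv hpq hp0 hcross)
  obtain ⟨q', hq'⟩ := exists_rename_of_shift_eq (hinv hpq.symm hq0 fun j => by
    rw [mul_comm, ← hcross, mul_comm])
  refine ⟨p', q', ?_, by rw [← hp', ← hq', hxpq]⟩
  rintro rfl
  exact hq0 (by rw [hq', map_zero])

end Operators

section Standard

variable {F : Type*} [Field F] {m n : ℕ}
  {D : Fin m → Derivation F (MixedField F m n) (MixedField F m n)}
  {S : Fin n → (MixedField F m n ≃ₐ[F] MixedField F m n)}

/-- The value of a univariate polynomial at `v ⬝ k + ℓ`. -/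
noncomputable def evalLinForm (m : ℕ) {n : ℕ} (v : Fin n → ℤ) (p : Polynomial F) (ℓ : ℤ) :
    MixedField F m n :=
  algebraMap (MvPolynomial (Fin m ⊕ Fin n) F) (MixedField F m n)
    (Polynomial.aeval (linForm F m v ℓ) p)

theorem evalLinForm_mul (v : Fin n → ℤ) (p q : Polynomial F) (ℓ : ℤ) :
    evalLinForm m v (p * q) ℓ = evalLinForm m v p ℓ * evalLinForm m v q ℓ := by
  simp only [evalLinForm, map_mul]

theorem evalLinForm_one (v : Fin n → ℤ) (ℓ : ℤ) : evalLinForm m v (1 : Polynomial F) ℓ = 1 := by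
  simp only [evalLinForm, map_one]

theorem evalLinForm_ne_zero [CharZero F] {v : Fin n → ℤ} (hv : v ≠ 0) {p : Polynomial F}
    (hp : p ≠ 0) (ℓ : ℤ) : evalLinForm m v p ℓ ≠ 0 :=
  algebraMap_ne_zero_of_ne (aeval_linForm_ne_zero hv ℓ hp)

theorem ExtendsShift.evalLinForm (hS : ExtendsShift S) (j : Fin n) (v : Fin n → ℤ)
    (p : Polynomial F) (ℓ : ℤ) : S j (evalLinForm m v p ℓ) = _root_.evalLinForm m v p (ℓ + v j) := by
  rw [_root_.evalLinForm, hS, shift_aeval_linForm, dotProduct_single, mul_one]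
  rfl

theorem ExtendsPartial.evalLinForm (hD : ExtendsPartial D) (i : Fin m) (v : Fin n → ℤ)
    (p : Polynomial F) (ℓ : ℤ) : D i (evalLinForm m v p ℓ) = 0 := by
  rw [_root_.evalLinForm, hD, pderiv_aeval_linForm, map_zero]

/-- The compatibility conditions on the shift quotients `b`. -/
def IsCompatible (D : Fin m → Derivation F (MixedField F m n) (MixedField F m n))
    (S : Fin n → (MixedField F m n ≃ₐ[F] MixedField F m n)) (b : Fin n → MixedField F m n) : Prop :=
  (∀ j, b j ≠ 0) ∧ (∀ i j, S i (b j) / b j = S j (b i) / b i) ∧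
    ∃ a : Fin m → MixedField F m n, ∀ i j, D i (b j) / b j = S j (a i) - a i

theorem IsCompatible.mul {b c : Fin n → MixedField F m n} (hb : IsCompatible D S b)
    (hc : IsCompatible D S c) : IsCompatible D S (fun j => b j * c j) := by
  obtain ⟨hb0, hbS, a, ha⟩ := hb
  obtain ⟨hc0, hcS, a', ha'⟩ := hc
  refine ⟨fun j => mul_ne_zero (hb0 j) (hc0 j), fun i j => ?_, fun i => a i + a' i, fun i j => ?_⟩
  · beta_reduce
    rw [map_mul, map_mul, mul_div_mul_comm, mul_div_mul_comm, hbS, hcS]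
  · have := hb0 j
    have := hc0 j
    have h : D i (b j * c j) / (b j * c j) = D i (b j) / b j + D i (c j) / c j := by
      rw [Derivation.leibniz]
      simp only [smul_eq_mul]
      field_simp
      ring
    rw [h, ha, ha', map_add]
    ring

theorem IsCompatible.inv {b : Fin n → MixedField F m n} (hb : IsCompatible D S b) :
    IsCompatible D S (fun j => (b j)⁻¹) := by
  obtain ⟨hb0, hbS, a, ha⟩ := hb
  refine ⟨fun j => inv_ne_zero (hb0 j), fun i j => ?_, fun i => -a i, fun i j => ?_⟩
  · beta_reduce
    rw [map_inv₀, map_inv₀, inv_div_inv, inv_div_inv, ← inv_div, hbS, inv_div]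
  · have := hb0 j
    have h : D i (b j)⁻¹ / (b j)⁻¹ = -(D i (b j) / b j) := by
      rw [Derivation.leibniz_inv]
      simp only [smul_eq_mul]
      field_simp
    rw [h, ha, map_neg]
    ring

/-- The normal form asserted by the structure theorem, for the shift quotients. -/
def IsStandard (S : Fin n → (MixedField F m n ≃ₐ[F] MixedField F m n))
    (b : Fin n → MixedField F m n) : Prop :=
  ∃ (f : MixedField F m n) (h : Fin n → MixedField F m n) (V : Finset (Fin n → ℤ))
    (p q : (Fin n → ℤ) → Polynomial F), f ≠ 0 ∧ (∀ j, memContField (h j) ∧ h j ≠ 0) ∧ 0 ∉ V ∧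
    (∀ v, (p v).Monic ∧ (q v).Monic) ∧ (∀ v, v ∉ V → p v = 1 ∧ q v = 1) ∧
    ∀ j, b j = S j f / f * h j * ∏ v ∈ V, twoSidedProd (v j) fun ℓ =>
      evalLinForm m v (p v) ℓ / evalLinForm m v (q v) ℓ

theorem IsStandard.mul {b c : Fin n → MixedField F m n} (hb : IsStandard S b)
    (hc : IsStandard S c) : IsStandard S (fun j => b j * c j) := by
  classical
  obtain ⟨f, h, V, p, q, hf, hh, hV, hpq, h1, hb⟩ := hb
  obtain ⟨f', h', V', p', q', hf', hh', hV', hpq', h1', hc⟩ := hc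
  refine ⟨f * f', fun j => h j * h' j, V ∪ V', fun v => p v * p' v, fun v => q v * q' v,
    mul_ne_zero hf hf', fun j => ⟨?_, mul_ne_zero (hh j).2 (hh' j).2⟩, ?_,
    fun v => ⟨(hpq v).1.mul (hpq' v).1, (hpq v).2.mul (hpq' v).2⟩, fun v hv => ?_, fun j => ?_⟩
  · rw [memContField_iff]
    exact mul_mem (memContField_iff.1 (hh j).1) (memContField_iff.1 (hh' j).1)
  · simp [hV, hV']
  · rw [Finset.mem_union, not_or] at hv
    simp [h1 v hv.1, h1' v hv.2]
  · beta_reduce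
    simp only [evalLinForm_mul, mul_div_mul_comm, twoSidedProd_mul, Finset.prod_mul_distrib]
    rw [hb, hc, Finset.prod_subset (Finset.subset_union_left (s₁ := V) (s₂ := V')),
      Finset.prod_subset (Finset.subset_union_right (s₁ := V) (s₂ := V')), map_mul,
      mul_div_mul_comm]
    · ring
    · intro v _ hv
      simp [h1' v hv, evalLinForm_one, twoSidedProd_const_one]
    · intro v _ hv
      simp [h1 v hv, evalLinForm_one, twoSidedProd_const_one]

theorem IsStandard.inv {b : Fin n → MixedField F m n} (hb : IsStandard S b) :
    IsStandard S (fun j => (b j)⁻¹) := by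
  obtain ⟨f, h, V, p, q, hf, hh, hV, hpq, h1, hb⟩ := hb
  refine ⟨f⁻¹, fun j => (h j)⁻¹, V, q, p, inv_ne_zero hf, fun j => ⟨?_, inv_ne_zero (hh j).2⟩, hV,
    fun v => (hpq v).symm, fun v hv => (h1 v hv).symm, fun j => ?_⟩
  · rw [memContField_iff]
    exact inv_mem (memContField_iff.1 (hh j).1)
  · beta_reduce
    rw [hb]
    simp only [mul_inv, map_inv₀, div_eq_mul_inv, ← Finset.prod_inv_distrib, ← twoSidedProd_inv]
    simp only [inv_inv, mul_comm]

/-- Compatible families with the asserted normal form. -/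
def IsGood (D : Fin m → Derivation F (MixedField F m n) (MixedField F m n))
    (S : Fin n → (MixedField F m n ≃ₐ[F] MixedField F m n)) (b : Fin n → MixedField F m n) : Prop :=
  IsCompatible D S b ∧ IsStandard S b

theorem IsGood.mul {b c : Fin n → MixedField F m n} (hb : IsGood D S b) (hc : IsGood D S c) :
    IsGood D S (fun j => b j * c j) := ⟨hb.1.mul hc.1, hb.2.mul hc.2⟩

theorem IsGood.inv {b : Fin n → MixedField F m n} (hb : IsGood D S b) :
    IsGood D S (fun j => (b j)⁻¹) := ⟨hb.1.inv, hb.2.inv⟩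

theorem isGood_of_memContField (hD : ExtendsPartial D) (hS : ExtendsShift S)
    {h : Fin n → MixedField F m n} (hh : ∀ j, memContField (h j) ∧ h j ≠ 0) : IsGood D S h := by
  classical
  refine ⟨⟨fun j => (hh j).2, fun i j => ?_, fun i => ∑ j, algebraMap
    (MvPolynomial (Fin m ⊕ Fin n) F) (MixedField F m n) (X (Sum.inr j)) * (D i (h j) / h j),
    fun i j => ?_⟩, 1, h, ∅, 1, 1, one_ne_zero, hh, by simp, fun v => ⟨Polynomial.monic_one,
      Polynomial.monic_one⟩, fun v _ => ⟨rfl, rfl⟩, fun j => by simp⟩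
  · rw [hS.eq_of_memContField _ (hh _).1, hS.eq_of_memContField _ (hh _).1, div_self (hh j).2,
      div_self (hh i).2]
  · rw [map_sum, ← Finset.sum_sub_distrib, Finset.sum_eq_single j]
    · rw [map_mul, map_div₀, hS.eq_of_memContField _ (hh _).1,
        hS.eq_of_memContField _ (hD.memContField_apply i (hh _).1), hS, shift_X_inr, map_add]
      simp
      ring
    · intro l _ hl
      rw [map_mul, map_div₀, hS.eq_of_memContField _ (hh _).1,
        hS.eq_of_memContField _ (hD.memContField_apply i (hh _).1), hS, shift_X_inr, map_add]
      simp [hl]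
    · simp

theorem isGood_coboundary (hD : ExtendsPartial D) (hS : ExtendsShift S)
    {f : MixedField F m n} (hf : f ≠ 0) : IsGood D S (fun j => S j f / f) := by
  have hSf (j : Fin n) : S j f ≠ 0 := by simpa using hf
  refine ⟨⟨fun j => div_ne_zero (hSf j) hf, fun i j => ?_, fun i => D i f / f,
    fun i j => ?_⟩, f, fun _ => 1, ∅, 1, 1, hf, fun j => ⟨⟨1, 1, one_ne_zero, by simp⟩, one_ne_zero⟩,
      by simp, fun v => ⟨Polynomial.monic_one,
      Polynomial.monic_one⟩, fun v _ => ⟨rfl, rfl⟩, fun j => by simp⟩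
  · have := hSf i
    have := hSf j
    rw [map_div₀, map_div₀, hS.comm]
    field_simp
  · have := hSf j
    rw [Derivation.leibniz_div, hD.comm_shift hS, map_div₀]
    simp only [smul_eq_mul]
    field_simp

theorem isGood_twoSidedProd [CharZero F] (hD : ExtendsPartial D) (hS : ExtendsShift S)
    {v : Fin n → ℤ} (hv : v ≠ 0) {p : Polynomial F} (hp : p.Monic) :
    IsGood D S (fun j => twoSidedProd (v j) (evalLinForm m v p)) := by
  classical
  have hα := evalLinForm_ne_zero (m := m) hv hp.ne_zero
  have hB (j : Fin n) := twoSidedProd_ne_zero (v j) hα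
  refine ⟨⟨hB, fun i j => ?_, fun i => 0, fun i j => ?_⟩, 1, fun _ => 1, {v},
    Function.update 1 v p, 1, one_ne_zero, fun j => ⟨⟨1, 1, one_ne_zero, by simp⟩, one_ne_zero⟩,
    by simpa using hv.symm, fun u => ⟨?_, Polynomial.monic_one⟩, fun u hu => ⟨?_, rfl⟩, fun j => ?_⟩
  · have h1 := twoSidedProd_add (v i) (v j) hα
    have h2 := twoSidedProd_add (v j) (v i) hα
    have h3 (i j : Fin n) : S i (twoSidedProd (v j) (evalLinForm m v p)) =
        twoSidedProd (v j) fun ℓ => evalLinForm m v p (v i + ℓ) := by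
      rw [map_twoSidedProd]
      simp only [hS.evalLinForm, add_comm (v i)]
    rw [h3, h3, div_eq_div_iff (hB _) (hB _), mul_comm, ← h1, mul_comm, ← h2, add_comm]
  · rw [map_twoSidedProd_eq_zero (D i) _ hα (hD.evalLinForm i v p)]
    simp
  · rcases eq_or_ne u v with rfl | h
    · simp [hp]
    · simp [h]
  · rw [Finset.mem_singleton] at hu
    simp [hu]
  · simp [evalLinForm_one]

theorem IsGood.zpow {b : Fin n → MixedField F m n} (hD : ExtendsPartial D) (hS : ExtendsShift S)
    (hb : IsGood D S b) (s : ℤ) : IsGood D S (fun j => b j ^ s) := by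
  have hnat (s : ℕ) : IsGood D S (fun j => b j ^ s) := by
    induction s with
    | zero =>
      simpa using isGood_of_memContField hD hS (h := fun _ => 1)
        fun j => ⟨⟨1, 1, one_ne_zero, by simp⟩, one_ne_zero⟩
    | succ s ih => simpa only [pow_succ] using ih.mul hb
  obtain ⟨s, rfl | rfl⟩ := s.eq_nat_or_neg
  · simpa only [zpow_natCast] using hnat s
  · simpa only [zpow_neg, zpow_natCast] using (hnat s).inv

end Standard

section Orbit

variable {F : Type*} [Field F] {m n : ℕ}

theorem PrimeClass.eq_of_rep_dvd {q q' : PrimeClass F m n} (h : q.rep ∣ q'.rep) : q = q' :=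
  PrimeClass.ext_rep (q.irreducible_rep.associated_of_dvd q'.irreducible_rep h)

theorem PrimeClass.ordAt_rep_of_ne {q q' : PrimeClass F m n} (h : q ≠ q') :
    ordAt q.rep (algebraMap _ (MixedField F m n) q'.rep) = 0 :=
  ordAt_eq_zero_of_not_dvd q.prime_rep fun hd => h (PrimeClass.eq_of_rep_dvd hd)

theorem PrimeClass.exists_ordAt_eq {f : PrimeClass F m n → ℤ} (hf : {q | f q ≠ 0}.Finite) :
    ∃ x : MixedField F m n, x ≠ 0 ∧ ∀ q : PrimeClass F m n, ordAt q.rep x = f q := by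
  classical
  have h0 (q : PrimeClass F m n) : algebraMap _ (MixedField F m n) q.rep ≠ 0 :=
    algebraMap_ne_zero_of_ne q.prime_rep.ne_zero
  have hz (q : PrimeClass F m n) : (algebraMap _ (MixedField F m n) q.rep) ^ f q ≠ 0 :=
    zpow_ne_zero _ (h0 q)
  refine ⟨∏ q ∈ hf.toFinset, (algebraMap _ (MixedField F m n) q.rep) ^ f q,
    Finset.prod_ne_zero_iff.2 fun q _ => hz q, fun q => ?_⟩
  rw [ordAt_prod q.prime_rep _ _ fun i _ => hz i]
  have h (i : PrimeClass F m n) : ordAt q.rep ((algebraMap _ (MixedField F m n) i.rep) ^ f i) =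
      if i = q then f q else 0 := by
    rw [ordAt_zpow q.prime_rep (h0 i)]
    split_ifs with hi
    · subst hi
      rw [ordAt_self i.prime_rep, mul_one]
    · rw [PrimeClass.ordAt_rep_of_ne (Ne.symm hi), mul_zero]
  simp only [h, Finset.sum_ite_eq', Set.Finite.mem_toFinset, Set.mem_ofPred_eq]
  split_ifs with hq
  · rfl
  · exact (not_not.1 hq).symm

variable {D : Fin m → Derivation F (MixedField F m n) (MixedField F m n)}
  {S : Fin n → (MixedField F m n ≃ₐ[F] MixedField F m n)}

theorem exists_isGood_of_potential (hD : ExtendsPartial D) (hS : ExtendsShift S)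
    {f : PrimeClass F m n → ℤ} (hf : {q | f q ≠ 0}.Finite) :
    ∃ c, IsGood D S c ∧ ∀ i (q : PrimeClass F m n),
      ordAt q.rep (c i) = f q - f (-(Pi.single i 1 : Fin n → ℤ) +ᵥ q) := by
  obtain ⟨x, hx, hxf⟩ := PrimeClass.exists_ordAt_eq hf
  refine ⟨_, (isGood_coboundary hD hS hx).inv, fun i q => ?_⟩
  have hSx : S i x ≠ 0 := (map_ne_zero _).2 hx
  rw [ordAt_inv q.prime_rep (div_ne_zero hSx hx), ordAt_div' q.prime_rep hSx hx,
    hS.ordAt_apply i q hx, hxf, hxf, neg_sub]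

theorem IsCompatible.ordAt_cocycle (hS : ExtendsShift S) {b : Fin n → MixedField F m n}
    (hb : IsCompatible D S b) (i j : Fin n) (q : PrimeClass F m n) :
    ordAt q.rep (b i) + ordAt (-(Pi.single i 1 : Fin n → ℤ) +ᵥ q).rep (b j) =
      ordAt q.rep (b j) + ordAt (-(Pi.single j 1 : Fin n → ℤ) +ᵥ q).rep (b i) := by
  obtain ⟨h0, hSS, -⟩ := hb
  have h1 (i j : Fin n) : S i (b j) ≠ 0 := (map_ne_zero _).2 (h0 j)
  have h : b i * S i (b j) = b j * S j (b i) := by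
    have := hSS i j
    rw [div_eq_div_iff (h0 j) (h0 i)] at this
    rw [mul_comm, this, mul_comm]
  rw [← hS.ordAt_apply i q (h0 j), ← hS.ordAt_apply j q (h0 i),
    ← ordAt_mul q.prime_rep (h0 i) (h1 i j), ← ordAt_mul q.prime_rep (h0 j) (h1 j i), h]

end Orbit

section Derivative

theorem MvPolynomial.totalDegree_pderiv_lt {σ R : Type*} [CommSemiring R] {i : σ} {p : MvPolynomial σ R}
    (h : pderiv i p ≠ 0) : (pderiv i p).totalDegree < p.totalDegree := by
  classical
  obtain ⟨d, hd, hdeg⟩ := Finset.exists_mem_eq_sup (pderiv i p).support (support_nonempty.2 h)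
    fun s => s.sum fun _ e => e
  rw [mem_support_iff, coeff_pderiv] at hd
  have hle := le_totalDegree (mem_support_iff.2 (left_ne_zero_of_mul hd))
  rw [Finsupp.sum_add_index' (fun _ => rfl) fun _ _ _ => rfl,
    Finsupp.sum_single_index rfl] at hle
  rw [totalDegree, hdeg]
  exact hle

theorem MvPolynomial.not_dvd_pderiv {σ R : Type*} [CommRing R] [IsDomain R] {i : σ}
    {p : MvPolynomial σ R} (h : pderiv i p ≠ 0) : ¬ p ∣ pderiv i p := by
  rintro ⟨q, hq⟩
  have hp : p ≠ 0 := by rintro rfl; exact h (map_zero _)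
  have hq0 : q ≠ 0 := by rintro rfl; exact h (by rw [hq, mul_zero])
  have := totalDegree_pderiv_lt h
  rw [hq, totalDegree_mul_of_isDomain hp hq0] at this
  omega

end Derivative

section Continuous

open Filter

variable {F : Type*} [Field F] {m n : ℕ}
  {D : Fin m → Derivation F (MixedField F m n) (MixedField F m n)}
  {S : Fin n → (MixedField F m n ≃ₐ[F] MixedField F m n)}

theorem neg_succ_smul_vadd {G P : Type*} [AddCommGroup G] [AddAction G P] (s : ℕ) (e : G) (q : P) :
    (-((s + 1 : ℕ) : ℤ) • e) +ᵥ q = (-(s : ℤ) • e) +ᵥ (-e +ᵥ q) := by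
  rw [vadd_vadd, Nat.cast_succ, neg_add, add_smul, neg_one_zsmul]

theorem ExtendsShift.ordAt_iterate (hS : ExtendsShift S) (j : Fin n) (N : ℕ) (q : PrimeClass F m n)
    {x : MixedField F m n} (hx : x ≠ 0) :
    ordAt q.rep ((S j)^[N] x) =
      ordAt ((-(N : ℤ) • (Pi.single j 1 : Fin n → ℤ)) +ᵥ q).rep x := by
  induction N generalizing q with
  | zero => simp
  | succ N ih =>
    have h0 : (S j)^[N] x ≠ 0 := fun h => hx ((S j).injective.iterate N
      (h.trans (Function.iterate_fixed (map_zero (S j)) N).symm))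
    rw [Function.iterate_succ_apply', hS.ordAt_apply j q h0, ih, neg_succ_smul_vadd]

theorem exists_iterated_cocycle (hD : ExtendsPartial D) (hS : ExtendsShift S)
    {a : Fin m → MixedField F m n} {j : Fin n} {b : MixedField F m n} (hb : b ≠ 0)
    (ha : ∀ i, D i b / b = S j (a i) - a i) (N : ℕ) :
    ∃ x : MixedField F m n, x ≠ 0 ∧
      (∀ q : PrimeClass F m n, ordAt q.rep x = ∑ s ∈ Finset.range N,
        ordAt ((-(s : ℤ) • (Pi.single j 1 : Fin n → ℤ)) +ᵥ q).rep b) ∧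
      ∀ i, D i x / x = (S j)^[N] (a i) - a i := by
  induction N with
  | zero => exact ⟨1, one_ne_zero, fun q => by simp [ordAt_one q.prime_rep], fun i => by simp⟩
  | succ N ih =>
    obtain ⟨x, hx, hord, hlog⟩ := ih
    have hSx : S j x ≠ 0 := (map_ne_zero _).2 hx
    refine ⟨b * S j x, mul_ne_zero hb hSx, fun q => ?_, fun i => ?_⟩
    · rw [ordAt_mul q.prime_rep hb hSx, hS.ordAt_apply j q hx, hord, Finset.sum_range_succ', add_comm]
      simp only [neg_succ_smul_vadd, Nat.cast_zero, neg_zero, zero_smul, zero_vadd]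
    · have h : D i (b * S j x) / (b * S j x) = D i b / b + S j (D i x / x) := by
        rw [Derivation.leibniz, hD.comm_shift hS, map_div₀, smul_eq_mul, smul_eq_mul]
        field_simp
        ring
      rw [h, ha, hlog, map_sub, Function.iterate_succ_apply']
      ring

theorem ordAt_neg_of_potential_ne_zero [CharZero F] (hD : ExtendsPartial D) (hS : ExtendsShift S)
    {a : Fin m → MixedField F m n} {j : Fin n} {b : MixedField F m n} (hb : b ≠ 0)
    (ha : ∀ i, D i b / b = S j (a i) - a i) {q : PrimeClass F m n} {i : Fin m}
    (hq : pderiv (Sum.inl i) q.rep ≠ 0)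
    (hfree : ∀ s : ℤ, (s • (Pi.single j 1 : Fin n → ℤ)) +ᵥ q = q → s = 0) {l : ℤ} (hl : l ≠ 0)
    (hsum : ∀ᶠ N : ℕ in atTop, l = ∑ s ∈ Finset.range N,
      ordAt ((-(s : ℤ) • (Pi.single j 1 : Fin n → ℤ)) +ᵥ q).rep b) :
    ordAt q.rep (a i) < 0 := by
  by_contra! hneg
  obtain ⟨N, hN, hN'⟩ := (hsum.and
    (eventually_vadd_notMem hfree (PrimeClass.finite_setOf_ordAt_neg (a i))).2).exists
  obtain ⟨x, hx, hord, hlog⟩ := exists_iterated_cocycle hD hS hb ha N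
  rw [Set.mem_ofPred_eq, not_lt] at hN'
  have h1 := (ordAt_logDeriv (D i) (pderiv (Sum.inl i)) (hD i) q.prime_rep
    (MvPolynomial.not_dvd_pderiv hq) hx (by rw [hord, ← hN]; exact hl)).2
  have h2 : 0 ≤ ordAt q.rep ((S j)^[N] (a i) - a i) := by
    refine ordAt_sub_nonneg q.prime_rep ?_ hneg
    by_cases h0 : a i = 0
    · rw [h0, Function.iterate_fixed (map_zero (S j)), ← h0]
      exact hneg
    · rwa [hS.ordAt_iterate j N q h0]
  rw [← hlog, h1] at h2
  omega

end Continuous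

section Primitive

variable {F : Type*} [Field F] [CharZero F] {m n : ℕ}
  {D : Fin m → Derivation F (MixedField F m n) (MixedField F m n)}
  {S : Fin n → (MixedField F m n ≃ₐ[F] MixedField F m n)}

omit [CharZero F] in
theorem PrimeClass.ordAt_algebraMap_of_associated {q : PrimeClass F m n}
    {p : MvPolynomial (Fin m ⊕ Fin n) F} {q' : PrimeClass F m n} (h : Associated q'.rep p)
    [Decidable (q = q')] :
    ordAt q.rep (algebraMap _ (MixedField F m n) p) = if q = q' then 1 else 0 := by
  split_ifs with hq
  · subst hq
    rw [ordAt_congr h, ordAt_self (h.prime q.prime_rep)]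
  · exact ordAt_eq_zero_of_not_dvd q.prime_rep fun hd =>
      hq (PrimeClass.eq_of_rep_dvd (hd.trans h.symm.dvd))

theorem PrimeClass.exists_monic_evalLinForm (p : PrimeClass F m n)
    (hd : ∀ i, pderiv (Sum.inl i) p.rep = 0) {v w : Fin n → ℤ} (hvw : v ⬝ᵥ w = 1)
    (hH : ∀ g, v ⬝ᵥ g = 0 → g +ᵥ p = p) :
    ∃ P : Polynomial F, P.Monic ∧ ∀ ℓ : ℤ,
      Associated ((ℓ • w) +ᵥ p).rep (Polynomial.aeval (linForm F m v ℓ) P) := by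
  obtain ⟨P, hP⟩ := exists_aeval_of_shift_eq hd hvw fun u hu =>
    PrimeClass.vadd_eq_self_iff_shift.1 (hH u hu)
  have hP' : p.rep = Polynomial.aeval (linForm F m v 0) P := by
    rw [hP, linForm, Int.cast_zero, add_zero]
  have hP0 : P ≠ 0 := by
    rintro rfl
    exact p.prime_rep.ne_zero (by rw [hP, map_zero])
  refine ⟨P * Polynomial.C P.leadingCoeff⁻¹, Polynomial.monic_mul_leadingCoeff_inv hP0, fun ℓ => ?_⟩
  refine (PrimeClass.rep_vadd _ _).trans ?_
  rw [hP', shift_aeval_linForm, dotProduct_smul, hvw, smul_eq_mul, mul_one, zero_add, map_mul,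
    Polynomial.aeval_C]
  refine associated_mul_unit_right _ _ ?_
  exact (IsUnit.mk0 _ (inv_ne_zero (Polynomial.leadingCoeff_ne_zero.2 hP0))).map _

theorem exists_isGood_of_primitive (hD : ExtendsPartial D) (hS : ExtendsShift S)
    (p : PrimeClass F m n) (hd : ∀ i, pderiv (Sum.inl i) p.rep = 0) {v w : Fin n → ℤ}
    (hvw : v ⬝ᵥ w = 1) (hH : ∀ g, v ⬝ᵥ g = 0 ↔ g +ᵥ p = p) :
    ∃ (c : Fin n → MixedField F m n) (f : PrimeClass F m n → ℤ), IsGood D S c ∧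
      (∀ i (q : PrimeClass F m n),
        ordAt q.rep (c i) = f q - f (-(Pi.single i 1 : Fin n → ℤ) +ᵥ q)) ∧
      (∀ q, (∀ g : Fin n → ℤ, q ≠ g +ᵥ p) → f q = 0) ∧
      ∀ g : Fin n → ℤ, f (g +ᵥ p) = if 0 ≤ v ⬝ᵥ g then 1 else 0 := by
  classical
  have hv : v ≠ 0 := by
    rintro rfl
    simp at hvw
  have hvadd (g g' : Fin n → ℤ) : g +ᵥ p = g' +ᵥ p ↔ v ⬝ᵥ g = v ⬝ᵥ g' := by
    have h : g +ᵥ p = g' +ᵥ p ↔ (-g' + g) +ᵥ p = p := by rw [add_vadd, neg_vadd_eq_iff]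
    rw [h, ← hH, dotProduct_add, dotProduct_neg]
    omega
  obtain ⟨P, hP, hPa⟩ := p.exists_monic_evalLinForm hd hvw fun g hg => (hH g).1 hg
  have hE (q : PrimeClass F m n) (ℓ : ℤ) :
      ordAt q.rep (evalLinForm m v P ℓ) = if q = (ℓ • w) +ᵥ p then 1 else 0 :=
    PrimeClass.ordAt_algebraMap_of_associated (hPa ℓ)
  have hE0 (ℓ : ℤ) : evalLinForm m v P ℓ ≠ 0 := evalLinForm_ne_zero hv hP.ne_zero ℓ
  have hstep (q : PrimeClass F m n) (t : ℤ) : ordAt q.rep (twoSidedProd (t + 1) (evalLinForm m v P)) =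
      ordAt q.rep (twoSidedProd t (evalLinForm m v P)) + if q = (t • w) +ᵥ p then 1 else 0 := by
    rw [twoSidedProd_add_one t hE0, ordAt_mul q.prime_rep (twoSidedProd_ne_zero t hE0) (hE0 t), hE]
  have hz (q : PrimeClass F m n) : ordAt q.rep (twoSidedProd 0 (evalLinForm m v P)) = 0 := by
    rw [twoSidedProd_zero, ordAt_one q.prime_rep]
  have hf (g : Fin n → ℤ) : (∃ g', g +ᵥ p = g' +ᵥ p ∧ 0 ≤ v ⬝ᵥ g') ↔ 0 ≤ v ⬝ᵥ g := by
    refine ⟨?_, fun h => ⟨g, rfl, h⟩⟩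
    rintro ⟨g', h, h'⟩
    rwa [(hvadd g g').1 h]
  refine ⟨_, fun q => if ∃ g : Fin n → ℤ, q = g +ᵥ p ∧ 0 ≤ v ⬝ᵥ g then 1 else 0,
    isGood_twoSidedProd hD hS hv hP, fun i q => ?_, fun q hq => ?_, fun g => ?_⟩
  · beta_reduce
    by_cases hq : ∃ g : Fin n → ℤ, q = g +ᵥ p
    · obtain ⟨g, rfl⟩ := hq
      have key (t : ℤ) : ordAt (g +ᵥ p).rep (twoSidedProd t (evalLinForm m v P)) =
          (if 0 ≤ v ⬝ᵥ g then 1 else 0) - if 0 ≤ v ⬝ᵥ g - t then 1 else 0 := by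
        have hs (t : ℤ) := hstep (g +ᵥ p) t
        simp only [hvadd, dotProduct_smul, hvw, smul_eq_mul, mul_one] at hs
        induction t using Int.induction_on with
        | zero => simp [hz]
        | succ t ih => rw [hs, ih]; split_ifs <;> omega
        | pred t ih =>
          have := hs (-(t : ℤ) - 1)
          rw [sub_add_cancel, ih] at this
          split_ifs at * <;> omega
      rw [key, vadd_vadd, hf, hf, dotProduct_add, dotProduct_neg, dotProduct_single, mul_one,
        sub_eq_neg_add (v ⬝ᵥ g)]
      split_ifs <;> rfl
    · have hq' : ¬ ∃ g : Fin n → ℤ, -(Pi.single i 1 : Fin n → ℤ) +ᵥ q = g +ᵥ p := by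
        rintro ⟨g, hg⟩
        exact hq ⟨Pi.single i 1 + g, by rw [add_vadd, ← hg, vadd_vadd, add_neg_cancel, zero_vadd]⟩
      rw [if_neg (fun ⟨g, h, _⟩ => hq ⟨g, h⟩), if_neg (fun ⟨g, h, _⟩ => hq' ⟨g, h⟩), sub_zero]
      generalize v i = t
      have hs (t : ℤ) : ordAt q.rep (twoSidedProd (t + 1) (evalLinForm m v P)) =
          ordAt q.rep (twoSidedProd t (evalLinForm m v P)) := by
        rw [hstep, if_neg (fun h => hq ⟨_, h⟩), add_zero]
      induction t using Int.induction_on with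
      | zero => exact hz q
      | succ t ih => rw [hs, ih]
      | pred t ih => rw [← hs, sub_add_cancel, ih]
  · exact if_neg fun ⟨g, h, _⟩ => hq g h
  · beta_reduce
    simp only [hf]

end Primitive

section OrbitRemoval

open Filter

variable {F : Type*} [Field F] {m n : ℕ}
  {D : Fin m → Derivation F (MixedField F m n) (MixedField F m n)}
  {S : Fin n → (MixedField F m n ≃ₐ[F] MixedField F m n)}

theorem MvPolynomial.pderiv_eq_zero_of_associated {σ : Type*} {i : σ} {p q : MvPolynomial σ F}
    (h : Associated p q) (hp : pderiv i p = 0) : pderiv i q = 0 := by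
  obtain ⟨u, rfl⟩ := h
  obtain ⟨c, -, hc⟩ := MvPolynomial.isUnit_iff_eq_C_of_isReduced.1 u.isUnit
  rw [hc, Derivation.leibniz, hp, pderiv_C, smul_zero, smul_zero, add_zero]

theorem PrimeClass.pderiv_rep_of_vadd {i : Fin m ⊕ Fin n} {g : Fin n → ℤ} {p : PrimeClass F m n}
    (h : pderiv i (g +ᵥ p).rep = 0) : pderiv i p.rep = 0 := by
  have := MvPolynomial.pderiv_eq_zero_of_associated (PrimeClass.rep_vadd g p) h
  rw [pderiv_shift] at this
  exact (map_eq_zero_iff _ (shift g).injective).1 this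

variable [CharZero F]

theorem exists_isGood_of_fixed (hD : ExtendsPartial D) (hS : ExtendsShift S) (p : PrimeClass F m n)
    (hp : ∀ j : Fin n, (Pi.single j 1 : Fin n → ℤ) +ᵥ p = p) (f : Fin n → ℤ) :
    ∃ c : Fin n → MixedField F m n, IsGood D S c ∧ (∀ i, ordAt p.rep (c i) = f i) ∧
      ∀ i, ∀ q : PrimeClass F m n, q ≠ p → ordAt q.rep (c i) = 0 := by
  have h0 : algebraMap _ (MixedField F m n) p.rep ≠ 0 := algebraMap_ne_zero_of_ne p.prime_rep.ne_zero
  have hmem := memContField_of_shift_eq (p.shift_rep_of_forall_vadd_eq hp)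
  refine ⟨fun i => (algebraMap _ (MixedField F m n) p.rep) ^ f i,
    isGood_of_memContField hD hS fun j => ⟨?_, zpow_ne_zero _ h0⟩, fun i => ?_, fun i q hq => ?_⟩
  · rw [memContField_iff] at *
    exact zpow_mem hmem _
  · rw [ordAt_zpow p.prime_rep h0, ordAt_self p.prime_rep, mul_one]
  · rw [ordAt_zpow q.prime_rep h0, PrimeClass.ordAt_rep_of_ne hq, mul_zero]

theorem exists_isGood_of_eventually (hD : ExtendsPartial D) (hS : ExtendsShift S)
    {p : PrimeClass F m n} (hd : ∀ i, pderiv (Sum.inl i) p.rep = 0) {j : Fin n}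
    (hj : (Pi.single j 1 : Fin n → ℤ) +ᵥ p ≠ p) {O : Set (PrimeClass F m n)}
    (hO : ∀ q, q ∈ O ↔ ∃ g : Fin n → ℤ, q = g +ᵥ p)
    (hO' : ∀ (g : Fin n → ℤ) (q : PrimeClass F m n), g +ᵥ q ∈ O ↔ q ∈ O)
    (hfree : ∀ q ∈ O, ∀ s : ℤ, (s • (Pi.single j 1 : Fin n → ℤ)) +ᵥ q = q → s = 0)
    {f : PrimeClass F m n → ℤ} (hf : ∀ q ∉ O, f q = 0)
    (hfin : {q | f q ≠ f (-(Pi.single j 1 : Fin n → ℤ) +ᵥ q)}.Finite) {ε : ℤ}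
    (hup : ∀ g : Fin n → ℤ, ∀ᶠ s : ℕ in atTop,
      f (((s : ℤ) • (Pi.single j 1 : Fin n → ℤ)) +ᵥ (g +ᵥ p)) = ε)
    (hdown : ∀ g : Fin n → ℤ, ∀ᶠ s : ℕ in atTop,
      f ((-(s : ℤ) • (Pi.single j 1 : Fin n → ℤ)) +ᵥ (g +ᵥ p)) = 0) :
    ∃ c : Fin n → MixedField F m n, IsGood D S c ∧ ∀ i (q : PrimeClass F m n),
      ordAt q.rep (c i) = f q - f (-(Pi.single i 1 : Fin n → ℤ) +ᵥ q) := by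
  by_cases hε : ε = 0
  · subst hε
    refine exists_isGood_of_potential hD hS
      (finite_support_of_eventually_zero hO' hfree hfin hf (fun q hq => ?_) fun q hq => ?_)
    · obtain ⟨g, rfl⟩ := (hO q).1 hq
      exact hup g
    · obtain ⟨g, rfl⟩ := (hO q).1 hq
      exact hdown g
  obtain ⟨v, w, hvw, hH, hvj⟩ := exists_primitive_of_saturated
    (AddAction.stabilizer (Fin n → ℤ) p) j (fun N g hN h => PrimeClass.vadd_eq_self_of_zsmul hN h) hj
    (exists_combination_mem_stabilizer j p hfin hε hup hdown)
  obtain ⟨c, θ, hc, hcθ, hθ, hθg⟩ := exists_isGood_of_primitive hD hS p hd hvw hH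
  have hθfin : {q | θ q ≠ θ (-(Pi.single j 1 : Fin n → ℤ) +ᵥ q)}.Finite := by
    refine (PrimeClass.finite_setOf_ordAt_ne_zero (hc.1.1 j)).subset fun q hq => ?_
    rw [Set.mem_ofPred_eq, hcθ, sub_ne_zero]
    exact hq
  have hsupp : {q | f q - ε * θ q ≠ 0}.Finite := by
    refine finite_support_of_eventually_zero (e := Pi.single j 1) (O := O) hO' hfree
      ((hfin.union hθfin).subset fun q hq => ?_) (fun q hq => ?_) (fun q hq => ?_) fun q hq => ?_
    · by_contra hcon
      simp only [Set.mem_union, Set.mem_ofPred_eq, not_or, not_not] at hcon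
      exact hq (by rw [← hcon.1, ← hcon.2])
    · rw [hf q hq, hθ q fun g hg => hq ((hO q).2 ⟨g, hg⟩), mul_zero, sub_zero]
    · obtain ⟨g, rfl⟩ := (hO q).1 hq
      filter_upwards [hup g, eventually_ge_atTop (v ⬝ᵥ g).natAbs] with s hs hsg
      rw [hs, vadd_vadd, hθg, if_pos, mul_one, sub_self]
      rw [dotProduct_add, dotProduct_smul, dotProduct_single, mul_one, smul_eq_mul]
      have : (s : ℤ) ≤ s * v j := le_mul_of_one_le_right (by positivity) hvj
      omega
    · obtain ⟨g, rfl⟩ := (hO q).1 hq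
      filter_upwards [hdown g, eventually_gt_atTop (v ⬝ᵥ g).natAbs] with s hs hsg
      rw [hs, vadd_vadd, hθg, if_neg, mul_zero, sub_zero]
      rw [dotProduct_add, dotProduct_smul, dotProduct_single, mul_one, smul_eq_mul, neg_mul]
      have : (s : ℤ) ≤ s * v j := le_mul_of_one_le_right (by positivity) hvj
      omega
  obtain ⟨c', hc', hord⟩ := exists_isGood_of_potential hD hS hsupp
  refine ⟨_, hc'.mul (hc.zpow hD hS ε), fun i q => ?_⟩
  rw [ordAt_mul q.prime_rep (hc'.1.1 i) (zpow_ne_zero _ (hc.1.1 i)),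
    ordAt_zpow q.prime_rep (hc.1.1 i), hord, hcθ]
  ring

theorem exists_isGood_orbit (hD : ExtendsPartial D) (hS : ExtendsShift S)
    {b : Fin n → MixedField F m n} (hb : IsCompatible D S b) (p : PrimeClass F m n) :
    ∃ c : Fin n → MixedField F m n, IsGood D S c ∧
      (∀ i (g : Fin n → ℤ), ordAt (g +ᵥ p).rep (c i) = ordAt (g +ᵥ p).rep (b i)) ∧
      ∀ i (q : PrimeClass F m n), (∀ g : Fin n → ℤ, q ≠ g +ᵥ p) → ordAt q.rep (c i) = 0 := by
  classical
  by_cases hp : ∀ j : Fin n, (Pi.single j 1 : Fin n → ℤ) +ᵥ p = p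
  · obtain ⟨c, hc, h1, h2⟩ := exists_isGood_of_fixed hD hS p hp fun i => ordAt p.rep (b i)
    have hfix (g : Fin n → ℤ) : g +ᵥ p = p :=
      PrimeClass.vadd_eq_self_iff_shift.2 (p.shift_rep_of_forall_vadd_eq hp g)
    refine ⟨c, hc, fun i g => ?_, fun i q hq => h2 i q ?_⟩
    · rw [hfix, h1]
    · simpa using hq 0
  push Not at hp
  obtain ⟨j, hj⟩ := hp
  set O : Set (PrimeClass F m n) := {q | ∃ g : Fin n → ℤ, q = g +ᵥ p} with hOdef
  have hO (g : Fin n → ℤ) (q : PrimeClass F m n) : g +ᵥ q ∈ O ↔ q ∈ O := by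
    constructor
    · rintro ⟨g', h⟩
      exact ⟨-g + g', by rw [add_vadd, ← h, neg_vadd_vadd]⟩
    · rintro ⟨g', rfl⟩
      exact ⟨g + g', by rw [add_vadd]⟩
  have hfree : ∀ q ∈ O, ∀ s : ℤ, (s • (Pi.single j 1 : Fin n → ℤ)) +ᵥ q = q → s = 0 := by
    rintro _ ⟨g, rfl⟩ s hs
    by_contra hs0
    have := PrimeClass.vadd_eq_self_of_zsmul hs0 hs
    rw [vadd_comm] at this
    exact hj (vadd_left_cancel g this)
  set φ : Fin n → PrimeClass F m n → ℤ := fun i q => if q ∈ O then ordAt q.rep (b i) else 0 with hφ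
  have hφfin (i : Fin n) : {q | φ i q ≠ 0}.Finite := by
    refine (PrimeClass.finite_setOf_ordAt_ne_zero (hb.1 i)).subset fun q hq => ?_
    by_contra hcon
    rw [Set.mem_ofPred_eq, not_not] at hcon
    exact hq (by simp only [hφ, hcon, ite_self])
  have hcoc (i j : Fin n) (q : PrimeClass F m n) :
      φ i q + φ j (-(Pi.single i 1 : Fin n → ℤ) +ᵥ q) =
        φ j q + φ i (-(Pi.single j 1 : Fin n → ℤ) +ᵥ q) := by
    simp only [hφ, hO]
    split_ifs
    · exact hb.ordAt_cocycle hS i j q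
    · rfl
  obtain ⟨f, hfφ, hf, hsum, hdown⟩ := exists_potential φ hφfin hcoc hO
    (fun i q hq => if_neg hq) j hfree
  suffices h : ∃ c : Fin n → MixedField F m n, IsGood D S c ∧ ∀ i (q : PrimeClass F m n),
      ordAt q.rep (c i) = f q - f (-(Pi.single i 1 : Fin n → ℤ) +ᵥ q) by
    obtain ⟨c, hc, hord⟩ := h
    refine ⟨c, hc, fun i g => ?_, fun i q hq => ?_⟩
    · rw [hord, ← hfφ, hφ]
      exact if_pos ⟨g, rfl⟩
    · rw [hord, ← hfφ, hφ]
      exact if_neg fun ⟨g, hg⟩ => hq g hg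
  have hffin (i : Fin n) : {q | f q ≠ f (-(Pi.single i 1 : Fin n → ℤ) +ᵥ q)}.Finite := by
    refine (hφfin i).subset fun q hq => ?_
    rw [Set.mem_ofPred_eq, hfφ, sub_ne_zero]
    exact hq
  by_cases hd : ∀ i, pderiv (Sum.inl i) p.rep = 0
  · obtain ⟨ε, hε⟩ := exists_eventual_value hffin j p fun g => hfree _ ⟨g, rfl⟩
    exact exists_isGood_of_eventually hD hS hd hj (fun q => Iff.rfl) hO hfree hf (hffin j) hε
      fun g => hdown _
  · push Not at hd
    obtain ⟨i, hi⟩ := hd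
    obtain ⟨a, ha⟩ := hb.2.2
    refine exists_isGood_of_potential hD hS
      ((PrimeClass.finite_setOf_ordAt_neg (a i)).subset fun q hq => ?_)
    have hqO : q ∈ O := by
      by_contra hcon
      exact hq (hf q hcon)
    refine ordAt_neg_of_potential_ne_zero hD hS (hb.1 j) (fun i => ha i j) ?_ (hfree q hqO) hq ?_
    · obtain ⟨g, rfl⟩ := hqO
      exact fun h => hi (PrimeClass.pderiv_rep_of_vadd h)
    · filter_upwards [hsum q] with N hN
      rw [hN]
      exact Finset.sum_congr rfl fun s _ => if_pos ((hO _ _).2 hqO)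

end OrbitRemoval

section StandardForm

variable {F : Type*} [Field F] [CharZero F] {m n : ℕ}
  {D : Fin m → Derivation F (MixedField F m n) (MixedField F m n)}
  {S : Fin n → (MixedField F m n ≃ₐ[F] MixedField F m n)}

omit [CharZero F] in
theorem memContField_of_forall_ordAt_eq_zero {x : MixedField F m n} (hx : x ≠ 0)
    (h : ∀ q : PrimeClass F m n, ordAt q.rep x = 0) : memContField x := by
  obtain ⟨u, hu, rfl⟩ := isUnit_of_ordAt_eq_zero (R := MvPolynomial (Fin m ⊕ Fin n) F) hx fun q hq => by
    obtain ⟨q', hq'⟩ := PrimeClass.exists_rep_associated hq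
    rw [← ordAt_congr hq', h]
  obtain ⟨c, -, rfl⟩ := MvPolynomial.isUnit_iff_eq_C_of_isReduced.1 hu
  exact ⟨C c, 1, one_ne_zero, by simp⟩

theorem isGood_of_isCompatible (hD : ExtendsPartial D) (hS : ExtendsShift S) (N : ℕ) :
    ∀ {b : Fin n → MixedField F m n}, IsCompatible D S b →
      {q : PrimeClass F m n | ∃ i, ordAt q.rep (b i) ≠ 0}.ncard = N → IsGood D S b := by
  induction N using Nat.strong_induction_on with
  | _ N ih =>
    intro b hb hN
    have hfin : {q : PrimeClass F m n | ∃ i, ordAt q.rep (b i) ≠ 0}.Finite := by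
      simp only [Set.ofPred_exists]
      exact Set.finite_iUnion fun i => PrimeClass.finite_setOf_ordAt_ne_zero (hb.1 i)
    rcases Set.eq_empty_or_nonempty {q : PrimeClass F m n | ∃ i, ordAt q.rep (b i) ≠ 0} with h | h
    · refine isGood_of_memContField hD hS fun j =>
        ⟨memContField_of_forall_ordAt_eq_zero (hb.1 j) fun q => ?_, hb.1 j⟩
      by_contra hq
      exact Set.eq_empty_iff_forall_notMem.1 h q ⟨j, hq⟩
    · obtain ⟨p, hp⟩ := h
      obtain ⟨c, hc, hcO, hcO'⟩ := exists_isGood_orbit hD hS hb p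
      have hord (i : Fin n) (q : PrimeClass F m n) :
          ordAt q.rep (b i * (c i)⁻¹) = ordAt q.rep (b i) - ordAt q.rep (c i) := by
        rw [← div_eq_mul_inv, ordAt_div' q.prime_rep (hb.1 i) (hc.1.1 i)]
      have hlt : {q : PrimeClass F m n | ∃ i, ordAt q.rep (b i * (c i)⁻¹) ≠ 0}.ncard < N := by
        rw [← hN]
        refine Set.ncard_lt_ncard ⟨fun q hq => ?_, fun hsub => ?_⟩ hfin
        · obtain ⟨i, hi⟩ := hq
          rw [hord] at hi
          by_cases hqO : ∃ g : Fin n → ℤ, q = g +ᵥ p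
          · obtain ⟨g, rfl⟩ := hqO
            rw [hcO, sub_self] at hi
            exact absurd rfl hi
          · rw [hcO' i q fun g hg => hqO ⟨g, hg⟩, sub_zero] at hi
            exact ⟨i, hi⟩
        · obtain ⟨i, hi⟩ := hsub hp
          have := hcO i 0
          rw [zero_vadd] at this
          rw [hord, this, sub_self] at hi
          exact hi rfl
      have := (ih _ hlt (hb.mul hc.1.inv) rfl).mul hc
      simpa only [inv_mul_cancel_right₀ (hc.1.1 _)] using this

end StandardForm

section FinalForm

variable {F : Type*} [Field F] [CharZero F] {m n : ℕ}
  {D : Fin m → Derivation F (MixedField F m n) (MixedField F m n)}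
  {S : Fin n → (MixedField F m n ≃ₐ[F] MixedField F m n)}

theorem exists_gradient_of_memContField [IsAlgClosed F] (hD : ExtendsPartial D)
    {a : Fin m → MixedField F m n} (ha : ∀ i, memContField (a i)) (hc : ∀ i j, D i (a j) = D j (a i)) :
    ∃ (L : ℕ) (g₀ : MixedField F m n) (g : Fin L → MixedField F m n) (γ : Fin L → F),
      memContField g₀ ∧ (∀ ℓ, memContField (g ℓ) ∧ g ℓ ≠ 0) ∧
      ∀ i, a i = D i g₀ + ∑ ℓ, algebraMap F (MixedField F m n) (γ ℓ) * (D i (g ℓ) / g ℓ) := by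
  classical
  have hstab (i : Fin m) : ∀ x ∈ contField F m n, D i x ∈ contField F m n := fun x hx =>
    memContField_iff.1 (hD.memContField_apply i (memContField_iff.2 hx))
  have hmem (i : Fin m) : algebraMap (MvPolynomial (Fin m ⊕ Fin n) F) (MixedField F m n)
      (X (Sum.inl i)) ∈ contField F m n := IntermediateField.subset_adjoin _ _ ⟨i, rfl⟩
  obtain ⟨g₀, γ, hγ⟩ := (closed_gradient_aux (F := F) m
    (fun i => (⟨_, hmem i⟩ : contField F m n))
    (fun i => (contField F m n).restrictDerivation (D i) (hstab i))
    (fun i j => by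
      refine Subtype.ext ?_
      rw [IntermediateField.coe_restrictDerivation, hD, pderiv_X]
      by_cases h : i = j
      · subst h; simp
      · simp [h, Ne.symm h])
    (by
      apply IntermediateField.lift_injective (contField F m n)
      rw [IntermediateField.lift_adjoin, IntermediateField.lift_top, ← Set.range_comp]
      rfl)).2 (fun i => ⟨a i, memContField_iff.1 (ha i)⟩)
    fun i j => Subtype.ext (hc i j)
  set s := γ.support.filter (· ≠ 0) with hs
  refine ⟨s.card, g₀, fun ℓ => ((s.equivFin.symm ℓ : contField F m n) : MixedField F m n),
    fun ℓ => γ (s.equivFin.symm ℓ), memContField_iff.2 g₀.2,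
    fun ℓ => ⟨memContField_iff.2 (Subtype.prop _), ?_⟩, fun i => ?_⟩
  · have := (Finset.mem_filter.1 (s.equivFin.symm ℓ).2).2
    exact fun h => this (Subtype.ext h)
  · have h1 := congrArg (algebraMap (contField F m n) (MixedField F m n)) (hγ i)
    rw [Finsupp.sum, map_add, map_sum] at h1
    refine h1.trans ?_
    congr 1
    rw [Equiv.sum_comp s.equivFin.symm fun x : s =>
      algebraMap F (MixedField F m n) (γ x) * (D i ((x : contField F m n) : MixedField F m n) /
        ((x : contField F m n) : MixedField F m n))]
    rw [Finset.sum_coe_sort s fun x : contField F m n =>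
      algebraMap F (MixedField F m n) (γ x) * (D i (x : MixedField F m n) / (x : MixedField F m n))]
    rw [hs, Finset.sum_filter_of_ne]
    · refine Finset.sum_congr rfl fun x _ => ?_
      rw [Algebra.smul_def, map_mul, map_div₀]
      rfl
    · intro x _ hx h0
      exact hx (by simp [h0])

omit [CharZero F] in
theorem Derivation.map_mul_div {K : Type*} [Field K] [Algebra F K] (d : Derivation F K K) {x y : K}
    (hx : x ≠ 0) (hy : y ≠ 0) : d (x * y) / (x * y) = d x / x + d y / y := by
  rw [Derivation.leibniz, smul_eq_mul, smul_eq_mul]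
  field_simp
  ring

omit [CharZero F] in
theorem Derivation.map_prod_eq_zero {K ι : Type*} [Field K] [Algebra F K] (d : Derivation F K K)
    (s : Finset ι) (f : ι → K) (h : ∀ i ∈ s, d (f i) = 0) : d (∏ i ∈ s, f i) = 0 := by
  classical
  induction s using Finset.induction_on with
  | empty => simp
  | insert i s hi ih =>
    rw [Finset.prod_insert hi, Derivation.leibniz, h i (Finset.mem_insert_self i s),
      ih fun l hl => h l (Finset.mem_insert_of_mem hl)]
    simp

theorem ExtendsPartial.exists_additive_form [IsAlgClosed F] (hD : ExtendsPartial D)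
    (hS : ExtendsShift S) {a : Fin m → MixedField F m n} {b : Fin n → MixedField F m n}
    (hDD : ∀ i j, D i (a j) = D j (a i)) (hDS : ∀ i j, D i (b j) / b j = S j (a i) - a i)
    {f : MixedField F m n} (hf : f ≠ 0) {h : Fin n → MixedField F m n}
    (hh : ∀ j, memContField (h j) ∧ h j ≠ 0) {e : Fin n → MixedField F m n} (he0 : ∀ j, e j ≠ 0)
    (he : ∀ i j, D i (e j) = 0) (hb : ∀ j, b j = S j f / f * h j * e j) :
    ∃ (L : ℕ) (g₀ : MixedField F m n) (g : Fin L → MixedField F m n) (γ : Fin L → F),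
      memContField g₀ ∧ (∀ ℓ, memContField (g ℓ) ∧ g ℓ ≠ 0) ∧
      ∀ i, a i = D i g₀ + D i f / f
          + (∑ ℓ, algebraMap F (MixedField F m n) (γ ℓ) * (D i (g ℓ) / g ℓ))
          + ∑ j, algebraMap (MvPolynomial (Fin m ⊕ Fin n) F) (MixedField F m n)
              (X (Sum.inr j)) * (D i (h j) / h j) := by
  have hSf (j : Fin n) : S j f ≠ 0 := (map_ne_zero _).2 hf
  set p : Fin m → MixedField F m n := fun i => D i f / f +
    ∑ j, algebraMap (MvPolynomial (Fin m ⊕ Fin n) F) (MixedField F m n)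
      (X (Sum.inr j)) * (D i (h j) / h j) with hp
  have hquot (i : Fin m) (j : Fin n) : memContField (D i (h j) / h j) := by
    have h1 := hD.memContField_apply i (hh j).1
    have h2 := (hh j).1
    rw [memContField_iff] at *
    exact div_mem h1 h2
  have hpS (i : Fin m) (j : Fin n) : S j (p i) - p i = D i (b j) / b j := by
    have h1 : D i (b j) / b j = D i (S j f / f) / (S j f / f) + D i (h j) / h j := by
      rw [hb, Derivation.map_mul_div _ (mul_ne_zero (div_ne_zero (hSf j) hf) (hh j).2) (he0 j), he,
        zero_div, add_zero, Derivation.map_mul_div _ (div_ne_zero (hSf j) hf) (hh j).2]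
    have h2 : D i (S j f / f) / (S j f / f) = S j (D i f / f) - D i f / f := by
      have := hSf j
      rw [Derivation.leibniz_div, hD.comm_shift hS, map_div₀]
      simp only [smul_eq_mul]
      field_simp
    have h3 : S j (∑ l, algebraMap (MvPolynomial (Fin m ⊕ Fin n) F) (MixedField F m n)
        (X (Sum.inr l)) * (D i (h l) / h l)) -
        ∑ l, algebraMap (MvPolynomial (Fin m ⊕ Fin n) F) (MixedField F m n)
        (X (Sum.inr l)) * (D i (h l) / h l) = D i (h j) / h j := by
      rw [map_sum, ← Finset.sum_sub_distrib, Finset.sum_eq_single j]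
      · rw [map_mul, hS.eq_of_memContField _ (hquot i j), hS, shift_X_inr, map_add, ← sub_mul]
        simp
      · intro l _ hl
        rw [map_mul, hS.eq_of_memContField _ (hquot i l), hS, shift_X_inr, map_add, ← sub_mul]
        simp [hl]
      · simp
    rw [h1, h2, ← h3, hp]
    beta_reduce
    rw [map_add]
    ring
  have hpD (i j : Fin m) : D i (p j) = D j (p i) := by
    simp only [hp, map_add, map_sum]
    rw [Derivation.map_div_comm _ _ (hD.comm i j)]
    congr 1
    refine Finset.sum_congr rfl fun l _ => ?_
    rw [Derivation.leibniz, Derivation.leibniz, Derivation.map_div_comm _ _ (hD.comm i j), hD, hD,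
      pderiv_X_of_ne (by simp), pderiv_X_of_ne (by simp), map_zero, smul_zero, smul_zero]
  clear_value p
  obtain ⟨L, g₀, g, γ, hg₀, hg, hag⟩ := exists_gradient_of_memContField hD
    (a := fun i => a i - p i) (fun i => hS.memContField_of_eq fun j => by
      rw [map_sub, ← sub_eq_zero]
      linear_combination -hDS i j - hpS i j)
    fun i j => by rw [map_sub, map_sub, hDD, hpD]
  refine ⟨L, g₀, g, γ, hg₀, hg, fun i => ?_⟩
  have hpi := congrFun hp i
  beta_reduce at hpi
  linear_combination hag i + hpi

end FinalForm

theorem evalLinForm_div_eq_ratFuncEval {F : Type*} [Field F] [CharZero F] {m n : ℕ} {v : Fin n → ℤ}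
    (hv : v ≠ 0) (p : Polynomial F) {q : Polynomial F} (hq : q ≠ 0) (ℓ : ℤ) :
    RatFunc.eval (algebraMap F (MixedField F m n))
      ((∑ i, v i • algebraMap (MvPolynomial (Fin m ⊕ Fin n) F) (MixedField F m n)
        (X (Sum.inr i))) + (ℓ : MixedField F m n))
      (algebraMap (Polynomial F) (RatFunc F) p / algebraMap (Polynomial F) (RatFunc F) q) =
    evalLinForm m v p ℓ / evalLinForm m v q ℓ := by
  have hx : (∑ i, v i • algebraMap (MvPolynomial (Fin m ⊕ Fin n) F) (MixedField F m n)
      (X (Sum.inr i))) + (ℓ : MixedField F m n) =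
      algebraMap (MvPolynomial (Fin m ⊕ Fin n) F) (MixedField F m n) (linForm F m v ℓ) := by
    simp [linForm]
  have hpoly (p : Polynomial F) : Polynomial.eval₂ (algebraMap F (MixedField F m n))
      (algebraMap (MvPolynomial (Fin m ⊕ Fin n) F) (MixedField F m n) (linForm F m v ℓ)) p =
      evalLinForm m v p ℓ := by
    rw [evalLinForm, ← Polynomial.aeval_def, Polynomial.aeval_algebraMap_apply]
  have hq' : evalLinForm m v q ℓ ≠ 0 := evalLinForm_ne_zero hv hq ℓ
  rw [hx, RatFunc.eval, hpoly, hpoly,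
    div_eq_div_iff (evalLinForm_ne_zero hv (RatFunc.denom_ne_zero _) ℓ) hq', ← evalLinForm_mul,
    ← evalLinForm_mul, (RatFunc.num_mul_eq_mul_denom_iff hq).2 rfl]

/-- **Structure theorem for compatible rational functions in the mixed
continuous–discrete setting.**
`F` is an algebraically closed field of characteristic zero; `D i` is the unique
derivation of `F(t_1, …, t_m, k_1, …, k_n)` extending `∂/∂t_i`, and `S j` is the
`F`-algebra automorphism sending `k_j ↦ k_j + 1` and fixing all other variables.
If `a_1, …, a_m` and nonzero `b_1, …, b_n` satisfy the compatibility conditions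
`D_i(a_j) = D_j(a_i)`, `S_i(b_j)/b_j = S_j(b_i)/b_i` and `D_i(b_j)/b_j = S_j(a_i) − a_i`,
then there are a nonzero `f`, rational functions `g₀` and nonzero `g_ℓ, h_j` in
`F(t_1, …, t_m)`, a finite set `V ⊂ ℤ^n \ {0}`, monic-quotient rational functions
`r_v ∈ F(z)` and constants `γ_ℓ, μ_j ∈ F` with `μ_j ≠ 0` such that
`a_i = D_i(g₀) + D_i(f)/f + Σ_ℓ γ_ℓ·D_i(g_ℓ)/g_ℓ + Σ_j k_j·D_i(h_j)/h_j` and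
`b_j = (S_j(f)/f)·μ_j·h_j·∏_{v ∈ V} ∏_0^{v_j} r_v(v·k + ℓ)`. -/
theorem structure_of_compatible_rational_functions
    (F : Type*) [Field F] [IsAlgClosed F] [CharZero F] (m n : ℕ)
    (D : Fin m → Derivation F (MixedField F m n) (MixedField F m n))
    (hD : ∀ i (p : MvPolynomial (Fin m ⊕ Fin n) F),
      D i (algebraMap (MvPolynomial (Fin m ⊕ Fin n) F) (MixedField F m n) p)
        = algebraMap (MvPolynomial (Fin m ⊕ Fin n) F) (MixedField F m n)
            (pderiv (Sum.inl i) p))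
    (S : Fin n → (MixedField F m n ≃ₐ[F] MixedField F m n))
    (hS : ∀ (j : Fin n) (v : Fin m ⊕ Fin n),
      S j (algebraMap (MvPolynomial (Fin m ⊕ Fin n) F) (MixedField F m n) (X v))
        = algebraMap (MvPolynomial (Fin m ⊕ Fin n) F) (MixedField F m n) (X v)
          + (if v = Sum.inr j then 1 else 0))
    (a : Fin m → MixedField F m n) (b : Fin n → MixedField F m n)
    (hb : ∀ j, b j ≠ 0)
    (hDD : ∀ i j : Fin m, i < j → D i (a j) = D j (a i))
    (hSS : ∀ i j : Fin n, i < j → S i (b j) / b j = S j (b i) / b i)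
    (hDS : ∀ (i : Fin m) (j : Fin n), D i (b j) / b j = S j (a i) - a i) :
    ∃ (f : MixedField F m n) (_ : f ≠ 0) (L : ℕ)
      (g₀ : MixedField F m n) (_ : memContField g₀)
      (g : Fin L → MixedField F m n) (_ : ∀ ℓ, memContField (g ℓ) ∧ g ℓ ≠ 0)
      (h : Fin n → MixedField F m n) (_ : ∀ j, memContField (h j) ∧ h j ≠ 0)
      (V : Finset (Fin n → ℤ)) (_ : (0 : Fin n → ℤ) ∉ V)
      (r : (Fin n → ℤ) → RatFunc F)
      (γ : Fin L → F) (μ : Fin n → F) (_ : ∀ j, μ j ≠ 0),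
      (∀ v ∈ V, ∃ p q : Polynomial F, p.Monic ∧ q.Monic ∧
        r v = algebraMap (Polynomial F) (RatFunc F) p /
              algebraMap (Polynomial F) (RatFunc F) q) ∧
      (∀ i, a i = D i g₀ + D i f / f
          + (∑ ℓ, algebraMap F (MixedField F m n) (γ ℓ) * (D i (g ℓ) / g ℓ))
          + ∑ j, algebraMap (MvPolynomial (Fin m ⊕ Fin n) F) (MixedField F m n)
              (X (Sum.inr j)) * (D i (h j) / h j)) ∧
      (∀ j, b j = S j f / f * algebraMap F (MixedField F m n) (μ j) * h j *
        ∏ v ∈ V, twoSidedProd (v j) (fun ℓ =>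
          RatFunc.eval (algebraMap F (MixedField F m n))
            ((∑ i, v i • algebraMap (MvPolynomial (Fin m ⊕ Fin n) F) (MixedField F m n)
                (X (Sum.inr i))) + (ℓ : MixedField F m n))
            (r v))) := by
  classical
  have hD' : ExtendsPartial D := hD
  have hS' : ExtendsShift S := extendsShift_of_X hS
  have hSS' (i j : Fin n) : S i (b j) / b j = S j (b i) / b i := by
    rcases lt_trichotomy i j with h | rfl | h
    exacts [hSS i j h, rfl, (hSS j i h).symm]
  have hDD' (i j : Fin m) : D i (a j) = D j (a i) := by
    rcases lt_trichotomy i j with h | rfl | h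
    exacts [hDD i j h, rfl, (hDD j i h).symm]
  obtain ⟨-, f, h, V, p, q, hf, hh, hV, hpq, -, hbf⟩ :=
    isGood_of_isCompatible hD' hS' _ ⟨hb, hSS', a, hDS⟩ rfl
  have hV0 (v : Fin n → ℤ) (hv : v ∈ V) : v ≠ 0 := by
    rintro rfl
    exact hV hv
  have hα (v : Fin n → ℤ) (hv : v ∈ V) (ℓ : ℤ) :
      evalLinForm m v (p v) ℓ / evalLinForm m v (q v) ℓ ≠ 0 :=
    div_ne_zero (evalLinForm_ne_zero (hV0 v hv) (hpq v).1.ne_zero ℓ)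
      (evalLinForm_ne_zero (hV0 v hv) (hpq v).2.ne_zero ℓ)
  obtain ⟨L, g₀, g, γ, hg₀, hg, hag⟩ := hD'.exists_additive_form hS' hDD' hDS hf hh
    (fun j => Finset.prod_ne_zero_iff.2 fun v hv => twoSidedProd_ne_zero (v j) (hα v hv))
    (fun i j => Derivation.map_prod_eq_zero _ _ _ fun v hv =>
      map_twoSidedProd_eq_zero (D i) (v j) (hα v hv) fun ℓ => by
        rw [Derivation.leibniz_div, hD'.evalLinForm, hD'.evalLinForm]
        simp) hbf
  refine ⟨f, hf, L, g₀, hg₀, g, hg, h, hh, V, hV, fun v =>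
    algebraMap (Polynomial F) (RatFunc F) (p v) / algebraMap (Polynomial F) (RatFunc F) (q v),
    γ, fun _ => 1, fun _ => one_ne_zero, fun v _ => ⟨p v, q v, (hpq v).1, (hpq v).2, rfl⟩,
    hag, fun j => ?_⟩
  rw [hbf j, map_one, mul_one]
  congr 1
  refine Finset.prod_congr rfl fun v hv => ?_
  congr 1
  ext ℓ
  exact (evalLinForm_div_eq_ratFuncEval (hV0 v hv) (p v) (hpq v).2.ne_zero ℓ).symm
end

section
/- Let F be a field of characteristic zero, m, n ≥ 1, and consider the field F(t_1, …, t_m, k_1, …, k_n) with the derivation D_1 extending ∂/∂t_1 and the shift automorphism S_1 determined by k_1 ↦ k_1 + 1 (fixing all other variables). Let d ∈ F[t_1, …, t_m, k_1, …, k_n] be irreducible with positive degree in t_1 and positive degree in k_1, let r ∈ F[t_1, …, t_m, k_1, …, k_n] be nonzero and not divisible by d, and let q ∈ F[t_1, …, t_m, k_1, …, k_n] be arbitrary. Then for every finitely supported family of polynomials c_{i,j} ∈ F[t_1, …, t_m, k_2, …, k_n] (indexed by pairs (i, j) of natural numbers, and free of the variable k_1) that are not all zero, one has Σ_{i,j}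 c_{i,j} · D_1^i(S_1^j(q + r/d)) ≠ 0 in F(t_1, …, t_m, k_1, …, k_n). (No nonzero operator in D_1 and S_1 with coefficients free of k_1 annihilates q + r/d.) -/
open MvPolynomial

section PoleOrder

variable {R : Type*} (K : Type*) [CommRing R] [Field K] [Algebra R K]

/-- The elements of `K` whose pole at the prime `p` of `R` has order at most `N`. -/
def poleOrderLE {p : R} (hp : Prime p) (N : ℕ) : Submodule R K where
  carrier := {x | ∃ a b : R, ¬ p ∣ b ∧ x * algebraMap R K b * algebraMap R K p ^ N = algebraMap R K a}
  zero_mem' := ⟨0, 1, hp.not_dvd_one, by simp⟩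
  add_mem' := by
    rintro x y ⟨a, b, hb, hx⟩ ⟨a', b', hb', hy⟩
    refine ⟨a * b' + a' * b, b * b', hp.not_dvd_mul hb hb', ?_⟩
    simp only [map_add, map_mul, ← hx, ← hy]
    ring
  smul_mem' := by
    rintro c x ⟨a, b, hb, hx⟩
    refine ⟨c * a, b, hb, ?_⟩
    simp only [map_mul, ← hx, Algebra.smul_def]
    ring

variable {K}

theorem algebraMap_mem_poleOrderLE {p : R} (hp : Prime p) (N : ℕ) (a : R) :
    algebraMap R K a ∈ poleOrderLE K hp N :=
  ⟨a * p ^ N, 1, hp.not_dvd_one, by simp⟩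

theorem mem_poleOrderLE_of_mul_pow {p : R} (hp : Prime p) {N M : ℕ} (hNM : N ≤ M) {x : K} {a : R}
    (h : x * algebraMap R K p ^ N = algebraMap R K a) : x ∈ poleOrderLE K hp M := by
  refine ⟨a * p ^ (M - N), 1, hp.not_dvd_one, ?_⟩
  rw [map_one, mul_one, map_mul, ← h, map_pow, mul_assoc, ← pow_add, Nat.add_sub_cancel' hNM]

theorem mem_poleOrderLE_of_mul {p : R} (hp : Prime p) {M : ℕ} {x : K} {a b : R} (hb : ¬ p ∣ b)
    (h : x * algebraMap R K b = algebraMap R K a) : x ∈ poleOrderLE K hp M :=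
  ⟨a * p ^ M, b, hb, by rw [h, map_mul, map_pow]⟩

theorem add_ne_zero_of_mem_poleOrderLE [FaithfulSMul R K] {p : R} (hp : Prime p) {N : ℕ} {x y : K}
    {a : R} (ha : ¬ p ∣ a) (hx : x * algebraMap R K p ^ (N + 1) = algebraMap R K a)
    (hy : y ∈ poleOrderLE K hp N) : x + y ≠ 0 := by
  obtain ⟨a', b, hb, hy⟩ := hy
  intro h
  have key : algebraMap R K (a * b + p * a') = 0 := by
    simp only [map_add, map_mul, ← hx, ← hy]
    linear_combination algebraMap R K b * algebraMap R K p ^ (N + 1) * h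
  have h0 := (FaithfulSMul.algebraMap_eq_zero_iff R K).1 key
  exact hp.not_dvd_mul ha hb ((dvd_add_left (dvd_mul_right p a')).1 (h0 ▸ dvd_zero p))

theorem exists_iterate_derivation_div {F : Type*} [CommRing F] [Algebra F K] [Algebra F R]
    [FaithfulSMul R K]
    (D : Derivation F K K) (δ : Derivation F R R)
    (hD : ∀ a, D (algebraMap R K a) = algebraMap R K (δ a)) {p : R} (hp : Prime p)
    (hchar : ∀ n : ℕ, ¬ p ∣ ((n + 1 : ℕ) : R)) (r : R) (i : ℕ) :
    ∃ a : R, D^[i] (algebraMap R K r / algebraMap R K p) * algebraMap R K p ^ (i + 1)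
        = algebraMap R K a ∧ (¬ p ∣ r → ¬ p ∣ δ p → ¬ p ∣ a) := by
  induction i with
  | zero =>
    have hp0 : algebraMap R K p ≠ 0 :=
      fun h => hp.ne_zero ((FaithfulSMul.algebraMap_eq_zero_iff R K).1 h)
    exact ⟨r, by simp [hp0], fun h _ => h⟩
  | succ i ih =>
    obtain ⟨a, ha, hna⟩ := ih
    refine ⟨p * δ a - ((i + 1 : ℕ) : R) * (a * δ p), ?_, fun hr hδ h => ?_⟩
    · rw [Function.iterate_succ_apply']
      have h := congrArg D ha
      rw [hD, D.leibniz, D.leibniz_pow, hD] at h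
      simp only [smul_eq_mul, nsmul_eq_mul, Nat.add_sub_cancel] at h
      simp only [map_sub, map_mul, map_natCast, ← h, ← ha]
      ring
    · exact hp.not_dvd_mul (hchar i) (hp.not_dvd_mul (hna hr hδ) hδ)
        ((dvd_sub_right (dvd_mul_right p _)).1 h)

theorem iterate_derivation_algebraMap {F : Type*} [CommRing F] [Algebra F K] [Algebra F R]
    (D : Derivation F K K) (δ : Derivation F R R)
    (hD : ∀ a, D (algebraMap R K a) = algebraMap R K (δ a)) (q : R) (i : ℕ) :
    D^[i] (algebraMap R K q) = algebraMap R K (δ^[i] q) := by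
  induction i with
  | zero => rfl
  | succ i ih => rw [Function.iterate_succ_apply', ih, hD, Function.iterate_succ_apply']

end PoleOrder

theorem Polynomial.eq_zero_of_dvd_taylor {A : Type*} [CommRing A] [IsDomain A] [CharZero A]
    {f : Polynomial A} {a : A} (hf : 0 < f.natDegree) (h : f ∣ taylor a f) : a = 0 := by
  obtain ⟨g, hg⟩ := h
  have hf0 : f ≠ 0 := by rintro rfl; simp at hf
  have hg0 : g ≠ 0 := by
    rintro rfl
    rw [mul_zero, taylor_eq_zero] at hg
    exact hf0 hg
  have hdeg := congrArg natDegree hg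
  rw [natDegree_taylor, natDegree_mul hf0 hg0] at hdeg
  have hlead := congrArg leadingCoeff hg
  rw [leadingCoeff_taylor, leadingCoeff_mul] at hlead
  have hu : g.leadingCoeff = 1 :=
    mul_left_cancel₀ (leadingCoeff_ne_zero.2 hf0) (by rw [← hlead, mul_one])
  have hg1 : g = 1 := by
    rw [eq_C_of_natDegree_eq_zero (by omega : g.natDegree = 0)] at hu ⊢
    rw [leadingCoeff_C] at hu
    rw [hu, C_1]
  rw [hg1, mul_one] at hg
  by_contra ha
  have heval : ∀ n : ℕ, f.eval (n * a) = f.eval 0 := by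
    intro n
    induction n with
    | zero => simp
    | succ n ih => rw [← ih, ← congrArg (eval (n * a)) hg, taylor_eval]; push_cast; ring_nf
  have hconst : f = C (f.eval 0) := by
    refine eq_of_infinite_eval_eq _ _ (Set.Infinite.mono ?_ (Set.infinite_range_of_injective
      (f := fun n : ℕ => (n : A) * a) fun x y hxy => ?_))
    · rintro _ ⟨n, rfl⟩
      simpa using heval n
    · exact Nat.cast_injective (mul_right_cancel₀ ha hxy)
  rw [hconst, natDegree_C] at hf
  exact hf.false

namespace MvPolynomial

variable {σ F : Type*} [Field F]

open Classical in
/-- Polynomials viewed as univariate polynomials in the variable `k`. -/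
noncomputable def univariateEquiv (k : σ) :
    MvPolynomial σ F ≃ₐ[F] Polynomial (MvPolynomial {b // b ≠ k} F) :=
  (renameEquiv F (Equiv.optionSubtypeNe k).symm).trans (optionEquivLeft F _)

theorem natDegree_univariateEquiv (k : σ) (p : MvPolynomial σ F) :
    (univariateEquiv k p).natDegree = p.degreeOf k := by
  classical
  rw [degreeOf_eq_natDegree]
  simp only [univariateEquiv, AlgEquiv.trans_apply, renameEquiv_apply]

theorem univariateEquiv_X_self (k : σ) : univariateEquiv (F := F) k (X k) = Polynomial.X := by
  simp [univariateEquiv]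

theorem univariateEquiv_X_of_ne {k v : σ} (h : v ≠ k) :
    univariateEquiv (F := F) k (X v) = Polynomial.C (X ⟨v, h⟩) := by
  classical
  simp [univariateEquiv, Equiv.optionSubtypeNe_symm_apply, h]

theorem univariateEquiv_C (k : σ) (a : F) :
    univariateEquiv k (C a) = Polynomial.C (C a) := by
  simp [univariateEquiv]

theorem univariateEquiv_pderiv (k : σ) (p : MvPolynomial σ F) :
    univariateEquiv k (pderiv k p) = Polynomial.derivative (univariateEquiv k p) := by
  classical
  induction p using MvPolynomial.induction_on with
  | C a => simp [univariateEquiv_C]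
  | add p q hp hq => simp [hp, hq]
  | mul_X p v hp =>
    by_cases h : v = k
    · subst h
      simp [hp, univariateEquiv_X_self]
      ring
    · simp [hp, univariateEquiv_X_of_ne h, pderiv_X_of_ne h, mul_comm]

theorem not_dvd_pderiv_s9 [CharZero F] {t : σ} {p : MvPolynomial σ F} (h : 0 < p.degreeOf t) :
    ¬ p ∣ pderiv t p := by
  intro hdvd
  rw [← natDegree_univariateEquiv] at h
  have h' := map_dvd (univariateEquiv t) hdvd
  rw [univariateEquiv_pderiv] at h'
  have h0 : univariateEquiv t p ≠ 0 := by rintro h0; simp [h0] at h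
  have := Polynomial.eq_zero_of_dvd_of_degree_lt h' (Polynomial.degree_derivative_lt h0)
  exact h.ne' (Polynomial.derivative_eq_zero.1 this)

theorem not_dvd_of_degreeOf_eq_zero {k : σ} {p c : MvPolynomial σ F} (hp : 0 < p.degreeOf k)
    (hc : c.degreeOf k = 0) (hc0 : c ≠ 0) : ¬ p ∣ c := by
  rintro ⟨e, rfl⟩
  rw [degreeOf_mul_eq (left_ne_zero_of_mul hc0) (right_ne_zero_of_mul hc0)] at hc
  omega

open Classical in
/-- The substitution `X k ↦ X k + a`, fixing all other variables. -/
noncomputable def shiftHom (k : σ) (a : F) : MvPolynomial σ F →ₐ[F] MvPolynomial σ F :=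
  aeval fun v => X v + if v = k then C a else 0

theorem shiftHom_X_self (k : σ) (a : F) : shiftHom k a (X k) = X k + C a := by
  simp [shiftHom]

theorem shiftHom_X_of_ne {k v : σ} (h : v ≠ k) (a : F) : shiftHom k a (X v) = X v := by
  simp [shiftHom, h]

theorem shiftHom_shiftHom (k : σ) (a b : F) (p : MvPolynomial σ F) :
    shiftHom k a (shiftHom k b p) = shiftHom k (a + b) p := by
  rw [← AlgHom.comp_apply]
  congr 1
  ext1 v
  by_cases h : v = k
  · subst h
    simp [shiftHom_X_self, add_assoc]
  · simp [shiftHom_X_of_ne h]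

theorem shiftHom_zero (k : σ) (p : MvPolynomial σ F) : shiftHom k 0 p = p := by
  simp [shiftHom]

/-- The automorphism `X k ↦ X k + a`, fixing all other variables. -/
noncomputable def shiftEquiv (k : σ) (a : F) : MvPolynomial σ F ≃ₐ[F] MvPolynomial σ F :=
  AlgEquiv.ofAlgHom (shiftHom k a) (shiftHom k (-a))
    (AlgHom.ext fun p => by simp [shiftHom_shiftHom, shiftHom_zero])
    (AlgHom.ext fun p => by simp [shiftHom_shiftHom, shiftHom_zero])

theorem shiftHom_dvd_shiftHom_iff (k : σ) (a : F) {p q : MvPolynomial σ F} :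
    shiftHom k a p ∣ shiftHom k a q ↔ p ∣ q :=
  map_dvd_iff (shiftEquiv k a)

theorem irreducible_shiftHom {k : σ} (a : F) {p : MvPolynomial σ F} (hp : Irreducible p) :
    Irreducible (shiftHom k a p) :=
  (MulEquiv.irreducible_iff (shiftEquiv k a)).2 hp

theorem shiftHom_eq_self {k : σ} (a : F) {p : MvPolynomial σ F} (hp : p.degreeOf k = 0) :
    shiftHom k a p = p := by
  classical
  refine hom_congr_vars (f₁ := (shiftHom k a : MvPolynomial σ F →+* MvPolynomial σ F))
    (f₂ := RingHom.id _) (by ext; simp) (fun v hv _ => ?_) rfl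
  have : v ≠ k := by
    rintro rfl
    exact mem_vars_iff_degreeOf_ne_zero.1 hv hp
  simp [shiftHom_X_of_ne this]

theorem pderiv_shiftHom (k t : σ) (a : F) (p : MvPolynomial σ F) :
    pderiv t (shiftHom k a p) = shiftHom k a (pderiv t p) := by
  classical
  induction p using MvPolynomial.induction_on with
  | C a => simp
  | add p q hp hq => simp [hp, hq]
  | mul_X p v hp =>
    have hX : pderiv t (shiftHom k a (X v)) = shiftHom k a (pderiv t (X v)) := by
      have h1 : shiftHom k a (pderiv t (X v)) = pderiv t (X v) := by
        by_cases h : v = t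
        · subst h; simp
        · simp [pderiv_X_of_ne h]
      rw [h1]
      by_cases h : v = k
      · subst h; simp [shiftHom_X_self]
      · rw [shiftHom_X_of_ne h]
    simp only [map_mul, pderiv_mul, hp, hX, map_add]

theorem univariateEquiv_shiftHom (k : σ) (a : F) (p : MvPolynomial σ F) :
    univariateEquiv k (shiftHom k a p) = Polynomial.taylor (C a) (univariateEquiv k p) := by
  induction p using MvPolynomial.induction_on with
  | C a => simp [univariateEquiv_C]
  | add p q hp hq => simp [hp, hq]
  | mul_X p v hp =>
    by_cases h : v = k
    · subst h
      simp [hp, shiftHom_X_self, univariateEquiv_X_self, univariateEquiv_C, Polynomial.taylor_mul]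
    · simp [hp, shiftHom_X_of_ne h, univariateEquiv_X_of_ne h, Polynomial.taylor_mul]

theorem not_shiftHom_dvd_shiftHom [CharZero F] {k : σ} {p : MvPolynomial σ F}
    (hp : 0 < p.degreeOf k) {a b : F} (hab : a ≠ b) : ¬ shiftHom k a p ∣ shiftHom k b p := by
  intro h
  have h' := map_dvd (shiftHom k (-a)) h
  rw [shiftHom_shiftHom, shiftHom_shiftHom, neg_add_cancel, shiftHom_zero] at h'
  have h'' := map_dvd (univariateEquiv k) h'
  rw [univariateEquiv_shiftHom] at h''
  have := Polynomial.eq_zero_of_dvd_taylor (by rwa [natDegree_univariateEquiv]) h''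
  rw [C_eq_zero, neg_add_eq_zero] at this
  exact hab this

end MvPolynomial

/-- **No nonzero operator in `D_1` and `S_1` with coefficients free of `k_1`
annihilates `q + r/d`.**
`F` is a field of characteristic zero, `m, n ≥ 1`; `D_1` is the unique derivation of
`F(t_1, …, t_m, k_1, …, k_n)` extending `∂/∂t_1` and `S_1` is the `F`-algebra
automorphism sending `k_1 ↦ k_1 + 1` and fixing all other variables.  Let `d` be
irreducible with positive degree in `t_1` and in `k_1`, let `r ≠ 0` be not divisible by
`d`, and let `q` be arbitrary.  Then for every finitely supported, not identically zero
family of polynomial coefficients `c_{i,j}` free of `k_1`, the combination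
`Σ_{i,j} c_{i,j}·D_1^i(S_1^j(q + r/d))` is nonzero. -/
theorem no_annihilating_operator
    (F : Type*) [Field F] [CharZero F] (m n : ℕ) (hm : 0 < m) (hn : 0 < n)
    (D₁ : Derivation F (MixedField F m n) (MixedField F m n))
    (hD : ∀ p : MvPolynomial (Fin m ⊕ Fin n) F,
      D₁ (algebraMap (MvPolynomial (Fin m ⊕ Fin n) F) (MixedField F m n) p)
        = algebraMap (MvPolynomial (Fin m ⊕ Fin n) F) (MixedField F m n)
            (pderiv (Sum.inl ⟨0, hm⟩) p))
    (S₁ : MixedField F m n ≃ₐ[F] MixedField F m n)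
    (hS : ∀ v : Fin m ⊕ Fin n,
      S₁ (algebraMap (MvPolynomial (Fin m ⊕ Fin n) F) (MixedField F m n) (X v))
        = algebraMap (MvPolynomial (Fin m ⊕ Fin n) F) (MixedField F m n) (X v)
          + (if v = Sum.inr ⟨0, hn⟩ then 1 else 0))
    (d : MvPolynomial (Fin m ⊕ Fin n) F) (hd : Irreducible d)
    (hdt : 0 < d.degreeOf (Sum.inl ⟨0, hm⟩)) (hdk : 0 < d.degreeOf (Sum.inr ⟨0, hn⟩))
    (r : MvPolynomial (Fin m ⊕ Fin n) F) (hr0 : r ≠ 0) (hrd : ¬ d ∣ r)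
    (q : MvPolynomial (Fin m ⊕ Fin n) F)
    (c : ℕ × ℕ → MvPolynomial (Fin m ⊕ Fin n) F)
    (hcfin : (Function.support c).Finite)
    (hcfree : ∀ p, (c p).degreeOf (Sum.inr ⟨0, hn⟩) = 0)
    (hcne : ∃ p, c p ≠ 0) :
    ∑ᶠ p : ℕ × ℕ,
      algebraMap (MvPolynomial (Fin m ⊕ Fin n) F) (MixedField F m n) (c p) *
        (⇑D₁)^[p.1] ((⇑S₁)^[p.2]
          (algebraMap (MvPolynomial (Fin m ⊕ Fin n) F) (MixedField F m n) q +
           algebraMap (MvPolynomial (Fin m ⊕ Fin n) F) (MixedField F m n) r /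
           algebraMap (MvPolynomial (Fin m ⊕ Fin n) F) (MixedField F m n) d)) ≠ 0 := by
  classical
  set k : Fin m ⊕ Fin n := Sum.inr ⟨0, hn⟩
  set t : Fin m ⊕ Fin n := Sum.inl ⟨0, hm⟩
  set ι := algebraMap (MvPolynomial (Fin m ⊕ Fin n) F) (MixedField F m n)
  have hS1 : ∀ p, S₁ (ι p) = ι (shiftHom k 1 p) := by
    intro p
    have : (S₁ : MixedField F m n →ₐ[F] MixedField F m n).comp
        (IsScalarTower.toAlgHom F (MvPolynomial (Fin m ⊕ Fin n) F) (MixedField F m n)) =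
        (IsScalarTower.toAlgHom F (MvPolynomial (Fin m ⊕ Fin n) F) (MixedField F m n)).comp
          (shiftHom k 1) := by
      ext1 v
      by_cases h : v = k
      · subst h
        simpa [shiftHom_X_self] using hS k
      · simpa [shiftHom_X_of_ne h, h] using hS v
    exact DFunLike.congr_fun this p
  have hSj : ∀ j : ℕ, ∀ p, S₁^[j] (ι p) = ι (shiftHom k (j : F) p) := by
    intro j p
    induction j with
    | zero => simp [shiftHom_zero]
    | succ j ih =>
      rw [Function.iterate_succ_apply', ih, hS1, shiftHom_shiftHom, Nat.cast_succ, add_comm]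
  have hterm : ∀ i j : ℕ, D₁^[i] (S₁^[j] (ι q + ι r / ι d)) =
      ι ((pderiv t)^[i] (shiftHom k (j : F) q)) +
        D₁^[i] (ι (shiftHom k (j : F) r) / ι (shiftHom k (j : F) d)) := by
    intro i j
    rw [iterate_map_add S₁, Function.Semiconj₂.iterate (map_div₀ S₁) j (ι r) (ι d), hSj, hSj, hSj, iterate_map_add D₁,
      iterate_derivation_algebraMap D₁ (pderiv t) hD]
  have hprime : ∀ j : ℕ, Prime (shiftHom k (j : F) d) := fun j =>
    (irreducible_shiftHom _ hd).prime
  have hchar : ∀ j N : ℕ, ¬ shiftHom k (j : F) d ∣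
      ((N + 1 : ℕ) : MvPolynomial (Fin m ⊕ Fin n) F) := by
    intro j N h
    rw [← map_natCast (shiftHom k (j : F)), shiftHom_dvd_shiftHom_iff] at h
    refine not_dvd_of_degreeOf_eq_zero hdk ?_ (Nat.cast_ne_zero.2 N.succ_ne_zero) h
    rw [← map_natCast (C : F →+* MvPolynomial (Fin m ⊕ Fin n) F), degreeOf_C]
  obtain ⟨⟨i₁, j⟩, hij⟩ := hcne
  have hcol : (Function.support fun i => c (i, j)).Finite :=
    hcfin.preimage (f := fun i => (i, j)) (fun _ _ _ _ h => (Prod.ext_iff.1 h).1)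
  obtain ⟨i, hi, hmax⟩ := hcol.exists_maximal ⟨i₁, hij⟩
  have hi : c (i, j) ≠ 0 := hi
  have hmax : ∀ i', c (i', j) ≠ 0 → i' ≤ i := fun i' h' => by
    by_contra hlt
    exact hlt (hmax h' (by omega))
  set p := shiftHom k (j : F) d with hp
  rw [finsum_eq_sum_of_support_subset (s := hcfin.toFinset) _ (fun x hx => by
    simp only [Set.Finite.coe_toFinset, Function.mem_support] at hx ⊢
    rintro h
    simp [h] at hx)]
  rw [← Finset.add_sum_erase _ _ (hcfin.mem_toFinset.2 hi)]
  simp only [hterm]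
  rw [mul_add, add_comm (ι _ * _), add_assoc]
  obtain ⟨a, ha, hna⟩ := exists_iterate_derivation_div D₁ (pderiv t) hD (hprime j) (hchar j)
    (shiftHom k (j : F) r) i
  have hna' : ¬ p ∣ a := hna (by rwa [shiftHom_dvd_shiftHom_iff])
    (by rw [pderiv_shiftHom, shiftHom_dvd_shiftHom_iff]; exact not_dvd_pderiv_s9 hdt)
  have hca : ¬ p ∣ c (i, j) := by
    rw [← shiftHom_eq_self (j : F) (hcfree (i, j)), hp, shiftHom_dvd_shiftHom_iff]
    exact not_dvd_of_degreeOf_eq_zero hdk (hcfree _) hi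
  refine add_ne_zero_of_mem_poleOrderLE (hprime j) (N := i) ((hprime j).not_dvd_mul hca hna')
    (by rw [mul_assoc, ha, map_mul]) ?_
  refine add_mem (by rw [← map_mul]; exact algebraMap_mem_poleOrderLE _ _ _) (sum_mem ?_)
  rintro ⟨i', j'⟩ hmem
  rw [Finset.mem_erase, hcfin.mem_toFinset, Function.mem_support] at hmem
  rw [← Algebra.smul_def]
  refine Submodule.smul_mem _ _ (add_mem (algebraMap_mem_poleOrderLE _ _ _) ?_)
  obtain ⟨a', ha', -⟩ := exists_iterate_derivation_div D₁ (pderiv t) hD (hprime j') (hchar j')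
    (shiftHom k (j' : F) r) i'
  by_cases hj : j' = j
  · subst hj
    have hne : i' ≠ i := fun h => hmem.1 (by rw [h])
    have hle := hmax i' hmem.2
    exact mem_poleOrderLE_of_mul_pow _ (by omega) ha'
  · rw [← map_pow] at ha'
    refine mem_poleOrderLE_of_mul _ (fun h => ?_) ha'
    exact not_shiftHom_dvd_shiftHom hdk (Nat.cast_injective.ne (Ne.symm hj))
      ((hprime j).dvd_of_dvd_pow h)
end
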